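/- Let n ≥ 2, let X ⊂ ℝ^{n+1} be a convex surface, and let ∅ ≠ K ⊆ X be closed. Set d_K(z) := inf_{y ∈ K} dist_X(z, y). Define the multijoined locus M(K) as the set of all x ∈ X for which, with r := d_K(x), there exist two distinct maps γ₁ ≠ γ₂ from [0,r] to X such that for i = 1,2: γ_i(0) = x, γ_i(r) ∈ K, and dist_X(γ_i(s), γ_i(t)) = |s−t| for all s,t ∈ [0,r] (i.e. two different minimal curves from x realizing the distance to K). Then M(K) can be covered by countably many (n−1)-dimensional DC surfaces in ℝ^{n+1}. -/

import Mathlib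

open Set
open scoped NNReal

open Set

/-- `f` is DC on the convex set `C`: a difference of two continuous convex functions on `C`. -/
def IsDCOn {E : Type*} [NormedAddCommGroup E] [NormedSpace ℝ E]
    (C : Set E) (f : E → ℝ) : Prop :=
  ∃ g h : E → ℝ, ConvexOn ℝ C g ∧ ConvexOn ℝ C h ∧
    ContinuousOn g C ∧ ContinuousOn h C ∧ ∀ x ∈ C, f x = g x - h x

/-- A mapping `F : C → F'` is DC if `ℓ ∘ F` is DC for every linear functional `ℓ`. -/
def IsDCMapOn {E F' : Type*} [NormedAddCommGroup E] [NormedSpace ℝ E]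
    [NormedAddCommGroup F'] [NormedSpace ℝ F'] (C : Set E) (F : E → F') : Prop :=
  ∀ ℓ : F' →ₗ[ℝ] ℝ, IsDCOn C (fun x => ℓ (F x))

/-- `F` is locally DC on the open set `U`: every point of `U` has an open convex
neighborhood contained in `U` on which `F` is DC. -/
def LocallyDCMapOn {E F' : Type*} [NormedAddCommGroup E] [NormedSpace ℝ E]
    [NormedAddCommGroup F'] [NormedSpace ℝ F'] (U : Set E) (F : E → F') : Prop :=
  ∀ x ∈ U, ∃ V : Set E, IsOpen V ∧ Convex ℝ V ∧ x ∈ V ∧ V ⊆ U ∧ IsDCMapOn V F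

/-- A `k`-dimensional DC surface: a nonempty set which is locally the graph of a locally DC
mapping from (an open subset of) a `k`-dimensional linear subspace `Q` to `Qᗮ`. -/
def IsDCSurface {E : Type*} [NormedAddCommGroup E] [InnerProductSpace ℝ E]
    (k : ℕ) (T : Set E) : Prop :=
  T.Nonempty ∧ ∀ x ∈ T, ∃ Q : Submodule ℝ E, Module.finrank ℝ Q = k ∧
    ∃ W : Set E, IsOpen W ∧ x ∈ W ∧ ∃ G : Set Q, IsOpen G ∧
      ∃ h : Q → Qᗮ, LocallyDCMapOn G h ∧
        T ∩ W = (fun u : Q => (u : E) + ((h u : Qᗮ) : E)) '' G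

/-- A convex body: a compact convex set with nonempty interior. -/
def IsConvexBody {E : Type*} [NormedAddCommGroup E] [NormedSpace ℝ E] (C : Set E) : Prop :=
  IsCompact C ∧ Convex ℝ C ∧ (interior C).Nonempty

/-- A convex surface: the boundary of a convex body. -/
def IsConvexSurface {E : Type*} [NormedAddCommGroup E] [NormedSpace ℝ E] (X : Set E) : Prop :=
  ∃ C : Set E, IsConvexBody C ∧ X = frontier C

/-- The intrinsic distance on `X ⊆ E`: the infimum of lengths (total variations) of
continuous curves `γ : [0,1] → E` joining `a` and `b` within `X`. -/
noncomputable def intrinsicDist {E : Type*} [NormedAddCommGroup E] [NormedSpace ℝ E]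
    (X : Set E) (a b : E) : ℝ :=
  (⨅ γ : {γ : ℝ → E // ContinuousOn γ (Set.Icc 0 1) ∧ γ 0 = a ∧ γ 1 = b ∧
      Set.MapsTo γ (Set.Icc 0 1) X},
    eVariationOn γ.1 (Set.Icc 0 1)).toReal

/-- A minimal curve from `x` to the closed set `K` within `X`, realizing the intrinsic
distance `r` from `x` to `K`: an arclength-parametrized shortest curve (with respect to
the intrinsic distance of `X`) defined on `[0,r]`, starting at `x` and ending in `K`. -/
def IsMinimizingCurveToSet {E : Type*} [NormedAddCommGroup E] [NormedSpace ℝ E]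
    (X K : Set E) (x : E) (r : ℝ) (γ : ℝ → E) : Prop :=
  MapsTo γ (Icc 0 r) X ∧ γ 0 = x ∧ γ r ∈ K ∧
    ∀ s ∈ Icc 0 r, ∀ t ∈ Icc 0 r, intrinsicDist X (γ s) (γ t) = |s - t|

set_option linter.unusedSectionVars false

local notation "⟪" x ", " y "⟫" => inner ℝ x y

section Curves

variable {E : Type*} [NormedAddCommGroup E] [NormedSpace ℝ E]

/-- `a` and `b` are joined inside `S` by a continuous curve of length at most `L`. -/
def JoinedWithin (S : Set E) (a b : E) (L : ℝ) : Prop :=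
  0 ≤ L ∧ ∃ γ : ℝ → E, ContinuousOn γ (Icc 0 1) ∧ γ 0 = a ∧ γ 1 = b ∧
    MapsTo γ (Icc 0 1) S ∧ eVariationOn γ (Icc 0 1) ≤ ENNReal.ofReal L

/-- The real-valued infimum of the lengths of curves joining `a` and `b` inside `S`. -/
noncomputable def pathDist (S : Set E) (a b : E) : ℝ := sInf {L | JoinedWithin S a b L}

/-- Any two points of `S` are joined by a curve of finite length in `S`. -/
def LengthConnected (S : Set E) : Prop := ∀ a ∈ S, ∀ b ∈ S, ∃ L, JoinedWithin S a b L

theorem JoinedWithin.of_curve {S : Set E} {γ : ℝ → E} {u v L : ℝ} (huv : u ≤ v) (hL : 0 ≤ L)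
    (hc : ContinuousOn γ (Icc u v)) (hm : MapsTo γ (Icc u v) S)
    (hv : eVariationOn γ (Icc u v) ≤ ENNReal.ofReal L) : JoinedWithin S (γ u) (γ v) L := by
  have hmap : MapsTo (fun t : ℝ => u + t * (v - u)) (Icc 0 1) (Icc u v) := by
    intro t ht
    constructor <;> nlinarith [ht.1, ht.2, sub_nonneg.2 huv]
  refine ⟨hL, fun t => γ (u + t * (v - u)), ?_, by simp, by simp, fun t ht => hm (hmap ht), ?_⟩
  · exact hc.comp (by fun_prop) hmap
  · refine le_trans (eVariationOn.comp_le_of_monotoneOn γ (fun t : ℝ => u + t * (v - u)) ?_ hmap) hv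
    intro s _ t _ hst
    have := sub_nonneg.2 huv
    simp only
    nlinarith

theorem JoinedWithin.mono {S T : Set E} (h : S ⊆ T) {a b : E} {L : ℝ}
    (hJ : JoinedWithin S a b L) : JoinedWithin T a b L := by
  obtain ⟨h0, γ, h1, h2, h3, h4, h5⟩ := hJ
  exact ⟨h0, γ, h1, h2, h3, h4.mono_right h, h5⟩

theorem JoinedWithin.trans {S : Set E} {a b c : E} {L L' : ℝ}
    (h : JoinedWithin S a b L) (h' : JoinedWithin S b c L') : JoinedWithin S a c (L + L') := by
  obtain ⟨h0, γ, h1, h2, h3, h4, h5⟩ := h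
  obtain ⟨h0', γ', h1', h2', h3', h4', h5'⟩ := h'
  let δ : ℝ → E := fun t => if t ≤ 1 then γ t else γ' (t - 1)
  have e1 : EqOn δ γ (Icc 0 1) := fun t ht => by simp [δ, ht.2]
  have e2 : EqOn δ (γ' ∘ fun t => t - 1) (Icc 1 2) := by
    intro t ht
    rcases eq_or_lt_of_le ht.1 with h | h
    · simp [δ, ← h, h3, h2']
    · simp [δ, not_le.2 h]
  have hm : MapsTo (fun t : ℝ => t - 1) (Icc 1 2) (Icc 0 1) := by
    intro t ht
    constructor <;> linarith [ht.1, ht.2]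
  have hun : Icc (0 : ℝ) 2 = Icc 0 1 ∪ Icc 1 2 :=
    (Icc_union_Icc_eq_Icc (by norm_num) (by norm_num)).symm
  have c1 : ContinuousOn δ (Icc 0 1) := h1.congr e1
  have c2 : ContinuousOn δ (Icc 1 2) :=
    (h1'.comp (by fun_prop) hm).congr e2
  have := JoinedWithin.of_curve (S := S) (γ := δ) (u := 0) (v := 2) (L := L + L') (by norm_num)
    (add_nonneg h0 h0') (by rw [hun]; exact c1.union_of_isClosed c2 isClosed_Icc isClosed_Icc) ?_ ?_
  · have ea : δ 0 = a := by simp [δ, h2]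
    have ec : δ 2 = c := by
      have : (2 : ℝ) - 1 = 1 := by norm_num
      simp [δ, this, h3']
    rwa [ea, ec] at this
  · rw [hun]
    rintro t (ht | ht)
    · rw [e1 ht]; exact h4 ht
    · rw [e2 ht]; exact h4' (hm ht)
  · have hh := eVariationOn.Icc_add_Icc δ (s := univ) (a := 0) (b := 1) (c := 2)
      (by norm_num) (by norm_num)
      (mem_univ _)
    simp only [univ_inter] at hh
    rw [← hh, eVariationOn.congr e1, eVariationOn.congr e2, ENNReal.ofReal_add h0 h0']
    refine add_le_add h5 (le_trans (eVariationOn.comp_le_of_monotoneOn γ' _ ?_ hm) h5')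
    intro s _ t _ hst
    simp only; linarith

theorem JoinedWithin.symm {S : Set E} {a b : E} {L : ℝ} (h : JoinedWithin S a b L) :
    JoinedWithin S b a L := by
  obtain ⟨h0, γ, h1, h2, h3, h4, h5⟩ := h
  have hm : MapsTo (fun t : ℝ => 1 - t) (Icc 0 1) (Icc 0 1) := by
    intro t ht
    constructor <;> linarith [ht.1, ht.2]
  refine ⟨h0, γ ∘ fun t => 1 - t, h1.comp (by fun_prop) hm, by simp [h3], by simp [h2],
    h4.comp hm, le_trans (eVariationOn.comp_le_of_antitoneOn γ _ ?_ hm) h5⟩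
  intro s _ t _ hst
  simp only; linarith

theorem JoinedWithin.map {F : Type*} [NormedAddCommGroup F] [NormedSpace ℝ F]
    {S : Set E} {T : Set F} {f : E → F} {k : ℝ≥0} (hf : LipschitzOnWith k f S)
    (hST : MapsTo f S T) {a b : E} {L : ℝ} (h : JoinedWithin S a b L) :
    JoinedWithin T (f a) (f b) (k * L) := by
  obtain ⟨h0, γ, h1, h2, h3, h4, h5⟩ := h
  refine ⟨by positivity, f ∘ γ, hf.continuousOn.comp h1 h4, by simp [h2], by simp [h3],
    hST.comp h4, (hf.comp_eVariationOn_le h4).trans ?_⟩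
  have hk : (k : ENNReal) * ENNReal.ofReal L = ENNReal.ofReal (k * L) := by
    rw [ENNReal.ofReal_mul k.coe_nonneg, ENNReal.ofReal_coe_nnreal]
  rw [← hk]
  gcongr

theorem JoinedWithin.norm_sub_le {S : Set E} {a b : E} {L : ℝ} (h : JoinedWithin S a b L) :
    ‖a - b‖ ≤ L := by
  obtain ⟨h0, γ, h1, h2, h3, h4, h5⟩ := h
  have := (eVariationOn.edist_le γ (s := Icc 0 1) (x := 0) (y := 1) (by simp) (by simp)).trans h5
  rw [h2, h3, edist_dist] at this
  rw [← dist_eq_norm]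
  exact (ENNReal.ofReal_le_ofReal_iff h0).1 this

theorem JoinedWithin.segment {S : Set E} {a b : E} (h : segment ℝ a b ⊆ S) :
    JoinedWithin S a b ‖a - b‖ := by
  have hl : LipschitzOnWith ‖b - a‖₊ (fun t : ℝ => a + t • (b - a))
      (Icc 0 1) := by
    apply LipschitzWith.lipschitzOnWith
    apply LipschitzWith.of_dist_le_mul
    intro s t
    rw [dist_eq_norm, dist_eq_norm, add_sub_add_left_eq_sub, ← sub_smul, norm_smul, mul_comm]
    rfl
  have hid : JoinedWithin (Icc (0 : ℝ) 1) (0 : ℝ) 1 1 := by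
    refine ⟨zero_le_one, id, continuousOn_id, rfl, rfl, mapsTo_id _, ?_⟩
    have := (monotoneOn_id (s := Icc (0 : ℝ) 1)).eVariationOn_eq (a := 0) (b := 1)
      (by simp) (by simp)
    simp at this
    simp
  have := hid.map hl (T := S) ?_
  · simp only [zero_smul, add_zero, one_smul, add_sub_cancel, mul_one, coe_nnnorm] at this
    rwa [norm_sub_rev] at this
  · intro t ht
    apply h
    rw [segment_eq_image']
    exact ⟨t, ht, rfl⟩

theorem JoinedWithin.refl {S : Set E} {a : E} (h : a ∈ S) : JoinedWithin S a a 0 := by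
  have := JoinedWithin.segment (S := S) (a := a) (b := a) (by simpa using h)
  simpa using this

theorem bddBelow_joinedWithin (S : Set E) (a b : E) : BddBelow {L | JoinedWithin S a b L} :=
  ⟨0, fun _ h => h.1⟩

theorem pathDist_nonneg (S : Set E) (a b : E) : 0 ≤ pathDist S a b :=
  Real.sInf_nonneg fun _ h => h.1

theorem JoinedWithin.pathDist_le {S : Set E} {a b : E} {L : ℝ} (h : JoinedWithin S a b L) :
    pathDist S a b ≤ L := csInf_le (bddBelow_joinedWithin S a b) h

theorem pathDist_le_of_segment {S : Set E} {a b : E} (h : segment ℝ a b ⊆ S) :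
    pathDist S a b ≤ ‖a - b‖ := (JoinedWithin.segment h).pathDist_le

theorem pathDist_self {S : Set E} {a : E} (h : a ∈ S) : pathDist S a a = 0 :=
  le_antisymm (JoinedWithin.refl h).pathDist_le (pathDist_nonneg _ _ _)

theorem pathDist_comm (S : Set E) (a b : E) : pathDist S a b = pathDist S b a := by
  unfold pathDist
  congr 1
  ext L
  exact ⟨fun h => h.symm, fun h => h.symm⟩

theorem LengthConnected.exists_lt {S : Set E} (hS : LengthConnected S) {a b : E} (ha : a ∈ S)
    (hb : b ∈ S) {c : ℝ} (hc : pathDist S a b < c) : ∃ L, L < c ∧ JoinedWithin S a b L := by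
  obtain ⟨L, hL, h⟩ := exists_lt_of_csInf_lt (hS a ha b hb) hc
  exact ⟨L, h, hL⟩

theorem LengthConnected.le_pathDist {S : Set E} (hS : LengthConnected S) {a b : E} (ha : a ∈ S)
    (hb : b ∈ S) {c : ℝ} (hc : ∀ L, JoinedWithin S a b L → c ≤ L) : c ≤ pathDist S a b :=
  le_csInf (hS a ha b hb) hc

theorem LengthConnected.norm_sub_le {S : Set E} (hS : LengthConnected S) {a b : E} (ha : a ∈ S)
    (hb : b ∈ S) : ‖a - b‖ ≤ pathDist S a b :=
  hS.le_pathDist ha hb fun _ h => h.norm_sub_le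

theorem LengthConnected.triangle {S : Set E} (hS : LengthConnected S) {a b c : E} (ha : a ∈ S)
    (hb : b ∈ S) (hc : c ∈ S) : pathDist S a c ≤ pathDist S a b + pathDist S b c := by
  apply le_of_forall_pos_le_add
  intro ε hε
  obtain ⟨L, hL, h⟩ := hS.exists_lt ha hb (lt_add_of_pos_right (pathDist S a b) (half_pos hε))
  obtain ⟨L', hL', h'⟩ := hS.exists_lt hb hc (lt_add_of_pos_right (pathDist S b c) (half_pos hε))
  linarith [(h.trans h').pathDist_le]

theorem LengthConnected.pathDist_mono {S T : Set E} (hS : LengthConnected S) (h : S ⊆ T) {a b : E}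
    (ha : a ∈ S) (hb : b ∈ S) : pathDist T a b ≤ pathDist S a b :=
  hS.le_pathDist ha hb fun _ hL => (hL.mono h).pathDist_le

theorem LengthConnected.pathDist_map_le {F : Type*} [NormedAddCommGroup F] [NormedSpace ℝ F]
    {S : Set E} (hS : LengthConnected S)
    {T : Set F} {f : E → F} {k : ℝ≥0} (hf : LipschitzOnWith k f S)
    (hST : MapsTo f S T) {a b : E} (ha : a ∈ S) (hb : b ∈ S) :
    pathDist T (f a) (f b) ≤ k * pathDist S a b := by
  rcases eq_or_ne k 0 with rfl | hk
  · obtain ⟨L, hL⟩ := hS a ha b hb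
    simpa using (hL.map hf hST).pathDist_le
  · have hk' : (0 : ℝ) < k := by positivity
    rw [← div_le_iff₀' hk']
    refine hS.le_pathDist ha hb fun L hL => ?_
    rw [div_le_iff₀' hk']
    exact (hL.map hf hST).pathDist_le

theorem LengthConnected.map {S T : Set E} (hS : LengthConnected S) {f : E → E} {k : ℝ≥0}
    (hf : LipschitzOnWith k f S) (hST : MapsTo f S T) (hsurj : ∀ b ∈ T, ∃ a ∈ S, f a = b) :
    LengthConnected T := by
  intro a ha b hb
  obtain ⟨a', ha', rfl⟩ := hsurj a ha
  obtain ⟨b', hb', rfl⟩ := hsurj b hb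
  obtain ⟨L, hL⟩ := hS a' ha' b' hb'
  exact ⟨_, hL.map hf hST⟩

end Curves

section IntrinsicDist

variable {E : Type*} [NormedAddCommGroup E] [NormedSpace ℝ E]

theorem LengthConnected.intrinsicDist_eq {S : Set E} (hS : LengthConnected S) {a b : E}
    (ha : a ∈ S) (hb : b ∈ S) : intrinsicDist S a b = pathDist S a b := by
  have hle : ∀ L, JoinedWithin S a b L →
      (⨅ γ : {γ : ℝ → E // ContinuousOn γ (Set.Icc 0 1) ∧ γ 0 = a ∧ γ 1 = b ∧
      Set.MapsTo γ (Set.Icc 0 1) S}, eVariationOn γ.1 (Set.Icc 0 1)) ≤ ENNReal.ofReal L := by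
    rintro L ⟨h0, γ, h1, h2, h3, h4, h5⟩
    exact (iInf_le _ ⟨γ, h1, h2, h3, h4⟩).trans h5
  obtain ⟨L₀, hL₀⟩ := hS a ha b hb
  apply le_antisymm
  · refine hS.le_pathDist ha hb fun L hL => ?_
    exact ENNReal.toReal_le_of_le_ofReal hL.1 (hle L hL)
  · unfold intrinsicDist
    rw [← ENNReal.ofReal_le_iff_le_toReal (ne_top_of_le_ne_top ENNReal.ofReal_ne_top (hle L₀ hL₀))]
    refine le_iInf fun γ => ?_
    by_cases htop : eVariationOn γ.1 (Set.Icc 0 1) = ⊤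
    · rw [htop]; exact le_top
    · have : JoinedWithin S a b (eVariationOn γ.1 (Set.Icc 0 1)).toReal :=
        ⟨ENNReal.toReal_nonneg, γ.1, γ.2.1, γ.2.2.1, γ.2.2.2.1, γ.2.2.2.2,
          (ENNReal.ofReal_toReal htop).ge⟩
      rw [← ENNReal.ofReal_toReal htop]
      exact ENNReal.ofReal_le_ofReal this.pathDist_le

end IntrinsicDist

section Exterior

variable {E : Type*} [NormedAddCommGroup E] [NormedSpace ℝ E]

theorem Convex.radial_notMem_interior {C : Set E} (hC : Convex ℝ C) {c a : E}
    (hc : c ∈ interior C) (ha : a ∉ interior C) {l : ℝ} (hl : 1 ≤ l) :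
    c + l • (a - c) ∉ interior C := by
  intro h
  apply ha
  have hl0 : 0 < l := by linarith
  have hi := hC.interior
  have := hi hc h (a := 1 - 1 / l) (b := 1 / l) (by rw [sub_nonneg, div_le_one hl0]; exact hl)
    (by positivity) (by ring)
  convert this using 1
  rw [smul_add, smul_smul, one_div, inv_mul_cancel₀ hl0.ne', one_smul, sub_smul, one_smul]
  abel

theorem Convex.radial_segment_subset {C : Set E} (hC : Convex ℝ C) {c a : E}
    (hc : c ∈ interior C) (ha : a ∉ interior C) {l : ℝ} (hl : 1 ≤ l) :
    segment ℝ a (c + l • (a - c)) ⊆ (interior C)ᶜ := by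
  rw [segment_eq_image']
  rintro _ ⟨t, ht, rfl⟩
  have : a + t • (c + l • (a - c) - a) = c + (1 + t * (l - 1)) • (a - c) := by module
  simp only
  rw [this]
  exact hC.radial_notMem_interior hc ha (by nlinarith [ht.1])

end Exterior

section Body

variable {E : Type*} [NormedAddCommGroup E] [InnerProductSpace ℝ E]

theorem halfSpace_convex (w : E) (r : ℝ) : Convex ℝ {y : E | r ≤ ⟪w, y⟫} := by
  intro x hx y hy a b ha hb hab
  simp only [mem_ofPred_eq] at *
  rw [inner_add_right, inner_smul_right, inner_smul_right]
  have : b = 1 - a := by linarith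
  subst this
  nlinarith

theorem halfSpace_convex' (w : E) (r : ℝ) : Convex ℝ {y : E | ⟪w, y⟫ ≤ r} := by
  intro x hx y hy a b ha hb hab
  simp only [mem_ofPred_eq] at *
  rw [inner_add_right, inner_smul_right, inner_smul_right]
  have : b = 1 - a := by linarith
  subst this
  nlinarith

theorem exists_unit_orthogonal [FiniteDimensional ℝ E] (h2 : 2 ≤ Module.finrank ℝ E) (a : E) :
    ∃ w : E, ‖w‖ = 1 ∧ ⟪w, a⟫ = 0 := by
  have hne : (ℝ ∙ a)ᗮ ≠ ⊥ := by
    intro h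
    have h1 := Submodule.finrank_add_finrank_orthogonal (ℝ ∙ a)
    rw [h, finrank_bot] at h1
    have h3 : Module.finrank ℝ (ℝ ∙ a) ≤ 1 := by
      simpa using finrank_span_le_card (R := ℝ) ({a} : Set E)
    omega
  obtain ⟨v, hv, hv0⟩ := Submodule.exists_mem_ne_zero_of_ne_bot hne
  refine ⟨(‖v‖⁻¹ : ℝ) • v, ?_, ?_⟩
  · rw [norm_smul, norm_inv, norm_norm, inv_mul_cancel₀ (norm_ne_zero_iff.2 hv0)]
  · rw [inner_smul_left, Submodule.mem_orthogonal_singleton_iff_inner_left.1 hv, mul_zero]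

theorem lengthConnected_compl_interior [FiniteDimensional ℝ E] (h2 : 2 ≤ Module.finrank ℝ E)
    {C : Set E} (hC : Convex ℝ C) (hb : Bornology.IsBounded C) (hne : (interior C).Nonempty) :
    LengthConnected (interior C)ᶜ := by
  obtain ⟨c, hc⟩ := hne
  obtain ⟨R, hR0, hR⟩ := hb.subset_ball_lt 0 c
  have far : ∀ y : E, R ≤ ‖y - c‖ → y ∈ (interior C)ᶜ := by
    intro y hy h
    have := hR (interior_subset h)
    rw [Metric.mem_ball, dist_eq_norm] at this
    linarith
  intro a ha b hb
  have radial : ∀ y ∈ (interior C)ᶜ, ∃ l : ℝ, 0 < l ∧ R ≤ ‖l • (y - c)‖ ∧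
      segment ℝ y (c + l • (y - c)) ⊆ (interior C)ᶜ := by
    intro y hy
    have hy0 : 0 < ‖y - c‖ := by
      rw [norm_pos_iff, sub_ne_zero]
      rintro rfl
      exact hy hc
    refine ⟨max 1 (R / ‖y - c‖), by positivity, ?_,
      hC.radial_segment_subset hc hy (le_max_left _ _)⟩
    rw [norm_smul, Real.norm_of_nonneg (by positivity), ← div_le_iff₀ hy0]
    exact le_max_right _ _
  obtain ⟨la, hla, hRa, hsa⟩ := radial a ha
  obtain ⟨lb, hlb, hRb, hsb⟩ := radial b hb
  obtain ⟨w, hw1, hwa, hwb⟩ : ∃ w : E, ‖w‖ = 1 ∧ ⟪w, a - c⟫ = 0 ∧ 0 ≤ ⟪w, b - c⟫ := by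
    obtain ⟨w, hw1, hwa⟩ := exists_unit_orthogonal h2 (a - c)
    rcases le_total 0 ⟪w, b - c⟫ with h | h
    · exact ⟨w, hw1, hwa, h⟩
    · exact ⟨-w, by simpa using hw1, by simp [hwa], by simpa using h⟩
  have up : ∀ u : E, R ≤ ‖u‖ → 0 ≤ ⟪w, u⟫ → segment ℝ (c + u) (c + u + R • w) ⊆ (interior C)ᶜ := by
    intro u hu hwu
    rw [segment_eq_image']
    rintro _ ⟨t, ht, rfl⟩
    apply far
    have e : c + u + t • (c + u + R • w - (c + u)) - c = u + (t * R) • w := by module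
    simp only
    rw [e]
    refine hu.trans ?_
    have : ‖u‖ ^ 2 ≤ ‖u + (t * R) • w‖ ^ 2 := by
      rw [norm_add_sq_real, inner_smul_right, real_inner_comm]
      have : 0 ≤ t * R := mul_nonneg ht.1 hR0.le
      nlinarith [sq_nonneg ‖(t * R) • w‖, mul_nonneg this hwu]
    exact (sq_le_sq₀ (norm_nonneg _) (norm_nonneg _)).1 this
  have s1 := up (la • (a - c)) hRa (by rw [inner_smul_right, hwa, mul_zero])
  have s2 := up (lb • (b - c)) hRb (by rw [inner_smul_right]; positivity)
  have mid : segment ℝ (c + la • (a - c) + R • w) (c + lb • (b - c) + R • w)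
      ⊆ (interior C)ᶜ := by
    have hww : ⟪w, w⟫ = 1 := by rw [real_inner_self_eq_norm_sq, hw1]; norm_num
    refine ((halfSpace_convex w (⟪w, c⟫ + R)).segment_subset ?_ ?_).trans ?_
    · simp only [mem_ofPred_eq, inner_add_right, inner_smul_right, hwa, hww]
      linarith
    · simp only [mem_ofPred_eq, inner_add_right, inner_smul_right, hww]
      nlinarith [mul_nonneg hlb.le hwb]
    · intro y hy
      apply far
      have h1 : R ≤ ⟪w, y - c⟫ := by
        rw [inner_sub_right]
        simp only [mem_ofPred_eq] at hy
        linarith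
      have := real_inner_le_norm w (y - c)
      rw [hw1, one_mul] at this
      linarith
  exact ⟨_, ((((JoinedWithin.segment hsa).trans (JoinedWithin.segment s1)).trans
    (JoinedWithin.segment mid)).trans (JoinedWithin.segment s2).symm).trans
    (JoinedWithin.segment hsb).symm⟩

/-- The nearest-point retraction onto a closed convex set. -/
theorem exists_nearest_retraction [CompleteSpace E] {C : Set E} (hC : Convex ℝ C)
    (hcl : IsClosed C) (hne : C.Nonempty) :
    ∃ f : E → E, LipschitzWith 1 f ∧ (∀ y, f y ∈ C) ∧ (∀ y ∈ C, f y = y) ∧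
      ∀ y, ∀ w ∈ C, ⟪y - f y, w - f y⟫ ≤ 0 := by
  have h : ∀ y : E, ∃ p ∈ C, ∀ w ∈ C, ⟪y - p, w - p⟫ ≤ 0 := by
    intro y
    obtain ⟨p, hp, hmin⟩ := exists_norm_eq_iInf_of_complete_convex hne hcl.isComplete hC y
    exact ⟨p, hp, (norm_eq_iInf_iff_real_inner_le_zero hC hp).1 hmin⟩
  choose f hf1 hf2 using h
  refine ⟨f, ?_, hf1, ?_, hf2⟩
  · apply LipschitzWith.of_dist_le_mul
    intro y z
    rw [NNReal.coe_one, one_mul, dist_eq_norm, dist_eq_norm]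
    have h1 := hf2 y (f z) (hf1 z)
    have h2 := hf2 z (f y) (hf1 y)
    have h3 : ‖f y - f z‖ ^ 2 ≤ ⟪y - z, f y - f z⟫ := by
      rw [← real_inner_self_eq_norm_sq]
      have e1 : ⟪y - f y, f z - f y⟫ = - ⟪y - f y, f y - f z⟫ := by
        rw [← inner_neg_right, neg_sub]
      have e2 : ⟪y - z, f y - f z⟫ - ⟪f y - f z, f y - f z⟫
          = ⟪y - f y, f y - f z⟫ - ⟪z - f z, f y - f z⟫ := by
        rw [← inner_sub_left, ← inner_sub_left]
        congr 1
        abel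
      linarith
    have h4 := h3.trans (real_inner_le_norm _ _)
    rcases (norm_nonneg (f y - f z)).eq_or_lt with h | h
    · rw [← h]; positivity
    · nlinarith
  · intro y hy
    have := hf2 y y hy
    rw [real_inner_self_eq_norm_sq] at this
    have : ‖y - f y‖ = 0 := by nlinarith [norm_nonneg (y - f y)]
    exact (sub_eq_zero.1 (norm_eq_zero.1 this)).symm

theorem exists_exterior_retraction [CompleteSpace E] {C : Set E} (hC : Convex ℝ C)
    (hcl : IsClosed C) (hne : C.Nonempty) :
    ∃ f : E → E, LipschitzWith 1 f ∧ (∀ y ∈ C, f y = y) ∧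
      MapsTo f (interior C)ᶜ (frontier C) := by
  obtain ⟨f, h1, h2, h3, h4⟩ := exists_nearest_retraction hC hcl hne
  refine ⟨f, h1, h3, fun y hy => ?_⟩
  rw [hcl.frontier_eq]
  refine ⟨h2 y, fun hi => ?_⟩
  by_cases hyC : y ∈ C
  · exact hy (h3 y hyC ▸ hi)
  · have hne : f y ≠ y := fun h => hyC (h ▸ h2 y)
    have hcont : ContinuousAt (fun t : ℝ => f y + t • (y - f y)) 0 := by fun_prop
    have : ∀ᶠ t : ℝ in nhds 0, f y + t • (y - f y) ∈ C := by
      apply hcont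
      simp only [zero_smul, add_zero]
      exact mem_interior_iff_mem_nhds.1 hi
    obtain ⟨ε, hε, hball⟩ := Metric.eventually_nhds_iff.1 this
    have hm := h4 y _ (hball (y := ε / 2) (by
      rw [Real.dist_eq, sub_zero, abs_of_pos (half_pos hε)]; linarith))
    rw [add_sub_cancel_left, inner_smul_right, real_inner_self_eq_norm_sq] at hm
    have : 0 < ‖y - f y‖ := norm_pos_iff.2 (sub_ne_zero.2 hne.symm)
    have : 0 < ε / 2 * ‖y - f y‖ ^ 2 := by positivity
    linarith

theorem frontier_subset_compl_interior (C : Set E) : frontier C ⊆ (interior C)ᶜ :=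
  fun _ h => h.2

variable [FiniteDimensional ℝ E]

theorem lengthConnected_frontier (h2 : 2 ≤ Module.finrank ℝ E) {C : Set E}
    (hC : IsConvexBody C) : LengthConnected (frontier C) := by
  obtain ⟨f, h1, h3, h4⟩ := exists_exterior_retraction hC.2.1 hC.1.isClosed
    (hC.2.2.mono interior_subset)
  refine (lengthConnected_compl_interior h2 hC.2.1 hC.1.isBounded hC.2.2).map
    h1.lipschitzOnWith h4 fun b hb => ⟨b, hb.2, h3 b ?_⟩
  exact hC.1.isClosed.frontier_subset hb

theorem pathDist_frontier_eq (h2 : 2 ≤ Module.finrank ℝ E) {C : Set E}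
    (hC : IsConvexBody C) {a b : E} (ha : a ∈ frontier C) (hb : b ∈ frontier C) :
    pathDist (frontier C) a b = pathDist (interior C)ᶜ a b := by
  obtain ⟨f, h1, h3, h4⟩ := exists_exterior_retraction hC.2.1 hC.1.isClosed
    (hC.2.2.mono interior_subset)
  apply le_antisymm
  · have := (lengthConnected_compl_interior h2 hC.2.1 hC.1.isBounded hC.2.2).pathDist_map_le
      (h1.lipschitzOnWith (s := (interior C)ᶜ)) h4 ha.2 hb.2
    rwa [h3 a (hC.1.isClosed.frontier_subset ha), h3 b (hC.1.isClosed.frontier_subset hb),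
      NNReal.coe_one, one_mul] at this
  · exact (lengthConnected_frontier h2 hC).pathDist_mono (frontier_subset_compl_interior C) ha hb

theorem intrinsicDist_frontier_eq (h2 : 2 ≤ Module.finrank ℝ E) {C : Set E}
    (hC : IsConvexBody C) {a b : E} (ha : a ∈ frontier C) (hb : b ∈ frontier C) :
    intrinsicDist (frontier C) a b = pathDist (interior C)ᶜ a b := by
  rw [(lengthConnected_frontier h2 hC).intrinsicDist_eq ha hb, pathDist_frontier_eq h2 hC ha hb]

end Body

section Chains

variable {E : Type*} [NormedAddCommGroup E] [NormedSpace ℝ E] {ι : Type*}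

/-- A polygonal chain of `m` segments from `a` to `b`, of total length `L`, each segment having
both endpoints in one of the sets `A j`. -/
def SegmentChain (A : ι → Set E) : ℕ → E → E → ℝ → Prop
  | 0, a, b, L => a = b ∧ L = 0
  | m + 1, a, b, L => ∃ j z L', a ∈ A j ∧ z ∈ A j ∧ SegmentChain A m z b L' ∧ L = ‖a - z‖ + L'

theorem SegmentChain.nonneg {A : ι → Set E} : ∀ {m : ℕ} {a b : E} {L : ℝ},
    SegmentChain A m a b L → 0 ≤ L
  | 0, _, _, _, h => h.2.ge
  | m + 1, a, b, L, ⟨j, z, L', _, _, h, e⟩ => by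
    have := h.nonneg
    rw [e]; positivity

theorem SegmentChain.joinedWithin {A : ι → Set E} (hA : ∀ j, Convex ℝ (A j)) {S : Set E}
    (hS : ∀ j, A j ⊆ S) : ∀ {m : ℕ} {a b : E} {L : ℝ},
    SegmentChain A m a b L → a ∈ S → JoinedWithin S a b L
  | 0, a, b, L, h, ha => by
    obtain ⟨rfl, rfl⟩ := h
    exact JoinedWithin.refl ha
  | m + 1, a, b, L, ⟨j, z, L', haj, hzj, h, e⟩, _ => by
    rw [e]
    exact (JoinedWithin.segment (((hA j).segment_subset haj hzj).trans (hS j))).trans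
      (h.joinedWithin hA hS (hS j hzj))

theorem SegmentChain.pad {A : ι → Set E} {m : ℕ} {a b : E} {L : ℝ} (h : SegmentChain A m a b L)
    (ha : ∃ j, a ∈ A j) (k : ℕ) : SegmentChain A (m + k) a b L := by
  induction k with
  | zero => exact h
  | succ k ih =>
    obtain ⟨j, hj⟩ := ha
    exact ⟨j, a, L, hj, hj, ih, by simp⟩

theorem exists_segmentChain_of_curve {A : ι → Set E} (hcl : ∀ j, IsClosed (A j)) :
    ∀ (n : ℕ) (s : Finset ι), s.card = n → ∀ (γ : ℝ → E) (u v : ℝ), u ≤ v →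
      ContinuousOn γ (Icc u v) → (∀ t ∈ Icc u v, ∃ j ∈ s, γ t ∈ A j) →
      ∃ L, SegmentChain A n (γ u) (γ v) L ∧ ENNReal.ofReal L ≤ eVariationOn γ (Icc u v) := by
  classical
  intro n
  induction n with
  | zero =>
    intro s hs γ u v huv _ h
    obtain ⟨j, hj, _⟩ := h u (left_mem_Icc.2 huv)
    simp [Finset.card_eq_zero.1 hs] at hj
  | succ n ih =>
    intro s hs γ u v huv hc h
    obtain ⟨j, hj, hju⟩ := h u (left_mem_Icc.2 huv)
    have hTc : IsCompact (Icc u v ∩ γ ⁻¹' A j) :=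
      isCompact_Icc.of_isClosed_subset (hc.preimage_isClosed_of_isClosed isClosed_Icc (hcl j))
        inter_subset_left
    obtain ⟨t, ⟨ht, htj⟩, hmax⟩ := hTc.exists_isGreatest ⟨u, left_mem_Icc.2 huv, hju⟩
    have hvar : eVariationOn γ (Icc u t) + eVariationOn γ (Icc t v) = eVariationOn γ (Icc u v) := by
      have := eVariationOn.Icc_add_Icc γ (s := univ) ht.1 ht.2 (mem_univ _)
      simpa only [univ_inter] using this
    have hedge : ENNReal.ofReal ‖γ u - γ t‖ ≤ eVariationOn γ (Icc u t) := by
      have := eVariationOn.edist_le γ (left_mem_Icc.2 ht.1) (right_mem_Icc.2 ht.1)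
      rwa [edist_dist, dist_eq_norm] at this
    suffices ∃ L', SegmentChain A n (γ t) (γ v) L' ∧
        ENNReal.ofReal L' ≤ eVariationOn γ (Icc t v) by
      obtain ⟨L', h1, h2⟩ := this
      refine ⟨‖γ u - γ t‖ + L', ⟨j, γ t, L', hju, htj, h1, rfl⟩, ?_⟩
      rw [ENNReal.ofReal_add (norm_nonneg _) h1.nonneg, ← hvar]
      exact add_le_add hedge h2
    rcases eq_or_lt_of_le ht.2 with rfl | htv
    · refine ⟨0, ?_, by simp⟩
      have : SegmentChain A 0 (γ t) (γ t) 0 := ⟨rfl, rfl⟩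
      simpa using this.pad ⟨j, htj⟩ n
    · refine ih (s.erase j) (by rw [Finset.card_erase_of_mem hj, hs]; rfl) γ t v ht.2
        (hc.mono (Icc_subset_Icc_left ht.1)) ?_
      have hIoc : ∀ τ ∈ Ioc t v, γ τ ∈ ⋃ k ∈ s.erase j, A k := by
        intro τ hτ
        obtain ⟨k, hk, hkA⟩ := h τ ⟨ht.1.trans hτ.1.le, hτ.2⟩
        have hkj : k ≠ j := by
          rintro rfl
          exact absurd (hmax ⟨⟨ht.1.trans hτ.1.le, hτ.2⟩, hkA⟩) (not_le.2 hτ.1)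
        exact mem_biUnion (Finset.mem_erase.2 ⟨hkj, hk⟩) hkA
      have hclU : IsClosed (⋃ k ∈ s.erase j, A k) :=
        isClosed_biUnion_finset fun k _ => hcl k
      have hIcc : ∀ τ ∈ Icc t v, γ τ ∈ ⋃ k ∈ s.erase j, A k := by
        have hpre := (hc.mono (Icc_subset_Icc_left ht.1)).preimage_isClosed_of_isClosed
          isClosed_Icc hclU
        have hsub : Ioc t v ⊆ Icc t v ∩ γ ⁻¹' (⋃ k ∈ s.erase j, A k) :=
          fun τ hτ => ⟨Ioc_subset_Icc_self hτ, hIoc τ hτ⟩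
        have := closure_minimal hsub hpre
        rw [closure_Ioc htv.ne] at this
        exact fun τ hτ => (this hτ).2
      intro τ hτ
      have := hIcc τ hτ
      simp only [mem_iUnion, exists_prop] at this
      exact this

theorem isClosed_segmentChain [Finite ι] {A : ι → Set E} (hA : ∀ j, IsCompact (A j)) (p : E) :
    ∀ m : ℕ, IsClosed {x : E × ℝ | SegmentChain A m x.1 p x.2}
  | 0 => by
    have : {x : E × ℝ | SegmentChain A 0 x.1 p x.2} = {(p, 0)} := by
      ext ⟨a, L⟩
      simp [SegmentChain]
    rw [this]
    exact isClosed_singleton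
  | m + 1 => by
    have ih := isClosed_segmentChain hA p m
    have : {x : E × ℝ | SegmentChain A (m + 1) x.1 p x.2} = ⋃ j, Prod.fst ''
        {y : (E × ℝ) × A j | y.1.1 ∈ A j ∧
          ((y.2 : E), y.1.2 - ‖y.1.1 - y.2‖) ∈ {x : E × ℝ | SegmentChain A m x.1 p x.2}} := by
      ext ⟨a, L⟩
      simp only [mem_ofPred_eq, SegmentChain, mem_iUnion, mem_image, Prod.exists, exists_and_right,
        exists_eq_right, Subtype.exists]
      constructor
      · rintro ⟨j, z, L', ha, hz, h, e⟩
        refine ⟨j, z, ⟨hz, ha⟩, ?_⟩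
        rw [e, add_sub_cancel_left]
        exact h
      · rintro ⟨j, z, ⟨hz, ha⟩, h⟩
        exact ⟨j, z, _, ha, hz, h, by ring⟩
    rw [this]
    refine isClosed_iUnion_of_finite fun j => ?_
    have : CompactSpace (A j) := isCompact_iff_compactSpace.1 (hA j)
    refine isClosedMap_fst_of_compactSpace _ (IsClosed.inter ?_ ?_)
    · exact (hA j).isClosed.preimage (by fun_prop)
    · exact ih.preimage (by fun_prop)

end Chains

section Polyhedron

variable {E : Type*} [NormedAddCommGroup E] [InnerProductSpace ℝ E] {ι : Type*}

/-- The polyhedron cut out by the half-spaces `⟪ν j, y⟫ ≤ β j`. -/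
def polyhedron (ν : ι → E) (β : ι → ℝ) : Set E := {y | ∀ j, ⟪ν j, y⟫ ≤ β j}

/-- The face of the polyhedron on which the `j`-th constraint is active. -/
def polyFacet (ν : ι → E) (β : ι → ℝ) (j : ι) : Set E :=
  {y | y ∈ polyhedron ν β ∧ ⟪ν j, y⟫ = β j}

/-- Distance in the closed exterior of the polyhedron. -/
noncomputable def polyDist (ν : ι → E) (β : ι → ℝ) (a b : E) : ℝ :=
  pathDist (interior (polyhedron ν β))ᶜ a b

/-- Unit normals, bounded, with a point satisfying all constraints strictly. -/
structure IsPolytope (ν : ι → E) (β : ι → ℝ) : Prop where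
  unit : ∀ j, ‖ν j‖ = 1
  bounded : Bornology.IsBounded (polyhedron ν β)
  slater : ∃ c, ∀ j, ⟪ν j, c⟫ < β j

variable {ν : ι → E} {β : ι → ℝ}

theorem polyhedron_convex (ν : ι → E) (β : ι → ℝ) : Convex ℝ (polyhedron ν β) := by
  have : polyhedron ν β = ⋂ j, {y | ⟪ν j, y⟫ ≤ β j} := by
    ext; simp [polyhedron]
  rw [this]
  exact convex_iInter fun j => halfSpace_convex' _ _

theorem polyhedron_isClosed (ν : ι → E) (β : ι → ℝ) : IsClosed (polyhedron ν β) := by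
  have : polyhedron ν β = ⋂ j, {y | ⟪ν j, y⟫ ≤ β j} := by
    ext; simp [polyhedron]
  rw [this]
  exact isClosed_iInter fun j => isClosed_le (by fun_prop) (by fun_prop)

theorem polyFacet_convex (ν : ι → E) (β : ι → ℝ) (j : ι) : Convex ℝ (polyFacet ν β j) := by
  have : polyFacet ν β j = polyhedron ν β ∩ {y | β j ≤ ⟪ν j, y⟫} := by
    ext y
    exact ⟨fun h => ⟨h.1, h.2.ge⟩, fun h => ⟨h.1, le_antisymm (h.1 j) h.2⟩⟩
  rw [this]
  exact (polyhedron_convex ν β).inter (halfSpace_convex _ _)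

theorem polyFacet_isClosed (ν : ι → E) (β : ι → ℝ) (j : ι) : IsClosed (polyFacet ν β j) :=
  (polyhedron_isClosed ν β).inter (isClosed_eq (by fun_prop) (by fun_prop))

theorem IsPolytope.interior_eq [Finite ι] (h : IsPolytope ν β) :
    interior (polyhedron ν β) = {y | ∀ j, ⟪ν j, y⟫ < β j} := by
  apply Subset.antisymm
  · intro y hy j
    have hcont : ContinuousAt (fun t : ℝ => y + t • ν j) 0 := by fun_prop
    have : ∀ᶠ t : ℝ in nhds 0, y + t • ν j ∈ polyhedron ν β := by
      apply hcont
      simp only [zero_smul, add_zero]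
      exact mem_interior_iff_mem_nhds.1 hy
    obtain ⟨ε, hε, hball⟩ := Metric.eventually_nhds_iff.1 this
    have hm := hball (y := ε / 2) (by
      rw [Real.dist_eq, sub_zero, abs_of_pos (half_pos hε)]; linarith) j
    rw [inner_add_right, inner_smul_right, real_inner_self_eq_norm_sq, h.unit j] at hm
    linarith
  · refine interior_maximal (fun y hy j => (hy j).le) ?_
    have : {y | ∀ j, ⟪ν j, y⟫ < β j} = ⋂ j, {y | ⟪ν j, y⟫ < β j} := by ext; simp
    rw [this]
    exact isOpen_iInter_of_finite fun j => isOpen_lt (by fun_prop) (by fun_prop)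

theorem IsPolytope.mem_exterior [Finite ι] (h : IsPolytope ν β) {y : E} :
    y ∈ (interior (polyhedron ν β))ᶜ ↔ ∃ j, β j ≤ ⟪ν j, y⟫ := by
  rw [h.interior_eq]
  simp

theorem IsPolytope.halfSpace_subset [Finite ι] (h : IsPolytope ν β) (j : ι) :
    {y | β j ≤ ⟪ν j, y⟫} ⊆ (interior (polyhedron ν β))ᶜ :=
  fun _ hy => h.mem_exterior.2 ⟨j, hy⟩

theorem IsPolytope.mem_frontier [Finite ι] (h : IsPolytope ν β) {y : E} :
    y ∈ frontier (polyhedron ν β) ↔ ∃ j, y ∈ polyFacet ν β j := by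
  rw [(polyhedron_isClosed ν β).frontier_eq, mem_sdiff, ← mem_compl_iff, h.mem_exterior]
  constructor
  · rintro ⟨h1, j, h2⟩
    exact ⟨j, h1, le_antisymm (h1 j) h2⟩
  · rintro ⟨j, h1, h2⟩
    exact ⟨h1, j, h2.ge⟩

theorem IsPolytope.facet_subset_frontier [Finite ι] (h : IsPolytope ν β) (j : ι) :
    polyFacet ν β j ⊆ frontier (polyhedron ν β) :=
  fun _ hy => h.mem_frontier.2 ⟨j, hy⟩

theorem IsPolytope.facet_subset_exterior [Finite ι] (h : IsPolytope ν β) (j : ι) :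
    polyFacet ν β j ⊆ (interior (polyhedron ν β))ᶜ :=
  fun _ hy => h.mem_exterior.2 ⟨j, hy.2.ge⟩

variable [FiniteDimensional ℝ E] [Finite ι]

theorem IsPolytope.isConvexBody (h : IsPolytope ν β) : IsConvexBody (polyhedron ν β) := by
  refine ⟨Metric.isCompact_of_isClosed_isBounded (polyhedron_isClosed ν β) h.bounded,
    polyhedron_convex ν β, ?_⟩
  rw [h.interior_eq]
  exact h.slater

theorem IsPolytope.facet_isCompact (h : IsPolytope ν β) (j : ι) : IsCompact (polyFacet ν β j) :=
  h.isConvexBody.1.of_isClosed_subset (polyFacet_isClosed ν β j) fun _ hy => hy.1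

theorem IsPolytope.lengthConnected (h2 : 2 ≤ Module.finrank ℝ E) (h : IsPolytope ν β) :
    LengthConnected (interior (polyhedron ν β))ᶜ :=
  lengthConnected_compl_interior h2 (polyhedron_convex ν β) h.bounded h.isConvexBody.2.2

theorem IsPolytope.polyDist_le_norm (h : IsPolytope ν β) (j : ι) {a b : E}
    (ha : β j ≤ ⟪ν j, a⟫) (hb : β j ≤ ⟪ν j, b⟫) : polyDist ν β a b ≤ ‖a - b‖ :=
  pathDist_le_of_segment (((halfSpace_convex (ν j) (β j)).segment_subset ha hb).trans
    (h.halfSpace_subset j))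

theorem IsPolytope.polyDist_triangle (h2 : 2 ≤ Module.finrank ℝ E) (h : IsPolytope ν β)
    {a b c : E} (ha : a ∈ (interior (polyhedron ν β))ᶜ) (hb : b ∈ (interior (polyhedron ν β))ᶜ)
    (hc : c ∈ (interior (polyhedron ν β))ᶜ) :
    polyDist ν β a c ≤ polyDist ν β a b + polyDist ν β b c :=
  (h.lengthConnected h2).triangle ha hb hc

theorem IsPolytope.polyDist_le_add (h2 : 2 ≤ Module.finrank ℝ E) (h : IsPolytope ν β)
    (j : ι) {a b p : E} (ha : β j ≤ ⟪ν j, a⟫) (hb : β j ≤ ⟪ν j, b⟫)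
    (hp : p ∈ (interior (polyhedron ν β))ᶜ) :
    polyDist ν β a p ≤ ‖a - b‖ + polyDist ν β b p := by
  have := h.polyDist_triangle h2 (h.halfSpace_subset j ha) (h.halfSpace_subset j hb) hp
  linarith [h.polyDist_le_norm j ha hb]

theorem IsPolytope.polyDist_le_chain (h : IsPolytope ν β) {m : ℕ}
    {a b : E} {L : ℝ} (ha : a ∈ (interior (polyhedron ν β))ᶜ)
    (hc : SegmentChain (polyFacet ν β) m a b L) : polyDist ν β a b ≤ L :=
  (hc.joinedWithin (polyFacet_convex ν β) h.facet_subset_exterior ha).pathDist_le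

theorem IsPolytope.exists_chain (h2 : 2 ≤ Module.finrank ℝ E) (h : IsPolytope ν β)
    {a p : E} (ha : a ∈ frontier (polyhedron ν β)) (hp : p ∈ frontier (polyhedron ν β)) :
    ∃ m, SegmentChain (polyFacet ν β) m a p (polyDist ν β a p) := by
  classical
  have : Fintype ι := Fintype.ofFinite ι
  set S : Set ℝ := {L | SegmentChain (polyFacet ν β) (Fintype.card ι) a p L} with hS
  have key : ∀ L, JoinedWithin (frontier (polyhedron ν β)) a p L → ∃ L' ∈ S, L' ≤ L := by
    rintro L ⟨h0, γ, h1, h2, h3, h4, h5⟩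
    obtain ⟨L', hc, hL'⟩ := exists_segmentChain_of_curve (polyFacet_isClosed ν β) _ Finset.univ
      rfl γ 0 1 zero_le_one h1 (fun t ht => by simpa using h.mem_frontier.1 (h4 ht))
    rw [h2, h3] at hc
    exact ⟨L', hc, (ENNReal.ofReal_le_ofReal_iff h0).1 (hL'.trans h5)⟩
  have hcl : IsClosed S :=
    (isClosed_segmentChain h.facet_isCompact p (Fintype.card ι)).preimage
      (f := fun L : ℝ => (a, L)) (by fun_prop)
  have hbdd : BddBelow S := ⟨0, fun L hL => hL.nonneg⟩
  have hconn := lengthConnected_frontier h2 h.isConvexBody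
  have hne : S.Nonempty := by
    obtain ⟨L, hL⟩ := hconn a ha p hp
    obtain ⟨L', h1, _⟩ := key L hL
    exact ⟨L', h1⟩
  have hmem := hcl.csInf_mem hne hbdd
  refine ⟨Fintype.card ι, ?_⟩
  suffices e : polyDist ν β a p = sInf S by rw [e]; exact hmem
  apply le_antisymm
  · exact h.polyDist_le_chain ha.2 hmem
  · unfold polyDist
    rw [← pathDist_frontier_eq h2 h.isConvexBody ha hp]
    refine hconn.le_pathDist ha hp fun L hL => ?_
    obtain ⟨L', h1, h2⟩ := key L hL
    exact (csInf_le hbdd h1).trans h2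

end Polyhedron

section Hinge

variable {E : Type*} [NormedAddCommGroup E] [InnerProductSpace ℝ E] {ι : Type*}

theorem norm_smul_add_smul_le {a u : E} (ha : ‖a‖ = 1) {r : ℝ} (hr : 0 < r) (t : ℝ) :
    ‖r • a + t • u‖ ≤ r + t * ⟪a, u⟫ + t ^ 2 * (‖u‖ ^ 2 / (2 * r)) := by
  have h1 : ‖r • a + t • u‖ ^ 2 = r ^ 2 + 2 * (r * (t * ⟪a, u⟫)) + t ^ 2 * ‖u‖ ^ 2 := by
    rw [norm_add_sq_real, real_inner_smul_left, real_inner_smul_right, norm_smul, norm_smul, ha,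
      mul_pow, mul_pow, Real.norm_eq_abs, Real.norm_eq_abs, sq_abs, sq_abs]
    ring
  have h2 : r + t * ⟪a, u⟫ + t ^ 2 * (‖u‖ ^ 2 / (2 * r)) =
      (‖r • a + t • u‖ ^ 2 + r ^ 2) / (2 * r) := by
    rw [h1]; field_simp; ring
  rw [h2, le_div_iff₀ (by positivity)]
  nlinarith [sq_nonneg (‖r • a + t • u‖ - r)]

theorem eq_zero_of_forall_small {A K δ : ℝ} (hδ : 0 < δ)
    (h : ∀ t, |t| < δ → 0 ≤ t * A + t ^ 2 * K) : A = 0 := by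
  by_contra hA
  set t : ℝ := min (δ / 2) (|A| / (2 * (|K| + 1))) with ht
  have hApos : 0 < |A| := abs_pos.2 hA
  have ht0 : 0 < t := by positivity
  have ht1 : t < δ := (min_le_left _ _).trans_lt (by linarith)
  have ht2 : t * (2 * (|K| + 1)) ≤ |A| := by
    rw [← le_div_iff₀ (by positivity)]; exact min_le_right _ _
  have hb : t * |K| < |A| := by nlinarith [abs_nonneg K]
  have hK := le_abs_self K
  rcases lt_or_gt_of_ne hA with h1 | h1
  · have := h t (by rwa [abs_of_pos ht0])
    rw [abs_of_neg h1] at hb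
    nlinarith
  · have := h (-t) (by rwa [abs_neg, abs_of_pos ht0])
    rw [abs_of_pos h1] at hb
    nlinarith

theorem norm_eq_of_inner_eq {e e' w : E} (he : ‖e‖ = 1) (he' : ‖e'‖ = 1)
    (h : ⟪e, w⟫ = ⟪e', w⟫) (r : ℝ) : ‖r • e - w‖ = ‖r • e' - w‖ := by
  have : ‖r • e - w‖ ^ 2 = ‖r • e' - w‖ ^ 2 := by
    rw [norm_sub_sq_real, norm_sub_sq_real, real_inner_smul_left, real_inner_smul_left, h,
      norm_smul, norm_smul, he, he']
  exact (sq_eq_sq₀ (norm_nonneg _) (norm_nonneg _)).1 this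

theorem exists_unit_step {x z : E} (h : x ≠ z) :
    ∃ e : E, ∃ l : ℝ, ‖e‖ = 1 ∧ 0 < l ∧ z = x + l • e ∧ l = ‖x - z‖ := by
  have hl : 0 < ‖x - z‖ := norm_pos_iff.2 (sub_ne_zero.2 h)
  refine ⟨‖x - z‖⁻¹ • (z - x), ‖x - z‖, ?_, hl, ?_, rfl⟩
  · rw [norm_smul, norm_inv, norm_norm, norm_sub_rev z x, inv_mul_cancel₀ hl.ne']
  · rw [smul_smul, mul_inv_cancel₀ hl.ne', one_smul, add_sub_cancel]

variable {ν : ι → E} {β : ι → ℝ} [FiniteDimensional ℝ E] [Finite ι]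

theorem IsPolytope.polyDist_step (h2 : 2 ≤ Module.finrank ℝ E) (h : IsPolytope ν β) {p : E}
    (hp : p ∈ frontier (polyhedron ν β)) {x z : E} {j : ι} (hx : x ∈ polyFacet ν β j)
    (hz : z ∈ polyFacet ν β j) {m : ℕ} {L : ℝ} (hc : SegmentChain (polyFacet ν β) m z p L)
    (hL : polyDist ν β x p = ‖x - z‖ + L) : polyDist ν β z p = L := by
  apply le_antisymm (h.polyDist_le_chain (h.facet_subset_exterior j hz) hc)
  have := h.polyDist_le_add h2 j hx.2.ge hz.2.ge hp.2
  linarith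

theorem IsPolytope.polyDist_pos (h2 : 2 ≤ Module.finrank ℝ E) (h : IsPolytope ν β) {a b : E}
    (ha : a ∈ (interior (polyhedron ν β))ᶜ) (hb : b ∈ (interior (polyhedron ν β))ᶜ)
    (hab : a ≠ b) : 0 < polyDist ν β a b :=
  (norm_pos_iff.2 (sub_ne_zero.2 hab)).trans_le ((h.lengthConnected h2).norm_sub_le ha hb)

theorem IsPolytope.local_hinge (h2 : 2 ≤ Module.finrank ℝ E) (h : IsPolytope ν β) {p : E}
    (hp : p ∈ frontier (polyhedron ν β)) : ∀ (m : ℕ) (x : E) (j : ι) (e : E) (l : ℝ),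
    ‖e‖ = 1 → 0 < l → (∀ m' ≤ m, ¬ SegmentChain (polyFacet ν β) m' x p (polyDist ν β x p)) →
    x ∈ polyFacet ν β j → x + l • e ∈ polyFacet ν β j →
    SegmentChain (polyFacet ν β) m (x + l • e) p (polyDist ν β x p - l) →
    ∃ ε > 0, ∀ v : E, ⟪ν j, v⟫ = 0 → ‖v‖ < ε →
      polyDist ν β (x + v) p ≤ ‖polyDist ν β x p • e - v‖ := by
  intro m
  induction m with
  | zero =>
    intro x j e l he hl _ hx hz hc
    obtain ⟨hz0, hr⟩ := hc
    have hr : polyDist ν β x p = l := by linarith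
    refine ⟨1, one_pos, fun v hv _ => ?_⟩
    have : l • e - v = -(x + v - p) := by rw [← hz0]; abel
    rw [hr, this, norm_neg]
    apply h.polyDist_le_norm j
    · rw [inner_add_right, hv, add_zero, hx.2]
    · rw [← hz0, hz.2]
  | succ k ih =>
    intro x j e l he hl hmin hx hz hc
    set r := polyDist ν β x p with hr
    have hnz : ‖x - (x + l • e)‖ = l := by
      rw [sub_add_cancel_left, norm_neg, norm_smul, he, mul_one, Real.norm_of_nonneg hl.le]
    set z := x + l • e with hzdef
    have hρz : polyDist ν β z p = r - l := h.polyDist_step h2 hp hx hz hc (by rw [hnz, ← hr]; ring)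
    obtain ⟨j', z', L', hzj', hz₂j, hc', hL'⟩ := hc
    have hzne : z ≠ z' := by
      intro heq
      rw [← heq, sub_self, norm_zero, zero_add] at hL'
      rw [← heq, ← hL'] at hc'
      exact hmin (k + 1) le_rfl ⟨j, z, r - l, hx, hz, hc', by rw [hnz]; ring⟩
    obtain ⟨e', l', he', hl', hz'e, hl'n⟩ := exists_unit_step hzne
    have hρz' := h.polyDist_step h2 hp hzj' hz₂j hc' (by rw [hρz]; exact hL')
    have hz'O := h.facet_subset_exterior j' hz₂j
    have hr1 : 0 < r - l := by
      have := hc'.nonneg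
      rw [← hl'n] at hL'
      linarith
    have hxj' : ⟪ν j', x⟫ < β j' := by
      refine lt_of_le_of_ne (hx.1 j') fun heq => hmin (k + 1) le_rfl ?_
      refine ⟨j', z', L', ⟨hx.1, heq⟩, hz₂j, hc', ?_⟩
      have h3 := h.polyDist_le_add h2 j' heq.ge hz₂j.2.ge hp.2
      rw [← hr, hρz'] at h3
      have h4 := norm_sub_le_norm_sub_add_norm_sub x z z'
      rw [hnz] at h4
      linarith
    obtain ⟨ε', hε', hinge⟩ := ih z j' e' l' he' hl' (by
        intro m' hm' hcm
        rw [hρz] at hcm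
        exact hmin (m' + 1) (by omega) ⟨j, z, r - l, hx, hz, hcm, by rw [hnz]; ring⟩)
      hzj' (hz'e ▸ hz₂j) (by
        rw [hρz, ← hz'e, hL', ← hl'n, add_sub_cancel_left]; exact hc')
    rw [hρz] at hinge
    have hej : ⟪ν j, e⟫ = 0 := by
      have := hz.2
      rw [hzdef, inner_add_right, inner_smul_right, hx.2] at this
      have : l * ⟪ν j, e⟫ = 0 := by linarith
      exact (mul_eq_zero.1 this).resolve_left hl.ne'
    have hb : 0 < ⟪ν j', e⟫ := by
      have := hzj'.2
      rw [hzdef, inner_add_right, inner_smul_right] at this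
      have : 0 < l * ⟪ν j', e⟫ := by linarith
      exact (mul_pos_iff_of_pos_left hl).1 this
    have hstat : ∀ w : E, ⟪ν j, w⟫ = 0 → ⟪ν j', w⟫ = 0 → ⟪e, w⟫ = ⟪e', w⟫ := by
      intro w hwj hwj'
      suffices ⟪e, w⟫ - ⟪e', w⟫ = 0 by linarith
      refine eq_zero_of_forall_small (K := ‖w‖ ^ 2 / (2 * l) + ‖w‖ ^ 2 / (2 * (r - l)))
        (δ := ε' / (‖w‖ + 1)) (by positivity) fun t ht => ?_
      have hw : ‖t • w‖ < ε' := by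
        rw [norm_smul, Real.norm_eq_abs]
        rw [lt_div_iff₀ (by positivity)] at ht
        nlinarith [abs_nonneg t]
      have h1 := hinge (t • w) (by rw [inner_smul_right, hwj', mul_zero]) hw
      have h3 : r ≤ ‖x - (z + t • w)‖ + polyDist ν β (z + t • w) p := by
        apply h.polyDist_le_add h2 j hx.2.ge _ hp.2
        rw [inner_add_right, inner_smul_right, hwj, hz.2, mul_zero, add_zero]
      have e1 : x - (z + t • w) = -(l • e + t • w) := by rw [hzdef]; abel
      rw [e1, norm_neg] at h3
      have h4 := norm_smul_add_smul_le (u := w) he hl t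
      have h5 := norm_smul_add_smul_le (u := w) he' hr1 (-t)
      have e2 : (r - l) • e' + (-t) • w = (r - l) • e' - t • w := by rw [neg_smul]; abel
      rw [e2] at h5
      nlinarith
    have hrpos : 0 < r := by linarith
    set τ : E → ℝ := fun v => (l * ⟪ν j', e⟫ - ⟪ν j', v⟫) / (r * ⟪ν j', e⟫ - ⟪ν j', v⟫) with hτ
    have hrb : r * ⟪ν j', e⟫ ≠ 0 := by positivity
    have hτc : ContinuousAt τ 0 := by
      apply ContinuousAt.div (by fun_prop) (by fun_prop)
      simpa using hrb
    have hτ0 : τ 0 = l / r := by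
      simp only [hτ, inner_zero_right, sub_zero]
      field_simp
    have hwc : ContinuousAt (fun v => v + τ v • (r • e - v) - l • e) 0 := by fun_prop
    have hw0 : (0 : E) + τ 0 • (r • e - 0) - l • e = 0 := by
      rw [hτ0, zero_add, sub_zero, smul_smul, div_mul_cancel₀ _ hrpos.ne', sub_self]
    have ev1 : ∀ᶠ v in nhds (0 : E), ‖v + τ v • (r • e - v) - l • e‖ < ε' := by
      have := hwc.norm
      apply this.eventually (Iio_mem_nhds _)
      beta_reduce; rw [hw0, norm_zero]; exact hε'
    have ev2 : ∀ᶠ v in nhds (0 : E), 0 < τ v ∧ τ v < 1 := by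
      apply hτc.eventually (Ioo_mem_nhds _ _)
      · rw [hτ0]; positivity
      · rw [hτ0, div_lt_one hrpos]; linarith
    have ev3 : ∀ᶠ v in nhds (0 : E), r * ⟪ν j', e⟫ - ⟪ν j', v⟫ ≠ 0 := by
      have : ContinuousAt (fun v : E => r * ⟪ν j', e⟫ - ⟪ν j', v⟫) 0 := by fun_prop
      apply this.eventually_ne
      simpa using hrb
    obtain ⟨ε, hε, hball⟩ := Metric.eventually_nhds_iff.1 (ev1.and (ev2.and ev3))
    refine ⟨ε, hε, fun v hv hvε => ?_⟩
    obtain ⟨hw1, ⟨hτpos, hτlt⟩, hden⟩ := hball (y := v) (by rwa [dist_zero_right])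
    set w := v + τ v • (r • e - v) - l • e with hw
    have hwj : ⟪ν j, w⟫ = 0 := by
      rw [hw, inner_sub_right, inner_add_right, inner_smul_right, inner_sub_right,
        inner_smul_right, inner_smul_right, hv, hej]
      ring
    have hwj' : ⟪ν j', w⟫ = 0 := by
      rw [hw, inner_sub_right, inner_add_right, inner_smul_right, inner_sub_right,
        inner_smul_right, inner_smul_right]
      have : τ v * (r * ⟪ν j', e⟫ - ⟪ν j', v⟫) = l * ⟪ν j', e⟫ - ⟪ν j', v⟫ :=
        div_mul_cancel₀ _ hden
      linarith
    have h1 := hinge w hwj' hw1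
    rw [← norm_eq_of_inner_eq he he' (hstat w hwj hwj')] at h1
    have h3 : polyDist ν β (x + v) p ≤ ‖(x + v) - (z + w)‖ + polyDist ν β (z + w) p := by
      apply h.polyDist_le_add h2 j _ _ hp.2
      · rw [inner_add_right, hv, hx.2, add_zero]
      · rw [inner_add_right, hwj, hz.2, add_zero]
    have e1 : (x + v) - (z + w) = -(τ v • (r • e - v)) := by rw [hw, hzdef]; abel
    have e2 : (r - l) • e - w = (1 - τ v) • (r • e - v) := by rw [hw]; module
    rw [e2, norm_smul, Real.norm_of_nonneg (by linarith)] at h1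
    rw [e1, norm_neg, norm_smul, Real.norm_of_nonneg hτpos.le] at h3
    linarith

end Hinge

section MidpointConvexity

theorem le_chord_of_local_midpoint {f : ℝ → ℝ} {a b : ℝ} (hab : a < b)
    (hf : ContinuousOn f (Icc a b))
    (hm : ∀ t ∈ Ioo a b, ∃ ε > 0, ∀ h ∈ Ioo 0 ε, 2 * f t ≤ f (t + h) + f (t - h))
    {t : ℝ} (ht : t ∈ Icc a b) :
    (b - a) * f t ≤ (b - t) * f a + (t - a) * f b := by
  set g : ℝ → ℝ := fun t => (b - a) * f t - ((b - t) * f a + (t - a) * f b) with hg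
  by_contra hcon
  have hpos : 0 < g t := by simp only [hg]; linarith
  have hgc : ContinuousOn g (Icc a b) := by fun_prop
  obtain ⟨M, hM, hMmax⟩ := isCompact_Icc.exists_isMaxOn ⟨t, ht⟩ hgc
  have hKc : IsCompact (Icc a b ∩ g ⁻¹' {g M}) :=
    isCompact_Icc.of_isClosed_subset
      (hgc.preimage_isClosed_of_isClosed isClosed_Icc isClosed_singleton) inter_subset_left
  obtain ⟨s, ⟨hs, hsM⟩, hleast⟩ := hKc.exists_isLeast ⟨M, hM, rfl⟩
  have hsM : g s = g M := hsM
  have hMpos : 0 < g M := hpos.trans_le (hMmax ht)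
  have hga : g a = 0 := by simp only [hg]; ring
  have hgb : g b = 0 := by simp only [hg]; ring
  have hsa : a < s := lt_of_le_of_ne hs.1 (by rintro rfl; linarith)
  have hsb : s < b := lt_of_le_of_ne hs.2 (by rintro rfl; linarith)
  obtain ⟨ε, hε, hmid⟩ := hm s ⟨hsa, hsb⟩
  set h := min (ε / 2) (min ((s - a) / 2) ((b - s) / 2)) with hh
  have h0 : 0 < h := by
    refine lt_min (by linarith) (lt_min ?_ ?_) <;> linarith
  have h1 : h ≤ ε / 2 := min_le_left _ _
  have h2 : h ≤ (s - a) / 2 := (min_le_right _ _).trans (min_le_left _ _)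
  have h3 : h ≤ (b - s) / 2 := (min_le_right _ _).trans (min_le_right _ _)
  have hmid := hmid h ⟨h0, by linarith⟩
  have hp : g (s + h) ≤ g M := hMmax ⟨by linarith, by linarith⟩
  have hl : g (s - h) < g M := by
    refine lt_of_le_of_ne (hMmax ⟨by linarith, by linarith⟩) fun heq => ?_
    have := hleast ⟨⟨by linarith, by linarith⟩, heq⟩
    linarith
  have : 2 * g s ≤ g (s + h) + g (s - h) := by
    simp only [hg]
    nlinarith
  linarith

theorem convexOn_of_local_midpoint {E : Type*} [NormedAddCommGroup E] [NormedSpace ℝ E]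
    {W : Set E} (hW : Convex ℝ W) {f : E → ℝ} (hf : ContinuousOn f W)
    (hm : ∀ y ∈ W, ∃ ε > 0, ∀ w : E, ‖w‖ < ε → 2 * f y ≤ f (y + w) + f (y - w)) :
    ConvexOn ℝ W f := by
  refine ⟨hW, fun x hx y hy a b ha hb hab => ?_⟩
  have hseg : ∀ t ∈ Icc (0 : ℝ) 1, x + t • (y - x) ∈ W := by
    intro t ht
    have := hW hx hy (a := 1 - t) (b := t) (by linarith [ht.2]) ht.1 (by ring)
    convert this using 1
    module
  have := le_chord_of_local_midpoint (f := fun t : ℝ => f (x + t • (y - x))) zero_lt_one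
    (hf.comp (by fun_prop) hseg) (fun t ht => ?_) (t := b) ⟨hb, by linarith⟩
  · have e1 : x + b • (y - x) = a • x + b • y := by
      rw [← eq_sub_iff_add_eq] at hab
      subst hab
      module
    simp only [zero_smul, add_zero, one_smul, add_sub_cancel, sub_zero, one_mul] at this
    rw [e1] at this
    have e2 : 1 - b = a := by linarith
    rw [e2] at this
    exact this
  · obtain ⟨ε, hε, hmid⟩ := hm _ (hseg t (Ioo_subset_Icc_self ht))
    refine ⟨ε / (‖y - x‖ + 1), by positivity, fun h hh => ?_⟩
    have hsm : ‖h • (y - x)‖ < ε := by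
      rw [norm_smul, Real.norm_of_nonneg hh.1.le]
      have := hh.2
      rw [lt_div_iff₀ (by positivity)] at this
      nlinarith [hh.1]
    have := hmid _ hsm
    have e1 : x + (t + h) • (y - x) = x + t • (y - x) + h • (y - x) := by module
    have e2 : x + (t - h) • (y - x) = x + t • (y - x) - h • (y - x) := by module
    rw [e1, e2]
    exact this

end MidpointConvexity

section Vertex

variable {E : Type*} [NormedAddCommGroup E] [InnerProductSpace ℝ E] {ι : Type*}

theorem norm_sub_lt_two {u v : E} (hu : ‖u‖ = 1) (hv : ‖v‖ = 1) (h : u ≠ -v) :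
    ‖u - v‖ < 2 := by
  have h0 : 0 < ‖u + v‖ := by
    rw [norm_pos_iff]
    exact fun h' => h (eq_neg_of_add_eq_zero_left h')
  have h1 : ‖u - v‖ ^ 2 + ‖u + v‖ ^ 2 = 4 := by
    rw [norm_sub_sq_real, norm_add_sq_real, hu, hv]; ring
  nlinarith [norm_nonneg (u - v)]

theorem mem_span_pair_of_orthogonal {x u v : E}
    (h : ∀ w, ⟪u, w⟫ = 0 → ⟪v, w⟫ = 0 → ⟪x, w⟫ = 0) : ∃ a b : ℝ, a • u + b • v = x := by
  rw [← Submodule.mem_span_pair]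
  have : FiniteDimensional ℝ (Submodule.span ℝ ({u, v} : Set E)) := by
    apply FiniteDimensional.span_of_finite
    simp
  rw [← Submodule.orthogonal_orthogonal (Submodule.span ℝ ({u, v} : Set E))]
  rw [Submodule.mem_orthogonal]
  intro w hw
  rw [Submodule.mem_orthogonal] at hw
  rw [real_inner_comm]
  exact h w (hw u (Submodule.subset_span (by simp))) (hw v (Submodule.subset_span (by simp)))

variable {ν : ι → E} {β : ι → ℝ} [FiniteDimensional ℝ E] [Finite ι]

theorem IsPolytope.exists_direction (h2 : 2 ≤ Module.finrank ℝ E) (h : IsPolytope ν β) {x p : E}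
    (hx : x ∈ frontier (polyhedron ν β)) (hp : p ∈ frontier (polyhedron ν β)) (hxp : x ≠ p) :
    ∃ m e l, ‖e‖ = 1 ∧ 0 < l ∧
      SegmentChain (polyFacet ν β) m (x + l • e) p (polyDist ν β x p - l) ∧
      (∃ k, x ∈ polyFacet ν β k ∧ x + l • e ∈ polyFacet ν β k) ∧
      ∀ j, x ∈ polyFacet ν β j → x + l • e ∈ polyFacet ν β j →
        ∃ ε > 0, ∀ v : E, ⟪ν j, v⟫ = 0 → ‖v‖ < ε →
          polyDist ν β (x + v) p ≤ ‖polyDist ν β x p • e - v‖ := by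
  classical
  have hex := h.exists_chain h2 hx hp
  have hspec := Nat.find_spec hex
  have hmin := fun m => Nat.find_min hex (m := m)
  rcases hn : Nat.find hex with _ | m
  · rw [hn] at hspec
    exact absurd hspec.1 hxp
  · rw [hn] at hspec hmin
    obtain ⟨j, z, L', hxj, hzj, hc, hL⟩ := hspec
    have hxz : x ≠ z := by
      rintro rfl
      rw [sub_self, norm_zero, zero_add] at hL
      exact hmin m (by omega) (hL ▸ hc)
    obtain ⟨e, l, he, hl, rfl, hln⟩ := exists_unit_step hxz
    have hc' : SegmentChain (polyFacet ν β) m (x + l • e) p (polyDist ν β x p - l) := by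
      rw [hL, ← hln, add_sub_cancel_left]; exact hc
    exact ⟨m, e, l, he, hl, hc', ⟨j, hxj, hzj⟩, fun j' hxj' hzj' =>
      h.local_hinge h2 hp m x j' e l he hl (fun m' hm' => hmin m' (by omega)) hxj' hzj' hc'⟩

/-- Midpoint estimate at a point where a minimal curve bends, assuming the minimal chain towards
`p` starts in the facet of the second branch. -/
theorem IsPolytope.midpoint_of_hinge (h2 : 2 ≤ Module.finrank ℝ E) (h : IsPolytope ν β) {z p : E}
    (hp : p ∈ frontier (polyhedron ν β)) {u₁ u₂ e : E} {i j : ι} {r ε : ℝ}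
    (hu₁ : ‖u₁‖ = 1) (hu₂ : ‖u₂‖ = 1) (he : ‖e‖ = 1) (hr : 0 < r) (hε : 0 < ε)
    (hzi : ⟪ν i, z⟫ = β i)
    (hi₁ : ⟪ν i, u₁⟫ = 0) (hi₂ : ⟪ν i, u₂⟫ < 0) (hj₂ : ⟪ν j, u₂⟫ = 0)
    (hie : ⟪ν i, e⟫ < 0) (hje : ⟪ν j, e⟫ = 0)
    (hstat : ∀ w, ⟪ν i, w⟫ = 0 → ⟪ν j, w⟫ = 0 → ⟪u₁, w⟫ = -⟪u₂, w⟫)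
    (hinge : ∀ v : E, ⟪ν j, v⟫ = 0 → ‖v‖ < ε → polyDist ν β (z + v) p ≤ ‖r • e - v‖) :
    ∃ δ > 0, ∀ t ∈ Ioo 0 δ, polyDist ν β (z + t • u₁) p ^ 2 + polyDist ν β (z + t • u₂) p ^ 2
      ≤ 2 * r ^ 2 + 2 * t ^ 2 := by
  set b := -⟪ν i, u₂⟫ with hb
  set c := -⟪ν i, e⟫ with hc
  have hbpos : 0 < b := by linarith
  have hcpos : 0 < c := by linarith
  refine ⟨ε / (1 + b / c), by positivity, fun t ⟨ht0, ht⟩ => ?_⟩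
  rw [lt_div_iff₀ (by positivity)] at ht
  have htε : t < ε := by
    have : 0 < t * (b / c) := by positivity
    linarith
  have h1 := hinge (t • u₂) (by rw [inner_smul_right, hj₂, mul_zero])
    (by rwa [norm_smul, hu₂, mul_one, Real.norm_of_nonneg ht0.le])
  set θ := t * b / (t * b + r * c) with hθ
  have hden : 0 < t * b + r * c := by positivity
  have hθ0 : 0 ≤ θ := by positivity
  have hθ1 : θ ≤ 1 := by
    rw [hθ, div_le_one hden]
    have : 0 < r * c := by positivity
    linarith
  have hθm : θ * (t * b + r * c) = t * b := div_mul_cancel₀ _ hden.ne'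
  set w : E := (1 - θ) • (-(t • u₂)) + θ • (r • e) with hw
  have hwi : ⟪ν i, w⟫ = 0 := by
    rw [hw, inner_add_right, inner_smul_right, inner_neg_right, inner_smul_right,
      inner_smul_right, inner_smul_right]
    have e1 : ⟪ν i, u₂⟫ = -b := by rw [hb]; ring
    have e2 : ⟪ν i, e⟫ = -c := by rw [hc]; ring
    rw [e1, e2]
    linarith
  have hwj : ⟪ν j, w⟫ = 0 := by
    rw [hw, inner_add_right, inner_smul_right, inner_neg_right, inner_smul_right,
      inner_smul_right, inner_smul_right, hj₂, hje]
    ring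
  have hwn : ‖w‖ < ε := by
    have n1 : ‖(1 - θ) • (-(t • u₂))‖ = (1 - θ) * t := by
      rw [norm_smul, norm_neg, norm_smul, hu₂, Real.norm_of_nonneg (by linarith),
        Real.norm_of_nonneg ht0.le, mul_one]
    have n2 : ‖θ • (r • e)‖ = θ * r := by
      rw [norm_smul, norm_smul, he, Real.norm_of_nonneg hθ0, Real.norm_of_nonneg hr.le, mul_one]
    have n3 := norm_add_le ((1 - θ) • (-(t • u₂))) (θ • (r • e))
    rw [n1, n2] at n3
    have n4 : θ * r ≤ t * (b / c) := by
      rw [mul_div_assoc', le_div_iff₀ hcpos]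
      have : 0 ≤ θ * (t * b) := by positivity
      linarith
    have n5 : 0 ≤ θ * t := by positivity
    linarith
  have h3 := hinge w hwj hwn
  have h4 : polyDist ν β (z + t • u₁) p ≤ ‖(z + t • u₁) - (z + w)‖ + polyDist ν β (z + w) p := by
    apply h.polyDist_le_add h2 i _ _ hp.2
    · rw [inner_add_right, inner_smul_right, hi₁, hzi, mul_zero, add_zero]
    · rw [inner_add_right, hwi, hzi, add_zero]
  have e1 : ‖(z + t • u₁) - (z + w)‖ = θ * ‖r • e + t • u₂‖ := by
    rw [add_sub_add_left_eq_sub,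
      norm_eq_of_inner_eq (e' := -u₂) hu₁ (by rwa [norm_neg])
        (by rw [inner_neg_left]; exact hstat w hwi hwj)]
    have : t • (-u₂) - w = -(θ • (r • e + t • u₂)) := by rw [hw]; module
    rw [this, norm_neg, norm_smul, Real.norm_of_nonneg hθ0]
  have e2 : ‖r • e - w‖ = (1 - θ) * ‖r • e + t • u₂‖ := by
    have : r • e - w = (1 - θ) • (r • e + t • u₂) := by rw [hw]; module
    rw [this, norm_smul, Real.norm_of_nonneg (by linarith)]
  have h5 : polyDist ν β (z + t • u₁) p ≤ ‖r • e + t • u₂‖ := by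
    rw [e1] at h4; rw [e2] at h3; linarith
  have s1 := pow_le_pow_left₀ (pathDist_nonneg _ _ _) h5 2
  have s2 := pow_le_pow_left₀ (pathDist_nonneg _ _ _) h1 2
  rw [norm_add_sq_real] at s1
  rw [norm_sub_sq_real] at s2
  have n1 : ‖r • e‖ ^ 2 = r ^ 2 := by rw [norm_smul, he, mul_one, Real.norm_eq_abs, sq_abs]
  have n2 : ‖t • u₂‖ ^ 2 = t ^ 2 := by rw [norm_smul, hu₂, mul_one, Real.norm_eq_abs, sq_abs]
  unfold polyDist
  linarith

end Vertex

section Midpoint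

variable {E : Type*} [NormedAddCommGroup E] [InnerProductSpace ℝ E] {ι : Type*}

variable {ν : ι → E} {β : ι → ℝ} [FiniteDimensional ℝ E] [Finite ι]

theorem inner_nonpos_of_active {j : ι} {z v : E} (hz : ⟪ν j, z⟫ = β j)
    (hv : z + v ∈ polyhedron ν β) : ⟪ν j, v⟫ ≤ 0 := by
  have := hv j
  rw [inner_add_right, hz] at this
  linarith

theorem inner_eq_zero_of_facet {j : ι} {z u : E} {a : ℝ} (ha : a ≠ 0)
    (hz : ⟪ν j, z⟫ = β j) (hv : ⟪ν j, z + a • u⟫ = β j) : ⟪ν j, u⟫ = 0 := by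
  rw [inner_add_right, hz, inner_smul_right] at hv
  have : a * ⟪ν j, u⟫ = 0 := by linarith
  exact (mul_eq_zero.1 this).resolve_left ha

theorem inner_nonpos_of_smul {j : ι} {z u : E} {a : ℝ} (ha : 0 < a)
    (hz : ⟪ν j, z⟫ = β j) (hv : z + a • u ∈ polyhedron ν β) : ⟪ν j, u⟫ ≤ 0 := by
  have := inner_nonpos_of_active hz hv
  rw [inner_smul_right] at this
  by_contra hc
  have : 0 < a * ⟪ν j, u⟫ := mul_pos ha (not_le.1 hc)
  linarith

theorem sq_norm_smul_sub {e u : E} (he : ‖e‖ = 1) (hu : ‖u‖ = 1) (r t : ℝ) :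
    ‖r • e - t • u‖ ^ 2 = r ^ 2 - 2 * (r * t * ⟪e, u⟫) + t ^ 2 := by
  rw [norm_sub_sq_real, norm_smul, norm_smul, he, hu, real_inner_smul_left, real_inner_smul_right,
    mul_one, mul_one, Real.norm_eq_abs, Real.norm_eq_abs, sq_abs, sq_abs]
  ring

/-- At a bend of a minimal curve every active normal is a combination of the normals of the two
adjacent facets. -/
theorem IsPolytope.inner_eq_zero_of_bend (h2 : 2 ≤ Module.finrank ℝ E) (h : IsPolytope ν β)
    {z u₁ u₂ : E} {i j k : ι} {a : ℝ} (ha : 0 < a)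
    (hu₁ : ‖u₁‖ = 1) (hu₂ : ‖u₂‖ = 1) (hne : u₁ ≠ -u₂)
    (hzi : ⟪ν i, z⟫ = β i) (hzj : ⟪ν j, z⟫ = β j) (hzk : ⟪ν k, z⟫ = β k)
    (hi₁ : ⟪ν i, u₁⟫ = 0) (hj₂ : ⟪ν j, u₂⟫ = 0)
    (hmin : 2 * a ≤ polyDist ν β (z + a • u₁) (z + a • u₂))
    (hstat : ∀ w, ⟪ν i, w⟫ = 0 → ⟪ν j, w⟫ = 0 → ⟪u₁, w⟫ = -⟪u₂, w⟫) :
    ∀ w, ⟪ν i, w⟫ = 0 → ⟪ν j, w⟫ = 0 → ⟪ν k, w⟫ = 0 := by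
  suffices hle : ∀ w, ⟪ν i, w⟫ = 0 → ⟪ν j, w⟫ = 0 → ⟪ν k, w⟫ ≤ 0 by
    intro w hi hj
    have := hle (-w) (by rw [inner_neg_right, hi, neg_zero]) (by rw [inner_neg_right, hj, neg_zero])
    rw [inner_neg_right] at this
    linarith [hle w hi hj]
  intro w hi hj
  by_contra hc
  have hc : 0 < ⟪ν k, w⟫ := not_le.1 hc
  set κ := ⟪ν k, w⟫ with hκ
  set s := ‖u₁ - u₂‖ with hs
  have hs2 : 0 < 2 - s := by linarith [norm_sub_lt_two hu₁ hu₂ hne]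
  set K := 2 * ‖w‖ ^ 2 / a with hK
  have hK0 : 0 ≤ K := by positivity
  set t := min (a / (2 * κ)) (κ * (2 - s) / (2 * (K + 1))) with ht
  have ht0 : 0 < t := by positivity
  have ht1 : t * κ ≤ a / 2 := by
    have : t ≤ a / (2 * κ) := min_le_left _ _
    rw [le_div_iff₀ (by positivity)] at this
    linarith
  have ht2 : t * K < κ * (2 - s) := by
    have : t ≤ κ * (2 - s) / (2 * (K + 1)) := min_le_right _ _
    rw [le_div_iff₀ (by positivity)] at this
    have : 0 ≤ t * K := by positivity
    nlinarith
  set r := a - t * κ with hr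
  have hr0 : 0 < r := by linarith
  set A := z + t • (w + κ • u₁) with hA
  set B := z + t • (w + κ • u₂) with hB
  have hcs : ∀ u : E, ‖u‖ = 1 → -1 ≤ ⟪ν k, u⟫ := by
    intro u hu
    have := (abs_le.1 (abs_real_inner_le_norm (ν k) u)).1
    rwa [h.unit, hu, one_mul] at this
  have hAk : β k ≤ ⟪ν k, A⟫ := by
    rw [hA, inner_add_right, inner_smul_right, inner_add_right, inner_smul_right, hzk, ← hκ]
    have : 0 ≤ t * (κ + κ * ⟪ν k, u₁⟫) := by
      have := hcs u₁ hu₁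
      apply mul_nonneg ht0.le
      nlinarith
    linarith
  have hBk : β k ≤ ⟪ν k, B⟫ := by
    rw [hB, inner_add_right, inner_smul_right, inner_add_right, inner_smul_right, hzk, ← hκ]
    have : 0 ≤ t * (κ + κ * ⟪ν k, u₂⟫) := by
      have := hcs u₂ hu₂
      apply mul_nonneg ht0.le
      nlinarith
    linarith
  have hAi : β i ≤ ⟪ν i, A⟫ := by
    rw [hA, inner_add_right, inner_smul_right, inner_add_right, inner_smul_right, hzi, hi, hi₁]
    simp
  have hBj : β j ≤ ⟪ν j, B⟫ := by
    rw [hB, inner_add_right, inner_smul_right, inner_add_right, inner_smul_right, hzj, hj, hj₂]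
    simp
  have h1i : β i ≤ ⟪ν i, z + a • u₁⟫ := by
    rw [inner_add_right, inner_smul_right, hi₁, hzi]; simp
  have h2j : β j ≤ ⟪ν j, z + a • u₂⟫ := by
    rw [inner_add_right, inner_smul_right, hj₂, hzj]; simp
  have O2 := h.halfSpace_subset j h2j
  have d1 := h.polyDist_le_add h2 i h1i hAi O2
  have d2 := h.polyDist_le_add h2 k hAk hBk O2
  have d3 := h.polyDist_le_norm j hBj h2j
  have n1 : ‖(z + a • u₁) - A‖ = ‖r • u₁ + (-t) • w‖ := by
    congr 1; rw [hA, hr]; module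
  have n2 : ‖A - B‖ = t * κ * s := by
    have : A - B = (t * κ) • (u₁ - u₂) := by rw [hA, hB]; module
    rw [this, norm_smul, Real.norm_of_nonneg (by positivity)]
  have n3 : ‖B - (z + a • u₂)‖ = ‖r • u₂ + (-t) • w‖ := by
    rw [← norm_neg]
    congr 1; rw [hB, hr]; module
  rw [n1] at d1
  rw [n2] at d2
  rw [n3] at d3
  have q1 := norm_smul_add_smul_le (u := w) hu₁ hr0 (-t)
  have q2 := norm_smul_add_smul_le (u := w) hu₂ hr0 (-t)
  have q3 := hstat w hi hj
  have q4 : ‖w‖ ^ 2 / (2 * r) ≤ K / 2 := by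
    have e : K / 2 = ‖w‖ ^ 2 / a := by rw [hK]; field_simp
    rw [e]
    apply div_le_div_of_nonneg_left (by positivity) ha
    linarith
  have q5 : (-t) ^ 2 * (‖w‖ ^ 2 / (2 * r)) ≤ t ^ 2 * (K / 2) := by
    rw [neg_sq]
    exact mul_le_mul_of_nonneg_left q4 (by positivity)
  have q6 : t * (t * K) < t * (κ * (2 - s)) := mul_lt_mul_of_pos_left ht2 ht0
  rw [q3] at q1
  nlinarith

theorem IsPolytope.midpoint (h2 : 2 ≤ Module.finrank ℝ E) (h : IsPolytope ν β) {z p : E}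
    (hz : z ∈ frontier (polyhedron ν β))
    (hp : p ∈ frontier (polyhedron ν β)) {u₁ u₂ : E} {i j : ι} {a : ℝ} (ha : 0 < a)
    (hu₁ : ‖u₁‖ = 1) (hu₂ : ‖u₂‖ = 1)
    (hzi : z ∈ polyFacet ν β i) (hzj : z ∈ polyFacet ν β j)
    (hi : z + a • u₁ ∈ polyFacet ν β i) (hj : z + a • u₂ ∈ polyFacet ν β j)
    (hmin : 2 * a ≤ polyDist ν β (z + a • u₁) (z + a • u₂)) :
    ∃ δ > 0, ∀ t ∈ Ioo 0 δ, polyDist ν β (z + t • u₁) p ^ 2 + polyDist ν β (z + t • u₂) p ^ 2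
      ≤ 2 * polyDist ν β z p ^ 2 + 2 * t ^ 2 := by
  have hi₁ := inner_eq_zero_of_facet ha.ne' hzi.2 hi.2
  have hj₂ := inner_eq_zero_of_facet ha.ne' hzj.2 hj.2
  have nrm : ∀ u : E, ‖u‖ = 1 → ∀ t : ℝ, 0 ≤ t → ‖t • u‖ = t := fun u hu t ht => by
    rw [norm_smul, hu, mul_one, Real.norm_of_nonneg ht]
  rcases eq_or_ne z p with rfl | hzp
  · refine ⟨1, one_pos, fun t ht => ?_⟩
    have d1 : polyDist ν β (z + t • u₁) z ≤ t := by
      refine (h.polyDist_le_norm i (b := z) ?_ hzi.2.ge).trans ?_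
      · rw [inner_add_right, inner_smul_right, hi₁, hzi.2]; simp
      · rw [add_sub_cancel_left, nrm u₁ hu₁ t ht.1.le]
    have d2 : polyDist ν β (z + t • u₂) z ≤ t := by
      refine (h.polyDist_le_norm j (b := z) ?_ hzj.2.ge).trans ?_
      · rw [inner_add_right, inner_smul_right, hj₂, hzj.2]; simp
      · rw [add_sub_cancel_left, nrm u₂ hu₂ t ht.1.le]
    have s1 := pow_le_pow_left₀ (pathDist_nonneg _ _ _) d1 2
    have s2 := pow_le_pow_left₀ (pathDist_nonneg _ _ _) d2 2
    have s3 := sq_nonneg (polyDist ν β z z)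
    unfold polyDist at *
    linarith
  obtain ⟨m, e, l, he, hl, -, ⟨k, hzk, hqk⟩, hall⟩ := h.exists_direction h2 hz hp hzp
  set r := polyDist ν β z p with hr
  have hr0 : 0 < r := h.polyDist_pos h2 hz.2 hp.2 hzp
  -- both directions controlled by hinges, with opposite first-order terms
  have both : ∀ i' j', (∃ ε > 0, ∀ v : E, ⟪ν i', v⟫ = 0 → ‖v‖ < ε →
        polyDist ν β (z + v) p ≤ ‖r • e - v‖) → (∃ ε > 0, ∀ v : E, ⟪ν j', v⟫ = 0 → ‖v‖ < ε →
        polyDist ν β (z + v) p ≤ ‖r • e - v‖) → ⟪ν i', u₁⟫ = 0 → ⟪ν j', u₂⟫ = 0 →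
        ⟪e, u₁⟫ = -⟪e, u₂⟫ → ∃ δ > 0, ∀ t ∈ Ioo 0 δ, polyDist ν β (z + t • u₁) p ^ 2 +
          polyDist ν β (z + t • u₂) p ^ 2 ≤ 2 * r ^ 2 + 2 * t ^ 2 := by
    rintro i' j' ⟨ε₁, hε₁, hg₁⟩ ⟨ε₂, hε₂, hg₂⟩ ho₁ ho₂ hop
    refine ⟨min ε₁ ε₂, lt_min hε₁ hε₂, fun t ht => ?_⟩
    have d1 := hg₁ (t • u₁) (by rw [inner_smul_right, ho₁, mul_zero])
      (by rw [nrm u₁ hu₁ t ht.1.le]; exact ht.2.trans_le (min_le_left _ _))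
    have d2 := hg₂ (t • u₂) (by rw [inner_smul_right, ho₂, mul_zero])
      (by rw [nrm u₂ hu₂ t ht.1.le]; exact ht.2.trans_le (min_le_right _ _))
    have s1 := pow_le_pow_left₀ (pathDist_nonneg _ _ _) d1 2
    have s2 := pow_le_pow_left₀ (pathDist_nonneg _ _ _) d2 2
    rw [sq_norm_smul_sub he hu₁, hop] at s1
    rw [sq_norm_smul_sub he hu₂] at s2
    unfold polyDist
    linarith
  rcases eq_or_ne u₁ (-u₂) with hstr | hne
  · have hk := hall k hzk hqk
    have o1 := inner_nonpos_of_smul ha hzk.2 hi.1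
    have o2 := inner_nonpos_of_smul ha hzk.2 hj.1
    have e1 : ⟪ν k, u₁⟫ = -⟪ν k, u₂⟫ := by rw [hstr, inner_neg_right]
    exact both k k hk hk (by linarith) (by linarith) (by rw [hstr, inner_neg_right])
  · have hlt : ‖(z + a • u₁) - (z + a • u₂)‖ < 2 * a := by
      rw [add_sub_add_left_eq_sub, ← smul_sub, norm_smul, Real.norm_of_nonneg ha.le]
      nlinarith [norm_sub_lt_two hu₁ hu₂ hne]
    have hi₂ : ⟪ν i, u₂⟫ < 0 := by
      refine lt_of_le_of_ne (inner_nonpos_of_smul ha hzi.2 hj.1) fun h0 => ?_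
      have := h.polyDist_le_norm i (a := z + a • u₁) (b := z + a • u₂) hi.2.ge
        (by rw [inner_add_right, inner_smul_right, h0, hzi.2]; simp)
      linarith
    have hj₁ : ⟪ν j, u₁⟫ < 0 := by
      refine lt_of_le_of_ne (inner_nonpos_of_smul ha hzj.2 hi.1) fun h0 => ?_
      have := h.polyDist_le_norm j (a := z + a • u₁) (b := z + a • u₂)
        (by rw [inner_add_right, inner_smul_right, h0, hzj.2]; simp) hj.2.ge
      linarith
    have hstat : ∀ w, ⟪ν i, w⟫ = 0 → ⟪ν j, w⟫ = 0 → ⟪u₁, w⟫ = -⟪u₂, w⟫ := by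
      intro w hwi hwj
      suffices ⟪u₁, w⟫ + ⟪u₂, w⟫ = 0 by linarith
      refine eq_zero_of_forall_small (K := ‖w‖ ^ 2 / (2 * a) + ‖w‖ ^ 2 / (2 * a))
        one_pos fun t _ => ?_
      have d1 := h.polyDist_le_add h2 i (a := z + a • u₁) (b := z + (-t) • w) hi.2.ge
        (by rw [inner_add_right, inner_smul_right, hwi, hzi.2]; simp)
        (h.facet_subset_exterior j hj)
      have d2 := h.polyDist_le_norm j (a := z + (-t) • w) (b := z + a • u₂)
        (by rw [inner_add_right, inner_smul_right, hwj, hzj.2]; simp) hj.2.ge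
      have n1 : ‖(z + a • u₁) - (z + (-t) • w)‖ = ‖a • u₁ + t • w‖ := by
        congr 1; module
      have n2 : ‖(z + (-t) • w) - (z + a • u₂)‖ = ‖a • u₂ + t • w‖ := by
        rw [← norm_neg]; congr 1; module
      rw [n1] at d1
      rw [n2] at d2
      have q1 := norm_smul_add_smul_le (u := w) hu₁ ha t
      have q2 := norm_smul_add_smul_le (u := w) hu₂ ha t
      linarith
    have hspan := h.inner_eq_zero_of_bend h2 ha hu₁ hu₂ hne hzi.2 hzj.2 hzk.2 hi₁ hj₂ hmin hstat
    obtain ⟨c, d, hcd⟩ := mem_span_pair_of_orthogonal hspan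
    have hie := inner_nonpos_of_smul hl hzi.2 hqk.1
    have hje := inner_nonpos_of_smul hl hzj.2 hqk.1
    have hke := inner_eq_zero_of_facet hl.ne' hzk.2 hqk.2
    have hk₁ := inner_nonpos_of_smul ha hzk.2 hi.1
    have hk₂ := inner_nonpos_of_smul ha hzk.2 hj.1
    have inn : ∀ v, ⟪ν k, v⟫ = c * ⟪ν i, v⟫ + d * ⟪ν j, v⟫ := fun v => by
      rw [← hcd, inner_add_left, real_inner_smul_left, real_inner_smul_left]
    rw [inn, hi₁] at hk₁
    rw [inn, hj₂] at hk₂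
    rw [inn] at hke
    have hc0 : 0 ≤ c := by nlinarith
    have hd0 : 0 ≤ d := by nlinarith
    have hqi : ⟪ν i, e⟫ = 0 → z + l • e ∈ polyFacet ν β i := fun h0 =>
      ⟨hqk.1, by rw [inner_add_right, inner_smul_right, h0, hzi.2]; simp⟩
    have hqj : ⟪ν j, e⟫ = 0 → z + l • e ∈ polyFacet ν β j := fun h0 =>
      ⟨hqk.1, by rw [inner_add_right, inner_smul_right, h0, hzj.2]; simp⟩
    have hor : ⟪ν i, e⟫ = 0 ∨ ⟪ν j, e⟫ = 0 := by
      by_contra hcon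
      push Not at hcon
      have hi' := lt_of_le_of_ne hie hcon.1
      have hj' := lt_of_le_of_ne hje hcon.2
      have hc' : c = 0 := by nlinarith
      have hd' : d = 0 := by nlinarith
      have := h.unit k
      rw [← hcd, hc', hd'] at this
      simp at this
    by_cases hie0 : ⟪ν i, e⟫ = 0
    · by_cases hje0 : ⟪ν j, e⟫ = 0
      · refine both i j (hall i hzi (hqi hie0)) (hall j hzj (hqj hje0)) hi₁ hj₂ ?_
        rw [real_inner_comm, real_inner_comm u₂ e]
        exact hstat e hie0 hje0
      · obtain ⟨ε, hε, hg⟩ := hall i hzi (hqi hie0)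
        obtain ⟨δ, hδ, hfin⟩ := h.midpoint_of_hinge h2 hp hu₂ hu₁ he hr0 hε hzj.2 hj₂ hj₁ hi₁
          (lt_of_le_of_ne hje hje0) hie0 (fun w hwj hwi => by rw [hstat w hwi hwj, neg_neg]) hg
        exact ⟨δ, hδ, fun t ht => by rw [add_comm]; exact hfin t ht⟩
    · have hje0 := hor.resolve_left hie0
      obtain ⟨ε, hε, hg⟩ := hall j hzj (hqj hje0)
      exact h.midpoint_of_hinge h2 hp hu₁ hu₂ he hr0 hε hzi.2 hi₁ hi₂ hj₂
          (lt_of_le_of_ne hie hie0) hje0 hstat hg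

end Midpoint

section Geodesic

variable {E : Type*} [NormedAddCommGroup E] [InnerProductSpace ℝ E] {ι : Type*}

variable {ν : ι → E} {β : ι → ℝ} [FiniteDimensional ℝ E] [Finite ι]

theorem IsPolytope.curve_of_chain (h2 : 2 ≤ Module.finrank ℝ E) (h : IsPolytope ν β) {b : E} :
    ∀ {m : ℕ} {a : E} {L : ℝ}, a ∈ frontier (polyhedron ν β) →
      SegmentChain (polyFacet ν β) m a b L →
      ∃ σ : ℝ → E, σ 0 = a ∧ σ L = b ∧ (∀ t ∈ Icc 0 L, σ t ∈ frontier (polyhedron ν β)) ∧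
        ∀ s ∈ Icc 0 L, ∀ t ∈ Icc 0 L, s ≤ t → polyDist ν β (σ s) (σ t) ≤ t - s := by
  intro m
  induction m with
  | zero =>
    rintro a L ha ⟨rfl, rfl⟩
    refine ⟨fun _ => a, rfl, rfl, fun _ _ => ha, fun s _ t _ hst => ?_⟩
    rw [polyDist, pathDist_self (frontier_subset_compl_interior _ ha)]
    linarith
  | succ m ih =>
    rintro a L ha ⟨j, z, L', haj, hzj, hc, rfl⟩
    obtain ⟨σ, h0, h1, hB, hD⟩ := ih (h.facet_subset_frontier j hzj) hc
    have hL' := hc.nonneg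
    set l := ‖a - z‖ with hl
    have hl0 : 0 ≤ l := norm_nonneg _
    have hseg : ∀ t ∈ Icc 0 l, a + (t / l) • (z - a) ∈ polyFacet ν β j := by
      intro t ht
      refine (polyFacet_convex ν β j).add_smul_sub_mem haj hzj ⟨by have := ht.1; positivity, ?_⟩
      exact div_le_one_of_le₀ ht.2 hl0
    have hsegd : ∀ s ∈ Icc 0 l, ∀ t ∈ Icc 0 l, s ≤ t →
        polyDist ν β (a + (s / l) • (z - a)) (a + (t / l) • (z - a)) ≤ t - s := by
      intro s hs t ht hst
      refine (h.polyDist_le_norm j (hseg s hs).2.ge (hseg t ht).2.ge).trans ?_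
      rw [add_sub_add_left_eq_sub, ← sub_smul, norm_smul, norm_sub_rev z a, ← hl, ← sub_div,
        Real.norm_eq_abs, abs_div, abs_of_nonneg hl0, abs_sub_comm, abs_of_nonneg (by linarith)]
      rcases hl0.eq_or_lt with h0 | hpos
      · rw [← h0, mul_zero]; linarith
      · rw [div_mul_cancel₀ _ hpos.ne']
    have hend : a + (l / l) • (z - a) = z := by
      rcases hl0.eq_or_lt with h0 | hpos
      · have : a - z = 0 := norm_eq_zero.1 (hl ▸ h0.symm)
        rw [← h0, div_zero, zero_smul, add_zero]
        exact sub_eq_zero.1 this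
      · rw [div_self hpos.ne', one_smul, add_sub_cancel]
    refine ⟨fun t => if t ≤ l then a + (t / l) • (z - a) else σ (t - l), ?_, ?_, ?_, ?_⟩
    · simp [hl0]
    · rcases hL'.eq_or_lt with h00 | hpos
      · simp only [← h00, add_zero, le_refl, if_true]
        rw [hend, ← h0, ← h1, ← h00]
      · have : ¬ l + L' ≤ l := by linarith
        simp only [this, if_false, add_sub_cancel_left]
        exact h1
    · intro t ht
      simp only
      split_ifs with htl
      · exact h.facet_subset_frontier j (hseg t ⟨ht.1, htl⟩)
      · exact hB _ ⟨by linarith, by linarith [ht.2]⟩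
    · intro s hs t ht hst
      simp only
      by_cases htl : t ≤ l
      · rw [if_pos htl, if_pos (hst.trans htl)]
        exact hsegd s ⟨hs.1, hst.trans htl⟩ t ⟨ht.1, htl⟩ hst
      · rw [if_neg htl]
        have htm : t - l ∈ Icc 0 L' := ⟨by linarith, by linarith [ht.2]⟩
        by_cases hsl : s ≤ l
        · rw [if_pos hsl]
          have d1 := hsegd s ⟨hs.1, hsl⟩ l ⟨hl0, le_rfl⟩ hsl
          rw [hend] at d1
          have d2 := hD 0 ⟨le_rfl, hL'⟩ (t - l) htm (by linarith)
          rw [h0] at d2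
          have := h.polyDist_triangle h2 (h.facet_subset_exterior j (hseg s ⟨hs.1, hsl⟩))
            (h.facet_subset_exterior j hzj)
            (frontier_subset_compl_interior _ (hB (t - l) htm))
          linarith
        · rw [if_neg hsl]
          have := hD (s - l) ⟨by linarith, by linarith [hs.2]⟩ (t - l) htm (by linarith)
          linarith

/-- Minimal curves on the boundary of a polytope, parametrised by arc length. -/
theorem IsPolytope.exists_geodesic (h2 : 2 ≤ Module.finrank ℝ E) (h : IsPolytope ν β) {a b : E}
    (ha : a ∈ frontier (polyhedron ν β)) (hb : b ∈ frontier (polyhedron ν β)) :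
    ∃ σ : ℝ → E, σ 0 = a ∧ σ (polyDist ν β a b) = b ∧
      (∀ t ∈ Icc 0 (polyDist ν β a b), σ t ∈ frontier (polyhedron ν β)) ∧
      ∀ s ∈ Icc 0 (polyDist ν β a b), ∀ t ∈ Icc 0 (polyDist ν β a b), s ≤ t →
        polyDist ν β (σ s) (σ t) = t - s := by
  obtain ⟨m, hm⟩ := h.exists_chain h2 ha hb
  obtain ⟨σ, h0, h1, hB, hD⟩ := h.curve_of_chain h2 ha hm
  set T := polyDist ν β a b with hT
  have hT0 : 0 ≤ T := pathDist_nonneg _ _ _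
  have hO : ∀ t ∈ Icc 0 T, σ t ∈ (interior (polyhedron ν β))ᶜ := fun t ht =>
    frontier_subset_compl_interior _ (hB t ht)
  refine ⟨σ, h0, h1, hB, fun s hs t ht hst => le_antisymm (hD s hs t ht hst) ?_⟩
  have m0 : (0:ℝ) ∈ Icc 0 T := ⟨le_rfl, hT0⟩
  have mT : T ∈ Icc 0 T := ⟨hT0, le_rfl⟩
  have d1 := hD 0 m0 s hs hs.1
  have d2 := hD t ht T mT ht.2
  have t1 := h.polyDist_triangle h2 (hO 0 m0) (hO s hs) (hO T mT)
  have t2 := h.polyDist_triangle h2 (hO s hs) (hO t ht) (hO T mT)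
  rw [h0] at d1 t1
  rw [h1] at d2 t1 t2
  linarith

/-- A unit speed curve in the boundary whose nearby values lie in one facet moves along a
straight segment. -/
theorem IsPolytope.exists_initial_segment {σ : ℝ → E} {d : ℝ} (h : IsPolytope ν β) (hd : 0 < d)
    (hB : ∀ t ∈ Icc 0 d, σ t ∈ frontier (polyhedron ν β))
    (hlip : ∀ s ∈ Icc 0 d, ∀ t ∈ Icc 0 d, s ≤ t → ‖σ s - σ t‖ ≤ t - s)
    (hD : ∀ t ∈ Icc 0 d, polyDist ν β (σ 0) (σ t) = t) :
    ∃ j u, ∃ a > 0, a ≤ d ∧ ‖u‖ = 1 ∧ σ 0 ∈ polyFacet ν β j ∧ σ 0 + a • u ∈ polyFacet ν β j ∧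
      ∀ t ∈ Icc 0 a, σ t = σ 0 + t • u := by
  have hmem : ∀ n : ℕ, d / (n + 1) ∈ Icc 0 d := fun n =>
    ⟨by positivity, div_le_self hd.le (by linarith [n.cast_nonneg (α := ℝ)])⟩
  choose J hJ using fun n : ℕ => h.mem_frontier.1 (hB _ (hmem n))
  obtain ⟨j, hj⟩ := Finite.exists_infinite_fiber J
  have hj : (J ⁻¹' {j}).Infinite := Set.infinite_coe_iff.1 hj
  have h0 : (0 : ℝ) ∈ Icc 0 d := ⟨le_rfl, hd.le⟩
  have hlim : Filter.Tendsto (fun n : ℕ => σ (d / (n + 1))) Filter.atTop (nhds (σ 0)) := by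
    rw [tendsto_iff_norm_sub_tendsto_zero]
    refine squeeze_zero (fun _ => norm_nonneg _) (fun n => ?_)
      (by simpa [div_eq_mul_inv] using
        (tendsto_one_div_add_atTop_nhds_zero_nat (𝕜 := ℝ)).const_mul d)
    rw [norm_sub_rev]
    have := hlip 0 h0 _ (hmem n) (hmem n).1
    rwa [sub_zero] at this
  have hσ0 : σ 0 ∈ polyFacet ν β j := by
    refine (polyFacet_isClosed ν β j).mem_of_frequently_of_tendsto ?_ hlim
    refine (Nat.frequently_atTop_iff_infinite.2 hj).mono fun n hn => ?_
    have : J n = j := hn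
    exact this ▸ hJ n
  obtain ⟨n, hn⟩ := hj.nonempty
  have hn : J n = j := hn
  set a := d / ((n : ℝ) + 1) with ha
  have ha0 : 0 < a := by positivity
  have hσa : σ a ∈ polyFacet ν β j := hn ▸ hJ n
  have hle : a ≤ ‖σ 0 - σ a‖ := by
    have := h.polyDist_le_norm j hσ0.2.ge hσa.2.ge
    rwa [hD a (hmem n)] at this
  refine ⟨j, a⁻¹ • (σ a - σ 0), a, ha0, (hmem n).2, ?_, hσ0, ?_, fun t ht => ?_⟩
  · have := hlip 0 h0 a (hmem n) ha0.le
    rw [norm_smul, norm_inv, Real.norm_of_nonneg ha0.le, norm_sub_rev, le_antisymm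
      (this.trans (sub_zero a).le) hle, inv_mul_cancel₀ ha0.ne']
  · rwa [smul_inv_smul₀ ha0.ne', add_sub_cancel]
  · have htd : t ∈ Icc 0 d := ⟨ht.1, ht.2.trans (hmem n).2⟩
    have l1 := hlip 0 h0 t htd ht.1
    have l2 := hlip t htd a (hmem n) ht.2
    have l3 : ‖σ 0 - σ a‖ ≤ ‖σ 0 - σ t‖ + ‖σ t - σ a‖ := norm_sub_le_norm_sub_add_norm_sub _ _ _
    have l4 := hlip 0 h0 a (hmem n) ha0.le
    have hn0 : ‖σ 0 - σ a‖ = a := by linarith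
    have key := eq_lineMap_of_dist_eq_mul_of_dist_eq_mul (E := E) (x := σ 0) (y := σ t) (z := σ a)
      (r := t / a)
      (by rw [dist_eq_norm, dist_eq_norm, hn0, div_mul_cancel₀ _ ha0.ne']; linarith)
      (by rw [dist_eq_norm, dist_eq_norm, hn0, sub_mul, div_mul_cancel₀ _ ha0.ne']; linarith)
    rw [key, AffineMap.lineMap_apply, vsub_eq_sub, vadd_eq_add, smul_smul, div_eq_mul_inv, add_comm]

/-- Comparison of distances from a point with the Euclidean ones along a minimal curve: the
boundary of a polytope is nonnegatively curved. -/
theorem IsPolytope.exists_comparison (h2 : 2 ≤ Module.finrank ℝ E) (h : IsPolytope ν β)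
    {x y p : E} (hx : x ∈ frontier (polyhedron ν β)) (hy : y ∈ frontier (polyhedron ν β))
    (hp : p ∈ frontier (polyhedron ν β)) {t : ℝ} (ht : t ∈ Icc 0 (polyDist ν β x y)) :
    ∃ m ∈ frontier (polyhedron ν β), polyDist ν β x m = t ∧
      polyDist ν β m y = polyDist ν β x y - t ∧
      (polyDist ν β x y - t) * polyDist ν β x p ^ 2 + t * polyDist ν β y p ^ 2
        ≤ polyDist ν β x y * (polyDist ν β m p ^ 2 + t * (polyDist ν β x y - t)) := by
  obtain ⟨σ, h0, h1, hB, hD⟩ := h.exists_geodesic h2 hx hy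
  set T := polyDist ν β x y with hT
  have hT0 : 0 ≤ T := pathDist_nonneg _ _ _
  have m0 : (0:ℝ) ∈ Icc 0 T := ⟨le_rfl, hT0⟩
  have mT : T ∈ Icc 0 T := ⟨hT0, le_rfl⟩
  have hO : ∀ t ∈ Icc 0 T, σ t ∈ (interior (polyhedron ν β))ᶜ := fun t ht =>
    frontier_subset_compl_interior _ (hB t ht)
  have hpO := frontier_subset_compl_interior _ hp
  refine ⟨σ t, hB t ht, ?_, ?_, ?_⟩
  · have := hD 0 m0 t ht ht.1
    rwa [h0, sub_zero] at this
  · have := hD t ht T mT ht.2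
    rwa [h1] at this
  rcases hT0.eq_or_lt with hz | hTpos
  · have ht0 : t = 0 := le_antisymm (hz ▸ ht.2) ht.1
    rw [ht0, ← hz]; simp
  have hlip : ∀ s ∈ Icc 0 T, ∀ t ∈ Icc 0 T, s ≤ t → ‖σ s - σ t‖ ≤ t - s := fun s hs t ht hst =>
    ((h.lengthConnected h2).norm_sub_le (hO s hs) (hO t ht)).trans (hD s hs t ht hst).le
  set g : ℝ → ℝ := fun s => polyDist ν β (σ s) p with hg
  have hgl : ∀ s ∈ Icc 0 T, ∀ t ∈ Icc 0 T, s ≤ t → |g s - g t| ≤ t - s := by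
    intro s hs t ht hst
    have e := hD s hs t ht hst
    have t1 := h.polyDist_triangle h2 (hO s hs) (hO t ht) hpO
    have t2 := h.polyDist_triangle h2 (hO t ht) (hO s hs) hpO
    have e2 : polyDist ν β (σ t) (σ s) = t - s := by rw [← e]; exact pathDist_comm _ _ _
    rw [abs_le]
    constructor <;> simp only [hg] <;> linarith
  have hgc : ContinuousOn g (Icc 0 T) := by
    refine (LipschitzOnWith.of_dist_le_mul (K := 1) fun s hs t ht => ?_).continuousOn
    rw [Real.dist_eq, Real.dist_eq, NNReal.coe_one, one_mul]
    rcases le_total s t with hst | hst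
    · rw [abs_sub_comm s t, abs_of_nonneg (sub_nonneg.2 hst)]
      exact hgl s hs t ht hst
    · rw [abs_sub_comm, abs_of_nonneg (sub_nonneg.2 hst)]
      exact hgl t ht s hs hst
  rcases ht.1.eq_or_lt with ht0 | ht0
  · rw [← ht0, h0]; simp
  rcases ht.2.eq_or_lt with htT | htT
  · rw [htT, h1]; simp
  have key := le_chord_of_local_midpoint (f := fun s => s ^ 2 - g s ^ 2) hTpos
    (by fun_prop) (fun s hs => ?_) ht
  · have e0 : g 0 = polyDist ν β x p := by simp only [hg, h0]
    have e1 : g T = polyDist ν β y p := by simp only [hg, h1]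
    have e2 : g t = polyDist ν β (σ t) p := rfl
    simp only [e0, e1, e2] at key
    nlinarith
  · obtain ⟨i, u₁, a₁, ha₁, had₁, hu₁, hzi, hi, hs₁⟩ := h.exists_initial_segment
      (σ := fun r => σ (s - r)) (d := s) hs.1
      (fun r hr => hB _ ⟨by linarith [hr.2], by linarith [hr.1, hs.2]⟩)
      (fun r hr q hq hrq => by
        have := hlip (s - q) ⟨by linarith [hq.2], by linarith [hq.1, hs.2]⟩ (s - r)
          ⟨by linarith [hr.2], by linarith [hr.1, hs.2]⟩ (by linarith)
        rw [norm_sub_rev]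
        linarith)
      (fun r hr => by
        have := hD (s - r) ⟨by linarith [hr.2], by linarith [hr.1, hs.2]⟩ s ⟨hs.1.le, hs.2.le⟩
          (by linarith [hr.1])
        simp only [sub_zero]
        rw [polyDist, pathDist_comm, ← polyDist, this]; ring)
    obtain ⟨j, u₂, a₂, ha₂, had₂, hu₂, hzj, hj, hs₂⟩ := h.exists_initial_segment
      (σ := fun r => σ (s + r)) (d := T - s) (sub_pos.2 hs.2)
      (fun r hr => hB _ ⟨by linarith [hr.1, hs.1], by linarith [hr.2]⟩)
      (fun r hr q hq hrq => by
        have := hlip (s + r) ⟨by linarith [hr.1, hs.1], by linarith [hr.2]⟩ (s + q)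
          ⟨by linarith [hq.1, hs.1], by linarith [hq.2]⟩ (by linarith)
        linarith)
      (fun r hr => by
        have := hD s ⟨hs.1.le, hs.2.le⟩ (s + r) ⟨by linarith [hr.1, hs.1], by linarith [hr.2]⟩
          (by linarith [hr.1])
        simp only [add_zero]
        rw [this]; ring)
    simp only [sub_zero, add_zero] at hzi hi hs₁ hzj hj hs₂
    set a := min a₁ a₂ with ha
    have ha0 : 0 < a := lt_min ha₁ ha₂
    have seg : ∀ {k : ι} {u : E} {b : ℝ}, 0 < b → a ≤ b → σ s ∈ polyFacet ν β k →
        σ s + b • u ∈ polyFacet ν β k → σ s + a • u ∈ polyFacet ν β k := by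
      intro k u b hb hab hk hk'
      have := (polyFacet_convex ν β k).add_smul_mem hk hk' (t := a / b)
        ⟨by positivity, div_le_one_of_le₀ hab hb.le⟩
      rwa [smul_smul, div_mul_cancel₀ _ hb.ne'] at this
    obtain ⟨δ, hδ, hmid⟩ := h.midpoint h2 (p := p) (hB s ⟨hs.1.le, hs.2.le⟩) hp ha0 hu₁ hu₂
      hzi hzj (seg ha₁ (min_le_left _ _) hzi hi) (seg ha₂ (min_le_right _ _) hzj hj) (by
        rw [← hs₁ a ⟨ha0.le, min_le_left _ _⟩, ← hs₂ a ⟨ha0.le, min_le_right _ _⟩,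
          hD (s - a) ⟨by linarith [min_le_left a₁ a₂], by linarith [hs.2]⟩ (s + a)
          ⟨by linarith [hs.1], by linarith [min_le_right a₁ a₂]⟩ (by linarith)]
        linarith)
    refine ⟨min δ a, lt_min hδ ha0, fun q hq => ?_⟩
    have hqa : q ≤ a := hq.2.le.trans (min_le_right _ _)
    have := hmid q ⟨hq.1, hq.2.trans_le (min_le_left _ _)⟩
    rw [← hs₁ q ⟨hq.1.le, hqa.trans (min_le_left _ _)⟩,
      ← hs₂ q ⟨hq.1.le, hqa.trans (min_le_right _ _)⟩] at this
    simp only [hg]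
    nlinarith

end Geodesic

section Chart

variable {E : Type*} [NormedAddCommGroup E] [InnerProductSpace ℝ E]

/-- The height at which the line through `y` in direction `e` enters `C`. -/
noncomputable def lowerHeight (C : Set E) (e y : E) : ℝ := sInf {t : ℝ | y + t • e ∈ C}

/-- The point at which the line through `y` in direction `e` enters `C`. -/
noncomputable def lowerPoint (C : Set E) (e y : E) : E := y + lowerHeight C e y • e

/-- Data for the description of the part of `frontier C` seen from a ball inside `C` in the
direction `-e` as a graph. -/
structure IsChart (C : Set E) (c e : E) (ρ R : ℝ) : Prop where
  convex : Convex ℝ C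
  compact : IsCompact C
  unit : ‖e‖ = 1
  pos : 0 < ρ
  ball_subset : Metric.ball c (2 * ρ) ⊆ C
  subset_ball : C ⊆ Metric.closedBall c R

variable {C : Set E} {c e : E} {ρ R : ℝ}

theorem IsChart.ball_subset_ball (hC : IsChart C c e ρ R) :
    Metric.ball c ρ ⊆ Metric.ball c (2 * ρ) :=
  Metric.ball_subset_ball (by linarith [hC.pos])

theorem IsChart.ball_subset_interior (hC : IsChart C c e ρ R) :
    Metric.ball c (2 * ρ) ⊆ interior C := interior_maximal hC.ball_subset Metric.isOpen_ball

theorem IsChart.isConvexBody (hC : IsChart C c e ρ R) : IsConvexBody C :=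
  ⟨hC.compact, hC.convex, c,
    hC.ball_subset_interior (Metric.mem_ball_self (by linarith [hC.pos]))⟩

theorem IsChart.abs_param_le (hC : IsChart C c e ρ R) {y : E}
    (hy : y ∈ Metric.ball c (2 * ρ)) {t : ℝ}
    (ht : y + t • e ∈ C) : |t| ≤ 2 * R := by
  have h1 := hC.subset_ball (hC.ball_subset hy)
  have h2 := hC.subset_ball ht
  have h3 := dist_triangle_right (y + t • e) y c
  rw [dist_eq_norm, add_sub_cancel_left, norm_smul, hC.unit, mul_one, Real.norm_eq_abs] at h3
  have := Metric.mem_closedBall.1 h1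
  have := Metric.mem_closedBall.1 h2
  linarith

theorem IsChart.bddBelow (hC : IsChart C c e ρ R) {y : E} (hy : y ∈ Metric.ball c (2 * ρ)) :
    BddBelow {t : ℝ | y + t • e ∈ C} :=
  ⟨-(2 * R), fun _ ht => (abs_le.1 (hC.abs_param_le hy ht)).1⟩

theorem IsChart.lowerPoint_mem (hC : IsChart C c e ρ R) {y : E} (hy : y ∈ Metric.ball c (2 * ρ)) :
    lowerPoint C e y ∈ C := by
  have hcl : IsClosed {t : ℝ | y + t • e ∈ C} :=
    hC.compact.isClosed.preimage (f := fun t : ℝ => y + t • e) (by fun_prop)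
  exact hcl.csInf_mem ⟨0, by simpa using hC.ball_subset hy⟩ (hC.bddBelow hy)

theorem IsChart.lowerHeight_le (hC : IsChart C c e ρ R) {y : E} (hy : y ∈ Metric.ball c (2 * ρ))
    {t : ℝ} (ht : y + t • e ∈ C) : lowerHeight C e y ≤ t := csInf_le (hC.bddBelow hy) ht

theorem IsChart.lowerHeight_nonpos (hC : IsChart C c e ρ R) {y : E}
    (hy : y ∈ Metric.ball c (2 * ρ)) : lowerHeight C e y ≤ 0 :=
  hC.lowerHeight_le hy (by simpa using hC.ball_subset hy)

theorem IsChart.abs_lowerHeight_le (hC : IsChart C c e ρ R) {y : E}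
    (hy : y ∈ Metric.ball c (2 * ρ)) : |lowerHeight C e y| ≤ 2 * R :=
  hC.abs_param_le hy (hC.lowerPoint_mem hy)

theorem IsChart.notMem_interior (hC : IsChart C c e ρ R) {y : E}
    (hy : y ∈ Metric.ball c (2 * ρ)) {t : ℝ} (ht : t ≤ lowerHeight C e y) :
    y + t • e ∉ interior C := by
  intro hi
  have hcont : ContinuousAt (fun s : ℝ => y + s • e) t := by fun_prop
  have : ∀ᶠ s : ℝ in nhds t, y + s • e ∈ C := hcont (mem_interior_iff_mem_nhds.1 hi)
  obtain ⟨ε, hε, hball⟩ := Metric.eventually_nhds_iff.1 this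
  have hm := hball (y := t - ε / 2) (by
    rw [Real.dist_eq, sub_sub_cancel_left, abs_neg, abs_of_pos (half_pos hε)]; linarith)
  linarith [hC.lowerHeight_le hy hm]

theorem IsChart.lowerPoint_mem_frontier (hC : IsChart C c e ρ R) {y : E}
    (hy : y ∈ Metric.ball c (2 * ρ)) : lowerPoint C e y ∈ frontier C :=
  ⟨subset_closure (hC.lowerPoint_mem hy), hC.notMem_interior hy le_rfl⟩

theorem IsChart.convexOn (hC : IsChart C c e ρ R) :
    ConvexOn ℝ (Metric.ball c (2 * ρ)) (lowerHeight C e) := by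
  refine ⟨convex_ball _ _, fun x hx y hy a b ha hb hab => ?_⟩
  refine hC.lowerHeight_le (convex_ball _ _ hx hy ha hb hab) ?_
  have := hC.convex (hC.lowerPoint_mem hx) (hC.lowerPoint_mem hy) ha hb hab
  convert this using 1
  simp only [lowerPoint, smul_eq_mul]
  module

/-- A point of the frontier strictly behind a point of the ball is recovered by the chart. -/
theorem IsChart.lowerHeight_eq (hC : IsChart C c e ρ R) {y : E}
    (hy : y ∈ Metric.ball c (2 * ρ)) {t : ℝ} (ht : t ≤ 0) (hx : y + t • e ∈ frontier C) :
    lowerHeight C e y = t := by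
  have hxC : y + t • e ∈ C := hC.compact.isClosed.frontier_subset hx
  refine le_antisymm (hC.lowerHeight_le hy hxC) ?_
  by_contra hlt
  have hlt := not_le.1 hlt
  have hopen := hC.convex.openSegment_interior_self_subset_interior
    (hC.ball_subset_interior hy) (hC.lowerPoint_mem hy)
  rcases ht.eq_or_lt with rfl | htneg
  · apply hx.2
    simpa using hC.ball_subset_interior hy
  · apply hx.2
    apply hopen
    set l := lowerHeight C e y with hl
    have hl0 : l < 0 := hlt.trans htneg
    refine ⟨1 - t / l, t / l, ?_, div_pos_of_neg_of_neg htneg hl0, by ring, ?_⟩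
    · rw [sub_pos, div_lt_one_of_neg hl0]; exact hlt
    · have e1 : (t / l) * l = t := div_mul_cancel₀ _ hl0.ne
      simp only [lowerPoint]
      rw [← hl, smul_add, smul_smul, e1]
      module

theorem IsChart.lipschitzOnWith (hC : IsChart C c e ρ R) :
    LipschitzOnWith (2 * (2 * R) / ρ).toNNReal (lowerHeight C e) (Metric.ball c ρ) := by
  have := hC.convexOn.lipschitzOnWith_of_abs_le hC.pos fun a ha =>
    hC.abs_lowerHeight_le (Metric.mem_ball.2 ha)
  rwa [show 2 * ρ - ρ = ρ by ring] at this

theorem IsChart.radius_pos (hC : IsChart C c e ρ R) : 0 < R := by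
  have h0 : c ∈ Metric.ball c (2 * ρ) := Metric.mem_ball_self (by linarith [hC.pos])
  have h1 : c + ρ • e ∈ C := hC.ball_subset (by
    rw [Metric.mem_ball, dist_eq_norm, add_sub_cancel_left, norm_smul, hC.unit,
      Real.norm_of_nonneg hC.pos.le]
    linarith [hC.pos])
  have := hC.abs_param_le h0 h1
  rw [abs_of_pos hC.pos] at this
  linarith [hC.pos]

theorem IsChart.abs_sub_le (hC : IsChart C c e ρ R) {y z : E} (hy : y ∈ Metric.ball c ρ)
    (hz : z ∈ Metric.ball c ρ) :
    |lowerHeight C e y - lowerHeight C e z| ≤ 4 * R / ρ * ‖y - z‖ := by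
  have h0 : 0 ≤ 2 * (2 * R) / ρ := by have := hC.radius_pos; have := hC.pos; positivity
  have := hC.lipschitzOnWith.dist_le_mul y hy z hz
  rw [Real.dist_eq, dist_eq_norm, Real.coe_toNNReal _ h0] at this
  convert this using 2
  ring

theorem IsChart.norm_lowerPoint_sub_le (hC : IsChart C c e ρ R) {y z : E}
    (hy : y ∈ Metric.ball c ρ) (hz : z ∈ Metric.ball c ρ) :
    ‖lowerPoint C e y - lowerPoint C e z‖ ≤ (1 + 4 * R / ρ) * ‖y - z‖ := by
  have e1 : lowerPoint C e y - lowerPoint C e z =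
      (y - z) + (lowerHeight C e y - lowerHeight C e z) • e := by
    simp only [lowerPoint]; module
  rw [e1]
  refine (norm_add_le _ _).trans ?_
  rw [norm_smul, hC.unit, mul_one, Real.norm_eq_abs]
  linarith [hC.abs_sub_le hy hz]

theorem IsChart.pathDist_lowerPoint_le (hC : IsChart C c e ρ R) {y z : E}
    (hy : y ∈ Metric.ball c ρ) (hz : z ∈ Metric.ball c ρ) :
    pathDist (interior C)ᶜ (lowerPoint C e y) (lowerPoint C e z) ≤ (1 + 4 * R / ρ) * ‖y - z‖ := by
  have h0 : 0 ≤ 1 + 4 * R / ρ := by have := hC.radius_pos; have := hC.pos; positivity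
  have hl : LipschitzOnWith (1 + 4 * R / ρ).toNNReal (lowerPoint C e) (Metric.ball c ρ) :=
    LipschitzOnWith.of_dist_le_mul fun y hy z hz => by
      rw [dist_eq_norm, dist_eq_norm, Real.coe_toNNReal _ h0]
      exact hC.norm_lowerPoint_sub_le hy hz
  have hm : MapsTo (lowerPoint C e) (Metric.ball c ρ) (interior C)ᶜ := fun y hy =>
    (hC.lowerPoint_mem_frontier (hC.ball_subset_ball hy)).2
  have := ((JoinedWithin.segment ((convex_ball c ρ).segment_subset hy hz)).map hl hm).pathDist_le
  rwa [Real.coe_toNNReal _ h0] at this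

theorem IsChart.abs_pathDist_sub_le [FiniteDimensional ℝ E] (h2 : 2 ≤ Module.finrank ℝ E)
    (hC : IsChart C c e ρ R) {y z p : E} (hp : p ∈ frontier C)
    (hy : y ∈ Metric.ball c ρ) (hz : z ∈ Metric.ball c ρ) :
    |pathDist (interior C)ᶜ (lowerPoint C e y) p - pathDist (interior C)ᶜ (lowerPoint C e z) p|
      ≤ (1 + 4 * R / ρ) * ‖y - z‖ := by
  have hlc := lengthConnected_compl_interior h2 hC.convex hC.compact.isBounded
    hC.isConvexBody.2.2
  have hy' := (hC.lowerPoint_mem_frontier (hC.ball_subset_ball hy)).2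
  have hz' := (hC.lowerPoint_mem_frontier (hC.ball_subset_ball hz)).2
  have t1 := hlc.triangle hy' hz' hp.2
  have t2 := hlc.triangle hz' hy' hp.2
  rw [pathDist_comm _ (lowerPoint C e z) (lowerPoint C e y)] at t2
  have := hC.pathDist_lowerPoint_le hy hz
  rw [abs_le]
  constructor <;> linarith

theorem IsChart.continuousOn_pathDist [FiniteDimensional ℝ E] (h2 : 2 ≤ Module.finrank ℝ E)
    (hC : IsChart C c e ρ R) {p : E} (hp : p ∈ frontier C) :
    ContinuousOn (fun y => pathDist (interior C)ᶜ (lowerPoint C e y) p) (Metric.ball c ρ) := by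
  have h0 : 0 ≤ 1 + 4 * R / ρ := by have := hC.radius_pos; have := hC.pos; positivity
  refine (LipschitzOnWith.of_dist_le_mul (K := (1 + 4 * R / ρ).toNNReal)
    fun y hy z hz => ?_).continuousOn
  rw [Real.dist_eq, dist_eq_norm, Real.coe_toNNReal _ h0]
  exact hC.abs_pathDist_sub_le h2 hp hy hz

variable {ι : Type*} {ν : ι → E} {β : ι → ℝ}

/-- Facets met by the chart are transversal to its direction. -/
theorem IsChart.inner_facet_le (h : IsPolytope ν β)
    (hC : IsChart (polyhedron ν β) c e ρ R) {y : E} (hy : y ∈ Metric.ball c ρ) {j : ι}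
    (hj : ⟪ν j, lowerPoint (polyhedron ν β) e y⟫ = β j) :
    ρ ≤ 4 * R * (-⟪ν j, e⟫) := by
  have hR := hC.radius_pos
  set s := lowerHeight (polyhedron ν β) e y with hs
  have hy' := hC.ball_subset_ball hy
  have hs0 : s ≤ 0 := hC.lowerHeight_nonpos hy'
  have hs1 := hC.abs_lowerHeight_le hy'
  rw [← hs, abs_of_nonpos hs0] at hs1
  have hm : y + (ρ / 2) • ν j ∈ Metric.ball c (2 * ρ) := by
    rw [Metric.mem_ball] at hy ⊢
    have := dist_triangle (y + (ρ / 2) • ν j) y c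
    rw [dist_eq_norm _ y, add_sub_cancel_left, norm_smul, h.unit,
      Real.norm_of_nonneg (by linarith [hC.pos])] at this
    linarith [hC.pos]
  have hle := hC.ball_subset hm j
  rw [← hj, lowerPoint, ← hs, inner_add_right, inner_add_right, inner_smul_right, inner_smul_right,
    real_inner_self_eq_norm_sq, h.unit] at hle
  have h3 : ρ / 2 ≤ (-s) * (-⟪ν j, e⟫) := by linarith
  have hpos : 0 < -⟪ν j, e⟫ := by
    by_contra hcon
    have := mul_nonpos_of_nonneg_of_nonpos (neg_nonneg.2 hs0) (not_lt.1 hcon)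
    linarith [hC.pos]
  have := mul_le_mul_of_nonneg_right hs1 hpos.le
  linarith

variable [FiniteDimensional ℝ E] [Finite ι]

/-- Semiconcavity of the distance from a point in a graph chart of a polytope, relative to the
graph function. -/
theorem IsPolytope.convexOn_chart (h2 : 2 ≤ Module.finrank ℝ E) (h : IsPolytope ν β)
    (hC : IsChart (polyhedron ν β) c e ρ R) {p : E} (hp : p ∈ frontier (polyhedron ν β))
    {W : Set E} (hW : Convex ℝ W) (hWo : IsOpen W) (hWb : W ⊆ Metric.ball c ρ) {r₀ : ℝ}
    (hr₀ : 0 < r₀)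
    (hr : ∀ y ∈ W, r₀ ≤ polyDist ν β (lowerPoint (polyhedron ν β) e y) p) :
    ConvexOn ℝ W fun y => (1 + 4 * R / ρ) ^ 2 / (2 * r₀) * ‖y‖ ^ 2 +
      lowerHeight (polyhedron ν β) e y - polyDist ν β (lowerPoint (polyhedron ν β) e y) p := by
  set P := polyhedron ν β with hP
  set M := 4 * R / ρ with hM
  have hρ := hC.pos
  have hM0 : 0 ≤ M := by have := hC.radius_pos; positivity
  have hb := hC.ball_subset_ball
  refine convexOn_of_local_midpoint hW ?_ ?_
  · refine ContinuousOn.sub (ContinuousOn.add (by fun_prop) ?_) ?_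
    · exact hC.lipschitzOnWith.continuousOn.mono hWb
    · exact (hC.continuousOn_pathDist h2 hp).mono hWb
  intro y hy
  have hyb := hWb hy
  have hyF := hC.lowerPoint_mem_frontier (hb hyb)
  have hyp : lowerPoint P e y ≠ p := by
    intro heq
    have := hr y hy
    rw [heq, polyDist, pathDist_self (frontier_subset_compl_interior _ hp)] at this
    linarith
  obtain ⟨m, d, l, hd, hl, -, ⟨j, hj, hj'⟩, hall⟩ := h.exists_direction h2 hyF hp hyp
  obtain ⟨ε, hε, hinge⟩ := hall j hj hj'
  set r := polyDist ν β (lowerPoint P e y) p with hrdef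
  have hr0 : r₀ ≤ r := hr y hy
  have hrpos : 0 < r := hr₀.trans_le hr0
  have htr := hC.inner_facet_le h hyb hj.2
  set a := -⟪ν j, e⟫ with ha
  have hapos : 0 < a := by
    by_contra hcon
    have := mul_nonpos_of_nonneg_of_nonpos (mul_nonneg zero_le_four hC.radius_pos.le)
      (not_lt.1 hcon)
    linarith
  have hMa : 1 / a ≤ M := by
    rw [hM, div_le_div_iff₀ hapos hρ]; linarith
  obtain ⟨δ, hδ, hball⟩ := Metric.isOpen_iff.1 hWo y hy
  -- one-sided bound
  have one : ∀ w : E, ‖w‖ < min δ (ε / (1 + M)) → y + w ∈ W ∧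
      polyDist ν β (lowerPoint P e (y + w)) p ≤ lowerHeight P e (y + w) - lowerHeight P e y
        - ⟪ν j, w⟫ / a + (r - ⟪d, w + (⟪ν j, w⟫ / a) • e⟫ + ((1 + M) * ‖w‖) ^ 2 / (2 * r)) := by
    intro w hw
    have hwW : y + w ∈ W := hball (by
      rw [Metric.mem_ball, dist_eq_norm, add_sub_cancel_left]
      exact hw.trans_le (min_le_left _ _))
    refine ⟨hwW, ?_⟩
    set τ := ⟪ν j, w⟫ / a with hτ
    have hτa : τ * a = ⟪ν j, w⟫ := div_mul_cancel₀ _ hapos.ne'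
    set v := w + τ • e with hv
    have hτle : |τ| ≤ M * ‖w‖ := by
      rw [hτ, abs_div, abs_of_pos hapos, div_eq_mul_one_div, mul_comm]
      have := abs_real_inner_le_norm (ν j) w
      rw [h.unit, one_mul] at this
      exact mul_le_mul hMa this (abs_nonneg _) hM0
    have hvn : ‖v‖ ≤ (1 + M) * ‖w‖ := by
      refine (norm_add_le _ _).trans ?_
      rw [norm_smul, hC.unit, mul_one, Real.norm_eq_abs]
      linarith
    have hvε : ‖v‖ < ε := by
      refine hvn.trans_lt ?_
      have := hw.trans_le (min_le_right _ _)
      rw [lt_div_iff₀ (by positivity)] at this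
      linarith
    have hvj : ⟪ν j, v⟫ = 0 := by
      rw [hv, inner_add_right, inner_smul_right]
      have : ⟪ν j, e⟫ = -a := by rw [ha]; ring
      rw [this]; linarith
    have hh := hinge v hvj hvε
    have hh2 : ‖r • d - v‖ ≤ r - ⟪d, v⟫ + ((1 + M) * ‖w‖) ^ 2 / (2 * r) := by
      have := norm_smul_add_smul_le (u := v) hd hrpos (-1)
      rw [neg_one_smul, ← sub_eq_add_neg] at this
      refine this.trans ?_
      have e3 : (-1 : ℝ) ^ 2 * (‖v‖ ^ 2 / (2 * r)) ≤ ((1 + M) * ‖w‖) ^ 2 / (2 * r) := by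
        rw [neg_one_sq, one_mul]
        gcongr
      linarith
    have hwF := hC.lowerPoint_mem_frontier (hb (hWb hwW))
    have hep : 0 ≤ lowerHeight P e (y + w) - lowerHeight P e y - τ := by
      have h5 := hC.lowerPoint_mem (hb (hWb hwW)) j
      have h6 := hj.2
      simp only [lowerPoint, inner_add_right, inner_smul_right] at h5 h6
      have h7 : ⟪ν j, e⟫ = -a := by rw [ha]; ring
      rw [h7] at h5 h6
      by_contra hcon
      have := mul_neg_of_neg_of_pos (not_le.1 hcon) hapos
      rw [← hτa] at h5
      linarith
    have hav : lowerPoint P e y + v ∈ (interior P)ᶜ := by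
      refine h.halfSpace_subset j ?_
      rw [mem_ofPred_eq, inner_add_right, hvj, hj.2, add_zero]
    have hseg : segment ℝ (lowerPoint P e (y + w)) (lowerPoint P e y + v) ⊆ (interior P)ᶜ := by
      rw [segment_eq_image']
      rintro _ ⟨s, hs, rfl⟩
      have : lowerPoint P e (y + w) + s • (lowerPoint P e y + v - lowerPoint P e (y + w)) =
          (y + w) + (lowerHeight P e (y + w) -
            s * (lowerHeight P e (y + w) - lowerHeight P e y - τ)) • e := by
        simp only [lowerPoint, hv]; module
      simp only
      rw [this]
      exact hC.notMem_interior (hb (hWb hwW)) (by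
        have := mul_nonneg hs.1 hep
        linarith)
    have hds := pathDist_le_of_segment hseg
    have hnorm : ‖lowerPoint P e (y + w) - (lowerPoint P e y + v)‖ =
        lowerHeight P e (y + w) - lowerHeight P e y - τ := by
      have : lowerPoint P e (y + w) - (lowerPoint P e y + v) =
          (lowerHeight P e (y + w) - lowerHeight P e y - τ) • e := by
        simp only [lowerPoint, hv]; module
      rw [this, norm_smul, hC.unit, mul_one, Real.norm_of_nonneg hep]
    have htri := h.polyDist_triangle h2 hwF.2 hav (frontier_subset_compl_interior _ hp)
    rw [hnorm] at hds
    simp only [polyDist] at htri hh ⊢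
    linarith
  refine ⟨min δ (ε / (1 + M)), lt_min hδ (by positivity), fun w hw => ?_⟩
  obtain ⟨-, o1⟩ := one w hw
  obtain ⟨-, o2⟩ := one (-w) (by rwa [norm_neg])
  rw [norm_neg, inner_neg_right, ← sub_eq_add_neg, neg_div, neg_smul, ← neg_add, inner_neg_right]
    at o2
  have e4 : ‖y + w‖ ^ 2 + ‖y - w‖ ^ 2 = 2 * ‖y‖ ^ 2 + 2 * ‖w‖ ^ 2 := by
    have := parallelogram_law_with_norm ℝ y w
    nlinarith
  have e5 : ((1 + M) * ‖w‖) ^ 2 / (2 * r) ≤ (1 + M) ^ 2 / (2 * r₀) * ‖w‖ ^ 2 := by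
    rw [mul_pow, div_mul_eq_mul_div]
    gcongr
  have e6 : (1 + M) ^ 2 / (2 * r₀) * (‖y + w‖ ^ 2 + ‖y - w‖ ^ 2) =
    (1 + M) ^ 2 / (2 * r₀) * (2 * ‖y‖ ^ 2 + 2 * ‖w‖ ^ 2) := by rw [e4]
  linarith

end Chart

section Approximation

variable {E : Type*} [NormedAddCommGroup E] [InnerProductSpace ℝ E]

theorem norm_convex_comb_gt {u v : E} (hu : ‖u‖ = 1) (hv : ‖v‖ = 1) (huv : 0 ≤ ⟪u, v⟫) {R : ℝ}
    (hR : 0 < R) {t : ℝ} (ht : t ∈ Icc (0 : ℝ) 1) :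
    R < ‖(2 * R) • u + t • ((2 * R) • v - (2 * R) • u)‖ := by
  have e : (2 * R) • u + t • ((2 * R) • v - (2 * R) • u) =
      (2 * R) • ((1 - t) • u + t • v) := by module
  rw [e, norm_smul, Real.norm_of_nonneg (by positivity)]
  have h1 : ‖(1 - t) • u + t • v‖ ^ 2 = (1 - t) ^ 2 + 2 * ((1 - t) * (t * ⟪u, v⟫)) + t ^ 2 := by
    rw [norm_add_sq_real, real_inner_smul_left, real_inner_smul_right, norm_smul, norm_smul, hu,
      hv, mul_one, mul_one, Real.norm_eq_abs, Real.norm_eq_abs, sq_abs, sq_abs]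
  have h2 : 0 ≤ (1 - t) * (t * ⟪u, v⟫) :=
    mul_nonneg (by linarith [ht.2]) (mul_nonneg ht.1 huv)
  have h3 : (1 / 2 : ℝ) < ‖(1 - t) • u + t • v‖ := by
    by_contra hcon
    have := pow_le_pow_left₀ (norm_nonneg _) (not_lt.1 hcon) 2
    nlinarith [sq_nonneg (1 - 2 * t)]
  nlinarith

theorem Convex.exists_mem_frontier {S C : Set E} (hS : Convex ℝ S) (hC : IsClosed C) {a b : E}
    (ha : a ∈ S) (haC : a ∈ C) (hb : b ∈ S) (hbC : b ∉ C) : ∃ z ∈ S, z ∈ frontier C := by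
  by_contra! hcon
  have hcov : S ⊆ interior C ∪ Cᶜ := fun z hz => by
    by_contra hz'
    rw [mem_union, not_or, mem_compl_iff, not_not] at hz'
    exact hcon z hz ⟨subset_closure hz'.2, hz'.1⟩
  obtain ⟨z, -, hz1, hz2⟩ := hS.isPreconnected _ _ isOpen_interior hC.isOpen_compl hcov
    ⟨a, ha, by_contra fun h => hcon a ha ⟨subset_closure haC, h⟩⟩ ⟨b, hb, hbC⟩
  exact hz2 (interior_subset hz1)

variable {C : Set E} {c e : E} {ρ R : ℝ}

theorem IsChart.norm_sub_le (hC : IsChart C c e ρ R) {y : E} (hy : y ∈ C) : ‖y - c‖ ≤ R := by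
  have := hC.subset_ball hy
  rwa [Metric.mem_closedBall, dist_eq_norm] at this

theorem IsChart.center_mem_interior (hC : IsChart C c e ρ R) : c ∈ interior C :=
  hC.ball_subset_interior (Metric.mem_ball_self (by linarith [hC.pos]))

theorem IsChart.ne_center (hC : IsChart C c e ρ R) {a : E} (ha : a ∈ frontier C) : a ≠ c := by
  rintro rfl
  exact ha.2 hC.center_mem_interior

variable [FiniteDimensional ℝ E]

theorem IsChart.lengthConnected (h2 : 2 ≤ Module.finrank ℝ E) (hC : IsChart C c e ρ R) :
    LengthConnected (interior C)ᶜ :=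
  lengthConnected_compl_interior h2 hC.convex hC.compact.isBounded hC.isConvexBody.2.2

/-- The intrinsic diameter of the frontier is bounded in terms of the radius. -/
theorem IsChart.pathDist_le (h2 : 2 ≤ Module.finrank ℝ E) (hC : IsChart C c e ρ R) {a b : E}
    (ha : a ∈ frontier C) (hb : b ∈ frontier C) : pathDist (interior C)ᶜ a b ≤ 12 * R := by
  have hR := hC.radius_pos
  have hlc := hC.lengthConnected h2
  have far : ∀ y : E, R < ‖y - c‖ → y ∈ (interior C)ᶜ := fun y hy hi =>
    absurd (hC.norm_sub_le (interior_subset hi)) (not_le.2 hy)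
  have arc : ∀ u v : E, ‖u‖ = 1 → ‖v‖ = 1 → 0 ≤ ⟪u, v⟫ →
      pathDist (interior C)ᶜ (c + (2 * R) • u) (c + (2 * R) • v) ≤ 4 * R := by
    intro u v hu hv huv
    refine (pathDist_le_of_segment ?_).trans ?_
    · rw [segment_eq_image']
      rintro _ ⟨t, ht, rfl⟩
      apply far
      have : c + (2 * R) • u + t • (c + (2 * R) • v - (c + (2 * R) • u)) - c =
        (2 * R) • u + t • ((2 * R) • v - (2 * R) • u) := by module
      simp only [this]
      exact norm_convex_comb_gt hu hv huv hR ht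
    · rw [add_sub_add_left_eq_sub, ← smul_sub, norm_smul, Real.norm_of_nonneg (by positivity)]
      have := _root_.norm_sub_le u v
      rw [hu, hv] at this
      nlinarith
  have farmem : ∀ u : E, ‖u‖ = 1 → c + (2 * R) • u ∈ (interior C)ᶜ := fun u hu => far _ (by
    rw [add_sub_cancel_left, norm_smul, hu, Real.norm_of_nonneg (by positivity)]; linarith)
  have arc2 : ∀ u v : E, ‖u‖ = 1 → ‖v‖ = 1 →
      pathDist (interior C)ᶜ (c + (2 * R) • u) (c + (2 * R) • v) ≤ 8 * R := by
    intro u v hu hv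
    obtain ⟨w, hw, hwu⟩ := exists_unit_orthogonal h2 u
    obtain ⟨w, hw, hwu, hwv⟩ : ∃ w : E, ‖w‖ = 1 ∧ ⟪w, u⟫ = 0 ∧ 0 ≤ ⟪w, v⟫ := by
      rcases le_total 0 ⟪w, v⟫ with h | h
      · exact ⟨w, hw, hwu, h⟩
      · exact ⟨-w, by rwa [norm_neg], by rw [inner_neg_left, hwu, neg_zero],
          by rw [inner_neg_left]; linarith⟩
    have := hlc.triangle (farmem u hu) (farmem w hw) (farmem v hv)
    have := arc u w hu hw (by rw [real_inner_comm, hwu])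
    have := arc w v hw hv hwv
    linarith
  have out : ∀ a ∈ frontier C, ∃ u : E, ‖u‖ = 1 ∧
      pathDist (interior C)ᶜ a (c + (2 * R) • u) ≤ 2 * R := by
    intro a ha
    have hne := hC.ne_center ha
    have hpos : 0 < ‖a - c‖ := norm_pos_iff.2 (sub_ne_zero.2 hne)
    have hle := hC.norm_sub_le (hC.compact.isClosed.frontier_subset ha)
    refine ⟨‖a - c‖⁻¹ • (a - c), by
      rw [norm_smul, norm_inv, norm_norm, inv_mul_cancel₀ hpos.ne'], ?_⟩
    have hl : 1 ≤ 2 * R * ‖a - c‖⁻¹ := by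
      rw [← div_eq_mul_inv, one_le_div hpos]; linarith
    rw [smul_smul]
    refine (pathDist_le_of_segment (hC.convex.radial_segment_subset hC.center_mem_interior
      ha.2 hl)).trans ?_
    have : a - (c + (2 * R * ‖a - c‖⁻¹) • (a - c)) = (1 - 2 * R * ‖a - c‖⁻¹) • (a - c) := by
      module
    rw [this, norm_smul, Real.norm_of_nonpos (by linarith), neg_sub, sub_mul, mul_assoc,
      inv_mul_cancel₀ hpos.ne']
    linarith
  obtain ⟨u, hu, hau⟩ := out a ha
  obtain ⟨v, hv, hbv⟩ := out b hb
  have t1 := hlc.triangle ha.2 (farmem u hu) hb.2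
  have t2 := hlc.triangle (farmem u hu) (farmem v hv) hb.2
  rw [pathDist_comm _ b] at hbv
  linarith [arc2 u v hu hv]

theorem exists_polytope_between {C : Set E} (hC : IsConvexBody C) {c : E} (hc : c ∈ interior C)
    {θ : ℝ} (hθ0 : 0 < θ) (hθ1 : θ < 1) :
    ∃ (N : ℕ) (ν : Fin N → E) (β : Fin N → ℝ), IsPolytope ν β ∧ polyhedron ν β ⊆ C ∧
      ∀ y ∈ C, c + θ • (y - c) ∈ polyhedron ν β := by
  set S : Set E := (fun y => c + θ • (y - c)) '' C with hS
  have hcS : c ∈ S := ⟨c, interior_subset hc, by simp⟩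
  have hSint : S ⊆ interior C := by
    rintro _ ⟨y, hy, rfl⟩
    refine hC.2.1.openSegment_interior_self_subset_interior hc hy ⟨1 - θ, θ, by linarith, hθ0,
      by ring, by module⟩
  have hScomp : IsCompact S := hC.1.image (by fun_prop)
  have hSconv : Convex ℝ S := by
    have : S = (AffineMap.homothety c θ : E →ᵃ[ℝ] E) '' C := by
      rw [hS]
      refine image_congr fun y _ => ?_
      rw [AffineMap.homothety_apply, vsub_eq_sub, vadd_eq_add, add_comm]
    rw [this]
    exact hC.2.1.affine_image _
  have sep : ∀ x ∈ frontier C, ∃ (w : E) (b : ℝ), ‖w‖ = 1 ∧ (∀ y ∈ S, ⟪w, y⟫ < b) ∧ b < ⟪w, x⟫ := by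
    intro x hx
    obtain ⟨f, u, h1, h2⟩ := geometric_hahn_banach_closed_point hSconv hScomp.isClosed
      (fun h => hx.2 (hSint h))
    set w := (InnerProductSpace.toDual ℝ E).symm f with hw
    have hf : ∀ y, f y = ⟪w, y⟫ := fun y => by
      rw [hw, InnerProductSpace.toDual_symm_apply]
    have hw0 : w ≠ 0 := by
      intro h0
      have := h1 c hcS
      rw [hf, h0, inner_zero_left] at this
      rw [hf, h0, inner_zero_left] at h2
      linarith
    have hpos : 0 < ‖w‖⁻¹ := inv_pos.2 (norm_pos_iff.2 hw0)
    refine ⟨‖w‖⁻¹ • w, ‖w‖⁻¹ * u, ?_, fun y hy => ?_, ?_⟩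
    · rw [norm_smul, norm_inv, norm_norm, inv_mul_cancel₀ (norm_ne_zero_iff.2 hw0)]
    · rw [real_inner_smul_left, ← hf]
      exact mul_lt_mul_of_pos_left (h1 y hy) hpos
    · rw [real_inner_smul_left, ← hf]
      exact mul_lt_mul_of_pos_left h2 hpos
  choose! w b hw hS' hx' using sep
  have hfc : IsCompact (frontier C) :=
    hC.1.of_isClosed_subset isClosed_frontier hC.1.isClosed.frontier_subset
  obtain ⟨t, ht, hcov⟩ := hfc.elim_nhds_subcover (fun x => {y | b x < ⟪w x, y⟫})
    (fun x hx => (isOpen_lt (by fun_prop) (by fun_prop)).mem_nhds (hx' x hx))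
  set eq := t.equivFin with heq
  set ν : Fin t.card → E := fun i => w (eq.symm i) with hν
  set β : Fin t.card → ℝ := fun i => b (eq.symm i) with hβ
  have hmemt : ∀ i, ((eq.symm i : t) : E) ∈ frontier C := fun i => ht _ (eq.symm i).2
  have hSP : ∀ y ∈ S, ∀ i, ⟪ν i, y⟫ < β i := fun y hy i => hS' _ (hmemt i) y hy
  have hdisj : ∀ y ∈ frontier C, y ∉ polyhedron ν β := by
    intro y hy hyP
    obtain ⟨x, hxt, hxy⟩ := mem_iUnion₂.1 (hcov hy)
    have h3 := hyP (eq ⟨x, hxt⟩)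
    simp only [hν, hβ, Equiv.symm_apply_apply] at h3
    exact absurd h3 (not_le.2 hxy)
  have hPC : polyhedron ν β ⊆ C := by
    intro y hy
    by_contra hyC
    have hcP : c ∈ polyhedron ν β := fun i => (hSP c hcS i).le
    obtain ⟨z, hz, hzf⟩ := (polyhedron_convex ν β).exists_mem_frontier hC.1.isClosed hcP
      (interior_subset hc) hy hyC
    exact hdisj z hzf hz
  exact ⟨t.card, ν, β, ⟨fun i => hw _ (hmemt i), hC.1.isBounded.subset hPC, c, hSP c hcS⟩, hPC,
    fun y hy i => (hSP _ ⟨y, hy, rfl⟩ i).le⟩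

end Approximation

section Approximation

variable {E : Type*} [NormedAddCommGroup E] [InnerProductSpace ℝ E] [FiniteDimensional ℝ E]

variable {C P : Set E} {c e : E} {ρ R θ : ℝ}

/-- `a'` lies on the ray from `c` through `a`, at relative distance in `[θ, 1]`. -/
def IsRadial (c : E) (θ : ℝ) (a a' : E) : Prop := ∃ l ∈ Icc θ 1, a' = c + l • (a - c)

theorem IsChart.mono_pos (hC : IsChart C c e (2 * ρ) R) (hρ : 0 < ρ) : IsChart C c e ρ R :=
  ⟨hC.convex, hC.compact, hC.unit, hρ,
    (Metric.ball_subset_ball (by linarith)).trans hC.ball_subset, hC.subset_ball⟩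

/-- `P` is a convex body between `C` and its homothetic copy with ratio `θ`. -/
structure IsInner (C P : Set E) (c : E) (θ : ℝ) : Prop where
  half_le : 1 / 2 ≤ θ
  lt_one : θ < 1
  subset : P ⊆ C
  homothety_mem : ∀ y ∈ C, c + θ • (y - c) ∈ P

theorem IsInner.isChart (hP : IsInner C P c θ) (hC : IsChart C c e (2 * ρ) R) (hρ : 0 < ρ)
    (hc : Convex ℝ P) (hcl : IsClosed P) : IsChart P c e ρ R := by
  have hθ : 0 < θ := by linarith [hP.half_le]
  refine ⟨hc, hC.compact.of_isClosed_subset hcl hP.subset, hC.unit, hρ, fun z hz => ?_,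
    hP.subset.trans hC.subset_ball⟩
  have hm : c + θ⁻¹ • (z - c) ∈ Metric.ball c (2 * (2 * ρ)) := by
    rw [Metric.mem_ball, dist_eq_norm] at hz ⊢
    rw [add_sub_cancel_left, norm_smul, norm_inv, Real.norm_of_nonneg hθ.le, inv_mul_lt_iff₀ hθ]
    nlinarith [hP.half_le]
  have := hP.homothety_mem _ (hC.ball_subset hm)
  rwa [add_sub_cancel_left, smul_inv_smul₀ hθ.ne', add_sub_cancel] at this

theorem IsInner.exists_radial (hP : IsInner C P c θ) (hC : IsChart C c e ρ R)
    (hcl : IsClosed P) {a : E} (ha : a ∈ frontier C) : ∃ a' ∈ frontier P, IsRadial c θ a a' := by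
  have haC : a ∈ C := hC.compact.isClosed.frontier_subset ha
  have hθ1 := hP.lt_one
  by_cases haP : a ∈ P
  · exact ⟨a, ⟨subset_closure haP, fun h => ha.2 (interior_mono hP.subset h)⟩, 1, ⟨hθ1.le, le_rfl⟩,
      by rw [one_smul, add_sub_cancel]⟩
  · obtain ⟨z, hz, hzf⟩ := (convex_segment (𝕜 := ℝ) (c + θ • (a - c)) a).exists_mem_frontier hcl
      (left_mem_segment _ _ _) (hP.homothety_mem a haC) (right_mem_segment _ _ _) haP
    rw [segment_eq_image'] at hz
    obtain ⟨t, ht, rfl⟩ := hz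
    refine ⟨_, hzf, θ + t * (1 - θ), ⟨?_, ?_⟩, ?_⟩
    · nlinarith [ht.1]
    · nlinarith [ht.2]
    · simp only; module

theorem IsInner.exists_radial' (hP : IsInner C P c θ) (hC : IsChart C c e ρ R)
    (hcl : IsClosed P) {a' : E} (ha' : a' ∈ frontier P) : ∃ a ∈ frontier C, IsRadial c θ a a' := by
  have haP : a' ∈ P := hcl.frontier_subset ha'
  have haC := hP.subset haP
  have hθ1 := hP.lt_one
  have hθ0 : 0 < θ := by linarith [hP.half_le]
  have hinv : 1 ≤ θ⁻¹ := (one_le_inv₀ hθ0).2 hθ1.le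
  have hout : c + θ⁻¹ • (a' - c) ∉ interior C := by
    intro hi
    have hsub : (fun y => c + θ⁻¹ • (y - c)) ⁻¹' interior C ⊆ P := by
      intro y hy
      have := hP.homothety_mem _ (interior_subset (mem_preimage.1 hy))
      rwa [add_sub_cancel_left, smul_inv_smul₀ hθ0.ne', add_sub_cancel] at this
    exact ha'.2 (interior_maximal hsub (isOpen_interior.preimage (by fun_prop)) hi)
  have fin : ∀ l, 1 ≤ l → l ≤ θ⁻¹ → c + l • (a' - c) ∈ frontier C →
      ∃ a ∈ frontier C, IsRadial c θ a a' := by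
    intro l h1 h2 h3
    have hl : 0 < l := by linarith
    refine ⟨_, h3, l⁻¹, ⟨?_, inv_le_one_of_one_le₀ h1⟩, ?_⟩
    · rw [le_inv_comm₀ hθ0 hl]; exact h2
    · rw [add_sub_cancel_left, inv_smul_smul₀ hl.ne', add_sub_cancel]
  by_cases hm : c + θ⁻¹ • (a' - c) ∈ C
  · exact fin _ hinv le_rfl ⟨subset_closure hm, hout⟩
  · obtain ⟨z, hz, hzf⟩ := (convex_segment (𝕜 := ℝ) a' (c + θ⁻¹ • (a' - c))).exists_mem_frontier
      hC.compact.isClosed (left_mem_segment _ _ _) haC (right_mem_segment _ _ _) hm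
    rw [segment_eq_image'] at hz
    obtain ⟨t, ht, rfl⟩ := hz
    refine fin (1 + t * (θ⁻¹ - 1)) ?_ ?_ ?_
    · nlinarith [ht.1]
    · nlinarith [ht.2]
    · convert hzf using 1
      module

theorem IsInner.pathDist_radial_le (hP : IsInner C P c θ) (hC : IsChart C c e ρ R)
    (hPC : IsChart P c e ρ R) {a a' : E} (ha : a ∈ frontier C) (ha' : a' ∈ frontier P)
    (h : IsRadial c θ a a') : pathDist (interior P)ᶜ a a' ≤ (1 - θ) * R := by
  obtain ⟨l, ⟨hl1, hl2⟩, rfl⟩ := h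
  have hθ0 : 0 < θ := by linarith [hP.half_le]
  have hl : 0 < l := by linarith
  have h1 : 1 ≤ l⁻¹ := (one_le_inv₀ hl).2 hl2
  have hs := hPC.convex.radial_segment_subset hPC.center_mem_interior ha'.2 h1
  rw [add_sub_cancel_left, inv_smul_smul₀ hl.ne', add_sub_cancel, segment_symm] at hs
  refine (pathDist_le_of_segment hs).trans ?_
  have : a - (c + l • (a - c)) = (1 - l) • (a - c) := by module
  rw [this, norm_smul, Real.norm_of_nonneg (by linarith)]
  have := hC.norm_sub_le (hC.compact.isClosed.frontier_subset ha)
  have := norm_nonneg (a - c)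
  nlinarith

theorem IsInner.pathDist_le (h2 : 2 ≤ Module.finrank ℝ E) (hP : IsInner C P c θ)
    (hC : IsChart C c e ρ R) {a b : E}
    (ha : a ∈ frontier C) (hb : b ∈ frontier C) :
    pathDist (interior P)ᶜ a b ≤ pathDist (interior C)ᶜ a b :=
  (hC.lengthConnected h2).pathDist_mono (compl_subset_compl.2 (interior_mono hP.subset)) ha.2 hb.2

theorem IsInner.notMem_interior (hP : IsInner C P c θ) {a : E} (ha : a ∈ frontier C) :
    a ∉ interior P := fun h => ha.2 (interior_mono hP.subset h)

theorem IsInner.abs_pathDist_sub_le (h2 : 2 ≤ Module.finrank ℝ E) (hP : IsInner C P c θ)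
    (hC : IsChart C c e ρ R) (hPC : IsChart P c e ρ R) {a a' b b' : E}
    (ha : a ∈ frontier C) (hb : b ∈ frontier C) (ha' : a' ∈ frontier P) (hb' : b' ∈ frontier P)
    (haa : IsRadial c θ a a') (hbb : IsRadial c θ b b') :
    |pathDist (interior C)ᶜ a b - pathDist (interior P)ᶜ a' b'| ≤ (1 - θ) * (32 * R) := by
  have hR := hC.radius_pos
  have hθ0 : 0 < θ := by linarith [hP.half_le]
  have hθ1 := hP.lt_one
  have hlP := hPC.lengthConnected h2
  have hlC := hC.lengthConnected h2
  have hinv : 1 ≤ θ⁻¹ := (one_le_inv₀ hθ0).2 hθ1.le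
  have hinv2 : θ⁻¹ - 1 ≤ 2 * (1 - θ) := by
    have : θ⁻¹ ≤ 2 := by
      rw [inv_le_comm₀ hθ0 two_pos]; linarith [hP.half_le]
    have e1 : θ⁻¹ * θ = 1 := inv_mul_cancel₀ hθ0.ne'
    nlinarith
  have hda := hP.pathDist_radial_le hC hPC ha ha' haa
  have hdb := hP.pathDist_radial_le hC hPC hb hb' hbb
  have hmono := hP.pathDist_le h2 hC ha hb
  have t1 := hlP.triangle (a := a') (b := a) (c := b') ha'.2 (hP.notMem_interior ha) hb'.2
  have t2 := hlP.triangle (a := a) (b := b) (c := b') (hP.notMem_interior ha)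
    (hP.notMem_interior hb) hb'.2
  rw [pathDist_comm _ a' a] at t1
  set DP := pathDist (interior P)ᶜ a' b' with hDP
  set DC := pathDist (interior C)ᶜ a b with hDC
  have up : DP ≤ DC + 2 * ((1 - θ) * R) := by linarith
  have hDC12 : DC ≤ 12 * R := hC.pathDist_le h2 ha hb
  -- the homothety
  set f : E → E := fun y => c + θ⁻¹ • (y - c) with hf
  have hmaps : MapsTo f (interior P)ᶜ (interior C)ᶜ := by
    intro y hy hi
    apply hy
    have hsub : f ⁻¹' interior C ⊆ P := by
      intro y hy
      have := hP.homothety_mem _ (interior_subset (mem_preimage.1 hy))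
      rwa [add_sub_cancel_left, smul_inv_smul₀ hθ0.ne', add_sub_cancel] at this
    exact interior_maximal hsub (isOpen_interior.preimage (by fun_prop)) hi
  have hlip : LipschitzOnWith (θ⁻¹).toNNReal f (interior P)ᶜ :=
    LipschitzOnWith.of_dist_le_mul fun y _ z _ => by
      rw [dist_eq_norm, dist_eq_norm, Real.coe_toNNReal _ (by positivity), hf]
      simp only
      rw [add_sub_add_left_eq_sub, ← smul_sub, norm_smul, Real.norm_of_nonneg (by positivity),
        sub_sub_sub_cancel_right]
  have hfd := hlP.pathDist_map_le hlip hmaps ha'.2 hb'.2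
  rw [Real.coe_toNNReal _ (by positivity), ← hDP] at hfd
  have rad : ∀ a ∈ frontier C, ∀ a' ∈ frontier P, IsRadial c θ a a' →
      pathDist (interior C)ᶜ a (f a') ≤ (θ⁻¹ - 1) * R := by
    rintro a ha a' ha' ⟨l, ⟨hl1, hl2⟩, rfl⟩
    have hfa : f (c + l • (a - c)) = c + (θ⁻¹ * l) • (a - c) := by
      rw [hf]; simp only; module
    have hge : 1 ≤ θ⁻¹ * l := by rw [inv_mul_eq_div, one_le_div hθ0]; exact hl1
    rw [hfa]
    refine (pathDist_le_of_segment (hC.convex.radial_segment_subset hC.center_mem_interior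
      ha.2 hge)).trans ?_
    have : a - (c + (θ⁻¹ * l) • (a - c)) = (1 - θ⁻¹ * l) • (a - c) := by module
    rw [this, norm_smul, Real.norm_of_nonpos (by linarith), neg_sub]
    have h3 : θ⁻¹ * l ≤ θ⁻¹ := mul_le_of_le_one_right (by positivity) hl2
    have h4 := hC.norm_sub_le (hC.compact.isClosed.frontier_subset ha)
    exact mul_le_mul (by linarith) h4 (norm_nonneg _) (by linarith)
  have ra := rad a ha a' ha' haa
  have rb := rad b hb b' hb' hbb
  have t3 := hlC.triangle (a := a) (b := f a') (c := b) ha.2 (hmaps ha'.2) hb.2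
  have t4 := hlC.triangle (a := f a') (b := f b') (c := b) (hmaps ha'.2) (hmaps hb'.2) hb.2
  rw [pathDist_comm _ b] at rb
  have hDP0 : 0 ≤ DP := pathDist_nonneg _ _ _
  have hDP14 : DP ≤ 14 * R := by nlinarith
  have low : DC ≤ DP + (θ⁻¹ - 1) * (16 * R) := by
    have : (θ⁻¹ - 1) * DP ≤ (θ⁻¹ - 1) * (14 * R) :=
      mul_le_mul_of_nonneg_left hDP14 (by linarith)
    linarith
  have : (θ⁻¹ - 1) * (16 * R) ≤ 2 * (1 - θ) * (16 * R) :=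
    mul_le_mul_of_nonneg_right hinv2 (by positivity)
  have : 0 ≤ (1 - θ) * R := mul_nonneg (by linarith) hR.le
  rw [abs_le]
  constructor <;> linarith

theorem IsInner.lowerHeight_le (hP : IsInner C P c θ) (hC : IsChart C c e ρ R)
    (hPC : IsChart P c e ρ R) {y : E} (hy : y ∈ Metric.ball c ρ) :
    lowerHeight C e y ≤ lowerHeight P e y ∧
      lowerHeight P e y ≤ lowerHeight C e y + (1 - θ) * (4 * R) := by
  have hy2 := hC.ball_subset_ball hy
  have hθ1 := hP.lt_one
  have hθh := hP.half_le
  refine ⟨hC.lowerHeight_le hy2 (hP.subset (hPC.lowerPoint_mem hy2)), ?_⟩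
  have h0 := hC.lowerHeight_nonpos hy2
  have h1 := hC.abs_lowerHeight_le hy2
  rw [abs_of_nonpos h0] at h1
  set s := lowerHeight C e y with hs
  have m1 := hP.homothety_mem _ (hC.lowerPoint_mem hy2)
  have m2 : c + (2 : ℝ) • (y - c) ∈ P := hPC.ball_subset (by
    rw [Metric.mem_ball, dist_eq_norm] at hy ⊢
    rw [add_sub_cancel_left, norm_smul, Real.norm_of_nonneg two_pos.le]
    linarith)
  have hd : 0 < 2 - θ := by linarith
  have hm := hPC.convex m1 m2 (a := 1 / (2 - θ)) (b := 1 - 1 / (2 - θ)) (by positivity)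
    (by rw [sub_nonneg, div_le_one hd]; linarith) (by ring)
  have heq : (1 / (2 - θ)) • (c + θ • (lowerPoint C e y - c)) +
      (1 - 1 / (2 - θ)) • (c + (2 : ℝ) • (y - c)) = y + (θ / (2 - θ) * s) • e := by
    have e1 : θ / (2 - θ) = 2 * (1 / (2 - θ)) - 1 := by field_simp; ring
    have e2 : (1 / (2 - θ)) * θ = 2 * (1 / (2 - θ)) - 1 := by field_simp; ring
    rw [lowerPoint, ← hs, smul_add, smul_smul, e1, e2]
    module
  rw [heq] at hm
  refine (hPC.lowerHeight_le hy2 hm).trans ?_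
  have e3 : θ / (2 - θ) * s = s + 2 * ((1 - θ) / (2 - θ)) * (-s) := by field_simp; ring
  have e4 : (1 - θ) / (2 - θ) ≤ 1 - θ := div_le_self (by linarith) (by linarith)
  have e5 : (1 - θ) / (2 - θ) * (-s) ≤ (1 - θ) * (2 * R) :=
    mul_le_mul e4 h1 (by linarith) (by linarith)
  linarith

theorem IsInner.abs_pathDist_lowerPoint_sub_le (h2 : 2 ≤ Module.finrank ℝ E)
    (hP : IsInner C P c θ) (hC : IsChart C c e ρ R) (hPC : IsChart P c e ρ R) {y p p' : E}
    (hy : y ∈ Metric.ball c ρ) (hp : p ∈ frontier C) (hp' : p' ∈ frontier P)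
    (hpp : IsRadial c θ p p') :
    |pathDist (interior C)ᶜ (lowerPoint C e y) p - pathDist (interior P)ᶜ (lowerPoint P e y) p'|
      ≤ (1 - θ) * (37 * R) := by
  have hy2 := hC.ball_subset_ball hy
  have haC := hC.lowerPoint_mem_frontier hy2
  have haP := hPC.lowerPoint_mem_frontier hy2
  have hcl : IsClosed P := hPC.compact.isClosed
  obtain ⟨a', ha', haa⟩ := hP.exists_radial hC hcl haC
  have d1 := hP.abs_pathDist_sub_le h2 hC hPC haC hp ha' hp' haa hpp
  have d2 := hP.pathDist_radial_le hC hPC haC ha' haa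
  obtain ⟨q1, q2⟩ := hP.lowerHeight_le hC hPC hy
  have hseg : segment ℝ (lowerPoint C e y) (lowerPoint P e y) ⊆ (interior P)ᶜ := by
    rw [segment_eq_image']
    rintro _ ⟨s, hs, rfl⟩
    have : lowerPoint C e y + s • (lowerPoint P e y - lowerPoint C e y) =
        y + (lowerHeight C e y + s * (lowerHeight P e y - lowerHeight C e y)) • e := by
      simp only [lowerPoint]; module
    simp only [this]
    exact hPC.notMem_interior hy2 (by nlinarith [hs.1, hs.2])
  have d3 := pathDist_le_of_segment hseg
  have : lowerPoint C e y - lowerPoint P e y = (lowerHeight C e y - lowerHeight P e y) • e := by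
    simp only [lowerPoint]; module
  rw [this, norm_smul, hC.unit, mul_one, Real.norm_of_nonpos (by linarith)] at d3
  have hlP := hPC.lengthConnected h2
  have haO := hP.notMem_interior haC
  have t1 := hlP.triangle haP.2 haO hp'.2
  have t2 := hlP.triangle haO ha'.2 hp'.2
  have t3 := hlP.triangle ha'.2 haO hp'.2
  have t4 := hlP.triangle haO haP.2 hp'.2
  rw [pathDist_comm _ a' (lowerPoint C e y)] at t3
  rw [pathDist_comm _ (lowerPoint P e y) (lowerPoint C e y)] at t1
  rw [abs_le] at d1 ⊢
  obtain ⟨d1, d1'⟩ := d1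
  constructor <;> linarith

/-- Simultaneous approximation of a convex surface, its intrinsic distance and its graph charts by
those of a polytope. -/
theorem IsChart.exists_approx (h2 : 2 ≤ Module.finrank ℝ E) (hC : IsChart C c e (2 * ρ) R)
    (hρ : 0 < ρ) {η : ℝ} (hη : 0 < η) :
    ∃ (N : ℕ) (ν : Fin N → E) (β : Fin N → ℝ), IsPolytope ν β ∧
      IsChart (polyhedron ν β) c e ρ R ∧ ∃ r : E → E → Prop,
      (∀ a ∈ frontier C, ∃ a' ∈ frontier (polyhedron ν β), r a a') ∧
      (∀ a' ∈ frontier (polyhedron ν β), ∃ a ∈ frontier C, r a a') ∧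
      (∀ a ∈ frontier C, ∀ b ∈ frontier C, ∀ a' ∈ frontier (polyhedron ν β),
        ∀ b' ∈ frontier (polyhedron ν β), r a a' → r b b' →
        |pathDist (interior C)ᶜ a b - polyDist ν β a' b'| ≤ η) ∧
      (∀ y ∈ Metric.ball c ρ, |lowerHeight C e y - lowerHeight (polyhedron ν β) e y| ≤ η) ∧
      ∀ y ∈ Metric.ball c ρ, ∀ p ∈ frontier C, ∀ p' ∈ frontier (polyhedron ν β), r p p' →
        |pathDist (interior C)ᶜ (lowerPoint C e y) p -
          polyDist ν β (lowerPoint (polyhedron ν β) e y) p'| ≤ η := by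
  have hR := hC.radius_pos
  have hC' := hC.mono_pos hρ
  set δ := min (1 / 2) (η / (40 * R)) with hδ
  have hδ0 : 0 < δ := by positivity
  have hδ1 : δ ≤ 1 / 2 := min_le_left _ _
  have hδη : δ * (40 * R) ≤ η := (le_div_iff₀ (by positivity)).1 (min_le_right _ _)
  obtain ⟨N, ν, β, hpoly, hsub, hmem⟩ := exists_polytope_between hC.isConvexBody
    hC.center_mem_interior (θ := 1 - δ) (by linarith) (by linarith)
  have hP : IsInner C (polyhedron ν β) c (1 - δ) := ⟨by linarith, by linarith, hsub, hmem⟩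
  have hcl := polyhedron_isClosed ν β
  have hPC := hP.isChart hC hρ (polyhedron_convex ν β) hcl
  have hδR : 0 < δ * R := by positivity
  refine ⟨N, ν, β, hpoly, hPC, IsRadial c (1 - δ), fun a ha => hP.exists_radial hC' hcl ha,
    fun a ha => hP.exists_radial' hC' hcl ha, fun a ha b hb a' ha' b' hb' haa hbb => ?_,
    fun y hy => ?_, fun y hy p hp p' hp' hpp => ?_⟩
  · refine (hP.abs_pathDist_sub_le h2 hC' hPC ha hb ha' hb' haa hbb).trans ?_
    rw [sub_sub_cancel]; linarith
  · obtain ⟨q1, q2⟩ := hP.lowerHeight_le hC' hPC hy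
    rw [sub_sub_cancel] at q2
    rw [abs_le]
    constructor <;> linarith
  · refine (hP.abs_pathDist_lowerPoint_sub_le h2 hC' hPC hy hp hp' hpp).trans ?_
    rw [sub_sub_cancel]; linarith

end Approximation

section Limits

variable {E : Type*} [NormedAddCommGroup E] [InnerProductSpace ℝ E] [FiniteDimensional ℝ E]

variable {C : Set E} {c e : E} {ρ R : ℝ}

theorem abs_mul_sub_mul_le {a b a' b' A B α β : ℝ} (hb : |b| ≤ B) (ha' : |a'| ≤ A)
    (h₁ : |a - a'| ≤ α) (h₂ : |b - b'| ≤ β) : |a * b - a' * b'| ≤ α * B + A * β := by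
  have : a * b - a' * b' = (a - a') * b + a' * (b - b') := by ring
  rw [this]
  refine (abs_add_le _ _).trans (add_le_add ?_ ?_) <;> rw [abs_mul]
  · exact mul_le_mul h₁ hb (abs_nonneg _) ((abs_nonneg _).trans h₁)
  · exact mul_le_mul ha' h₂ (abs_nonneg _) ((abs_nonneg _).trans ha')

theorem comparison_perturb {T t a b m T' t' a' b' m' δ L : ℝ}
    (ht : |t| ≤ L) (ha : |a| ≤ L) (hb : |b| ≤ L) (hm : |m| ≤ L) (hT' : |T'| ≤ L) (ht' : |t'| ≤ L)
    (ha' : |a'| ≤ L) (hm' : |m'| ≤ L) (hb' : |b'| ≤ L) (hu : |T - t| ≤ L) (hu' : |T' - t'| ≤ L)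
    (dT : |T - T'| ≤ δ) (dt : |t - t'| ≤ δ) (da : |a - a'| ≤ δ) (db : |b - b'| ≤ δ)
    (dm : |m - m'| ≤ δ)
    (h : (T' - t') * a' ^ 2 + t' * b' ^ 2 ≤ T' * (m' ^ 2 + t' * (T' - t'))) :
    (T - t) * a ^ 2 + t * b ^ 2 ≤ T * (m ^ 2 + t * (T - t)) + 14 * L ^ 2 * δ := by
  have du : |(T - t) - (T' - t')| ≤ 2 * δ := by
    rw [abs_le] at *
    constructor <;> linarith [dT.1, dT.2, dt.1, dt.2]
  have sq : ∀ {z : ℝ}, |z| ≤ L → |z * z| ≤ L * L := fun {z} hz => by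
    rw [abs_mul]; exact mul_le_mul hz hz (abs_nonneg _) ((abs_nonneg _).trans hz)
  have e1 := abs_mul_sub_mul_le (sq ha) hu' du (abs_mul_sub_mul_le ha ha' da da)
  have e2 := abs_mul_sub_mul_le (sq hb) ht' dt (abs_mul_sub_mul_le hb hb' db db)
  have e3 := abs_mul_sub_mul_le hm hm' dm dm
  have e4 := abs_mul_sub_mul_le hu ht' dt du
  have e5 : |(m * m + t * (T - t)) - (m' * m' + t' * (T' - t'))| ≤ 5 * L * δ := by
    rw [abs_le] at *
    constructor <;> linarith [e3.1, e3.2, e4.1, e4.2]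
  have b5 : |m * m + t * (T - t)| ≤ 2 * L ^ 2 := by
    refine (abs_add_le _ _).trans ?_
    have := sq hm
    have h2 : |t * (T - t)| ≤ L * L := by
      rw [abs_mul]; exact mul_le_mul ht hu (abs_nonneg _) ((abs_nonneg _).trans ht)
    linarith
  have e6 := abs_mul_sub_mul_le b5 hT' dT e5
  rw [abs_le] at e1 e2 e6
  nlinarith [e1.2, e2.2, e6.1, h]

/-- Approximate form, on a convex surface, of Toponogov's comparison inequality for the distance
from a point `p` to the points of a shortest curve from `x` to `y`. -/
theorem IsChart.exists_approx_comparison (h2 : 2 ≤ Module.finrank ℝ E)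
    (hC : IsChart C c e (2 * ρ) R) (hρ : 0 < ρ) {x y p : E} (hx : x ∈ frontier C)
    (hy : y ∈ frontier C) (hp : p ∈ frontier C) {t : ℝ}
    (ht : t ∈ Icc 0 (pathDist (interior C)ᶜ x y)) {η : ℝ} (hη : 0 < η) :
    ∃ m ∈ frontier C, pathDist (interior C)ᶜ x m ≤ t + η ∧
      pathDist (interior C)ᶜ m y ≤ pathDist (interior C)ᶜ x y - t + η ∧
      (pathDist (interior C)ᶜ x y - t) * pathDist (interior C)ᶜ x p ^ 2 +
        t * pathDist (interior C)ᶜ y p ^ 2 ≤ pathDist (interior C)ᶜ x y *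
          (pathDist (interior C)ᶜ m p ^ 2 + t * (pathDist (interior C)ᶜ x y - t)) + η := by
  have hR := hC.radius_pos
  have hC' := hC.mono_pos hρ
  set L := 12 * R + 1 with hL
  have hL1 : 1 ≤ L := by linarith
  set δ := min 1 (η / (14 * L ^ 2)) with hδ
  have hδ0 : 0 < δ := by positivity
  have hδ1 : δ ≤ 1 := min_le_left _ _
  have hδη : δ * (14 * L ^ 2) ≤ η := (le_div_iff₀ (by positivity)).1 (min_le_right _ _)
  have hδ3 : 14 * δ ≤ η := by nlinarith [mul_le_mul_of_nonneg_left hL1 hδ0.le, mul_pos hδ0 hδ0]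
  obtain ⟨N, ν, β, hpoly, hPC, r, r1, r2, rD, -, -⟩ := hC.exists_approx h2 hρ hδ0
  obtain ⟨x', hx', rx⟩ := r1 x hx
  obtain ⟨y', hy', ry⟩ := r1 y hy
  obtain ⟨p', hp', rp⟩ := r1 p hp
  set T := pathDist (interior C)ᶜ x y with hT
  set T' := polyDist ν β x' y' with hT'
  have dT := rD x hx y hy x' hx' y' hy' rx ry
  have T0 : 0 ≤ T' := pathDist_nonneg _ _ _
  have bd : ∀ {a b}, a ∈ frontier C → b ∈ frontier C → |pathDist (interior C)ᶜ a b| ≤ L :=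
    fun ha hb => by
      rw [abs_of_nonneg (pathDist_nonneg _ _ _)]
      linarith [hC'.pathDist_le h2 ha hb]
  have bd' : ∀ {a b}, a ∈ frontier (polyhedron ν β) → b ∈ frontier (polyhedron ν β) →
      |polyDist ν β a b| ≤ L := fun {a b} ha hb => by
      have : 0 ≤ polyDist ν β a b := pathDist_nonneg _ _ _
      rw [abs_of_nonneg this]
      have := hPC.pathDist_le h2 ha hb
      rw [polyDist]
      linarith
  have bT := bd hx hy
  have bT' := bd' hx' hy'
  rw [← hT] at bT dT
  rw [← hT'] at bT' dT
  obtain ⟨m', hm', m1, m2, m3⟩ := hpoly.exists_comparison h2 hx' hy' hp'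
    (t := min t T') ⟨le_min ht.1 T0, min_le_right _ _⟩
  obtain ⟨m, hm, rm⟩ := r2 m' hm'
  have dxm := rD x hx m hm x' hx' m' hm' rx rm
  have dmy := rD m hm y hy m' hm' y' hy' rm ry
  rw [m1, abs_le] at dxm
  rw [m2, abs_le, ← hT'] at dmy
  have dT2 := abs_le.1 dT
  have dt : |t - min t T'| ≤ δ := by
    rw [abs_of_nonneg (sub_nonneg.2 (min_le_left _ _))]
    rcases min_cases t T' with ⟨h, -⟩ | ⟨h, -⟩ <;> rw [h] <;> linarith [ht.2]
  have dt2 := abs_le.1 dt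
  have t0 : 0 ≤ min t T' := le_min ht.1 T0
  have tT := min_le_right t T'
  refine ⟨m, hm, by linarith [min_le_left t T'], by linarith, ?_⟩
  have := comparison_perturb (T := T) (t := t)
        (by rw [abs_of_nonneg ht.1]; linarith [ht.2, le_abs_self T])
    (bd hx hp) (bd hy hp) (bd hm hp) bT' (t' := min t T')
    (by rw [abs_of_nonneg t0]; linarith [le_abs_self T']) (bd' hx' hp') (bd' hm' hp') (bd' hy' hp')
    (by rw [abs_of_nonneg (by linarith [ht.2])]; linarith [ht.1, le_abs_self T])
    (by rw [abs_of_nonneg (by linarith)]; linarith [le_abs_self T']) dT dt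
    (rD x hx p hp x' hx' p' hp' rx rp) (rD y hy p hp y' hy' p' hp' ry rp)
    (rD m hm p hp m' hm' p' hp' rm rp) m3
  linarith

/-- In a chart, the distance to a point away from the chart is, up to a quadratic term,
the difference of the graph function and a convex function. -/
theorem IsChart.convexOn_chart (h2 : 2 ≤ Module.finrank ℝ E) (hC : IsChart C c e (2 * ρ) R)
    (hρ : 0 < ρ) {p : E} (hp : p ∈ frontier C) {W : Set E} (hW : Convex ℝ W) (hWo : IsOpen W)
    (hWb : W ⊆ Metric.ball c ρ) {r₀ : ℝ} (hr₀ : 0 < r₀)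
    (hr : ∀ y ∈ W, r₀ ≤ pathDist (interior C)ᶜ (lowerPoint C e y) p) :
    ConvexOn ℝ W fun y => (1 + 4 * R / ρ) ^ 2 / r₀ * ‖y‖ ^ 2 +
      lowerHeight C e y - pathDist (interior C)ᶜ (lowerPoint C e y) p := by
  refine ⟨hW, fun y hy z hz a b ha hb hab => ?_⟩
  refine le_of_forall_pos_le_add fun ε hε => ?_
  set η := min (r₀ / 2) (ε / 4) with hη
  have hη0 : 0 < η := by positivity
  have hη1 : η ≤ r₀ / 2 := min_le_left _ _
  have hη2 : η ≤ ε / 4 := min_le_right _ _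
  obtain ⟨N, ν, β, hpoly, hPC, r, r1, -, -, rφ, rψ⟩ := hC.exists_approx h2 hρ hη0
  obtain ⟨p', hp', rp⟩ := r1 p hp
  have key := (hpoly.convexOn_chart h2 hPC hp' hW hWo hWb (r₀ := r₀ / 2) (by positivity)
    fun w hw => by
      have := abs_le.1 (rψ w (hWb hw) p hp p' hp' rp)
      linarith [hr w hw, this.2]).2 hy hz ha hb hab
  rw [mul_div_cancel₀ _ (two_ne_zero)] at key
  simp only [smul_eq_mul] at key ⊢
  have hw := hW hy hz ha hb hab
  have u1 := abs_le.1 (rφ _ (hWb hy))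
  have u2 := abs_le.1 (rφ _ (hWb hz))
  have u3 := abs_le.1 (rφ _ (hWb hw))
  have v1 := abs_le.1 (rψ _ (hWb hy) p hp p' hp' rp)
  have v2 := abs_le.1 (rψ _ (hWb hz) p hp p' hp' rp)
  have v3 := abs_le.1 (rψ _ (hWb hw) p hp p' hp' rp)
  have w1 := mul_le_mul_of_nonneg_left u1.1 ha
  have w2 := mul_le_mul_of_nonneg_left u2.1 hb
  have w3 := mul_le_mul_of_nonneg_left v1.2 ha
  have w4 := mul_le_mul_of_nonneg_left v2.2 hb
  have ab : a * η + b * η = η := by rw [← add_mul, hab, one_mul]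
  linarith [u3.2, v3.1]

end Limits

section DCSurfaces

variable {E : Type*} [NormedAddCommGroup E] [InnerProductSpace ℝ E]

theorem IsDCOn.add {C : Set E} {f g : E → ℝ} (hf : IsDCOn C f) (hg : IsDCOn C g) :
    IsDCOn C fun x => f x + g x := by
  obtain ⟨f₁, f₂, a₁, a₂, b₁, b₂, h⟩ := hf
  obtain ⟨g₁, g₂, c₁, c₂, d₁, d₂, h'⟩ := hg
  refine ⟨fun x => f₁ x + g₁ x, fun x => f₂ x + g₂ x, a₁.add c₁, a₂.add c₂, b₁.add d₁, b₂.add d₂,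
    fun x hx => ?_⟩
  beta_reduce; rw [h x hx, h' x hx]; ring

theorem IsDCOn.const_mul {C : Set E} {f : E → ℝ} (hf : IsDCOn C f) (k : ℝ) :
    IsDCOn C fun x => k * f x := by
  obtain ⟨f₁, f₂, a₁, a₂, b₁, b₂, h⟩ := hf
  rcases le_total 0 k with hk | hk
  · refine ⟨fun x => k * f₁ x, fun x => k * f₂ x, a₁.smul hk, a₂.smul hk,
      continuousOn_const.mul b₁, continuousOn_const.mul b₂, fun x hx => ?_⟩
    beta_reduce; rw [h x hx]; ring
  · have hk' : 0 ≤ -k := by linarith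
    refine ⟨fun x => -k * f₂ x, fun x => -k * f₁ x, a₂.smul hk', a₁.smul hk',
      continuousOn_const.mul b₂, continuousOn_const.mul b₁, fun x hx => ?_⟩
    beta_reduce; rw [h x hx]; ring

theorem isDCOn_const {C : Set E} (hC : Convex ℝ C) (k : ℝ) : IsDCOn C fun _ => k :=
  ⟨fun _ => k, fun _ => 0, convexOn_const _ hC, convexOn_const _ hC, continuousOn_const,
    continuousOn_const, fun _ _ => by ring⟩

theorem ConvexOn.isDCOn_sub [FiniteDimensional ℝ E] {C : Set E} (hC : IsOpen C) {f g h : E → ℝ}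
    (hg : ConvexOn ℝ C g) (hh : ConvexOn ℝ C h) (hf : ∀ x ∈ C, f x = g x - h x) : IsDCOn C f :=
  ⟨g, h, hg, hh, hg.continuousOn hC, hh.continuousOn hC, hf⟩

theorem convexOn_comp_sub {W : Set E} {φ : E → ℝ} (hφ : ConvexOn ℝ W φ) {M : ℝ}
    (hM : ∀ x ∈ W, ∀ y ∈ W, |φ x - φ y| ≤ M * ‖x - y‖) (hM0 : 0 ≤ M) {v w : E} (hv : ‖v‖ = 1)
    {Q : Submodule ℝ E} {V : Set Q} {g₁ g₂ : Q → ℝ} (h₁ : ConvexOn ℝ V g₁) (h₂ : ConvexOn ℝ V g₂)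
    (hV : ∀ z ∈ V, (z : E) + w + (g₁ z - g₂ z) • v ∈ W) :
    ConvexOn ℝ V fun z => φ ((z : E) + w + (g₁ z - g₂ z) • v) + M * (g₁ z + g₂ z) := by
  refine ⟨h₁.1, fun x hx y hy a b ha hb hab => ?_⟩
  have hxy := h₁.1 hx hy ha hb hab
  have k₁ := h₁.2 hx hy ha hb hab
  have k₂ := h₂.2 hx hy ha hb hab
  simp only [smul_eq_mul] at k₁ k₂ ⊢
  have kφ := hφ.2 (hV x hx) (hV y hy) ha hb hab
  have kW := hφ.1 (hV x hx) (hV y hy) ha hb hab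
  have hw : w = a • w + b • w := by rw [← add_smul, hab, one_smul]
  set s := g₁ (a • x + b • y) - g₂ (a • x + b • y)
  set s' := a * (g₁ x - g₂ x) + b * (g₁ y - g₂ y)
  have e1 : a • ((x : E) + w + (g₁ x - g₂ x) • v) + b • ((y : E) + w + (g₁ y - g₂ y) • v)
      = ((a • x + b • y : Q) : E) + w + s' • v := by
    rw [show ((a • x + b • y : Q) : E) = a • (x : E) + b • (y : E) by simp]
    nth_rewrite 3 [hw]
    module
  rw [e1] at kφ kW
  have l := hM _ (hV _ hxy) _ kW
  have e2 : ((a • x + b • y : Q) : E) + w + s • v - (((a • x + b • y : Q) : E) + w + s' • v)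
      = (s - s') • v := by module
  rw [e2, norm_smul, hv, mul_one, Real.norm_eq_abs] at l
  have l1 : |s - s'| ≤ (a * g₁ x + b * g₁ y - g₁ (a • x + b • y)) +
      (a * g₂ x + b * g₂ y - g₂ (a • x + b • y)) := by
    rw [abs_le]
    constructor <;> simp only [s, s'] <;> linarith
  have l2 := mul_le_mul_of_nonneg_left l1 hM0
  simp only [smul_eq_mul] at kφ
  have l3 := le_abs_self (φ (((a • x + b • y : Q) : E) + w + s • v) -
    φ (((a • x + b • y : Q) : E) + w + s' • v))
  linarith

/-- The infimum of `t ↦ F (z + w + t • v) - γ * t` over the parameters for which the argument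
lies in `W`. -/
noncomputable def tiltedInf (F : E → ℝ) (W : Set E) (v w : E) (γ : ℝ) (z : E) : ℝ :=
  sInf ((fun t : ℝ => F (z + w + t • v) - γ * t) '' {t : ℝ | z + w + t • v ∈ W})

section TiltedInf

variable {F : E → ℝ} {W : Set E} {v w : E} {γ : ℝ}

theorem convexOn_tiltedInf (hF : ConvexOn ℝ W F)
    (hb : ∀ z : E,
      BddBelow ((fun t : ℝ => F (z + w + t • v) - γ * t) '' {t : ℝ | z + w + t • v ∈ W}))
    {Q : Submodule ℝ E} :
    ConvexOn ℝ {z : Q | ∃ t : ℝ, (z : E) + w + t • v ∈ W}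
      fun z : Q => tiltedInf F W v w γ (z : E) := by
  have comb : ∀ (x y : Q) (t t' a b : ℝ), a + b = 1 →
      a • ((x : E) + w + t • v) + b • ((y : E) + w + t' • v)
        = ((a • x + b • y : Q) : E) + w + (a * t + b * t') • v := fun x y t t' a b hab => by
    have hw : w = a • w + b • w := by rw [← add_smul, hab, one_smul]
    rw [show ((a • x + b • y : Q) : E) = a • (x : E) + b • (y : E) by simp]
    nth_rewrite 3 [hw]
    module
  refine ⟨fun x ⟨t, ht⟩ y ⟨t', ht'⟩ a b ha hb hab =>
    ⟨a * t + b * t', by rw [← comb _ _ _ _ _ _ hab]; exact hF.1 ht ht' ha hb hab⟩,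
    fun x ⟨t, ht⟩ y ⟨t', ht'⟩ a b ha hb' hab => ?_⟩
  refine le_of_forall_pos_le_add fun ε hε => ?_
  obtain ⟨_, ⟨τ, hτ, rfl⟩, h1⟩ := exists_lt_of_csInf_lt
    (s := (fun t : ℝ => F ((x : E) + w + t • v) - γ * t) '' {t : ℝ | (x : E) + w + t • v ∈ W})
    ⟨_, t, ht, rfl⟩
    (lt_add_of_pos_right (tiltedInf F W v w γ (x : E)) hε)
  obtain ⟨_, ⟨τ', hτ', rfl⟩, h2⟩ := exists_lt_of_csInf_lt
    (s := (fun t : ℝ => F ((y : E) + w + t • v) - γ * t) '' {t : ℝ | (y : E) + w + t • v ∈ W})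
    ⟨_, t', ht', rfl⟩
    (lt_add_of_pos_right (tiltedInf F W v w γ (y : E)) hε)
  have hm : ((a • x + b • y : Q) : E) + w + (a * τ + b * τ') • v ∈ W := by
    rw [← comb _ _ _ _ _ _ hab]; exact hF.1 hτ hτ' ha hb' hab
  have h3 := csInf_le (hb _) ⟨a * τ + b * τ', hm, rfl⟩
  have h4 := hF.2 hτ hτ' ha hb' hab
  rw [comb _ _ _ _ _ _ hab] at h4
  simp only [smul_eq_mul] at h3 h4 ⊢
  have h5 := mul_le_mul_of_nonneg_left h1.le ha
  have h6 := mul_le_mul_of_nonneg_left h2.le hb'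
  have : a * ε + b * ε = ε := by rw [← add_mul, hab, one_mul]
  refine h3.trans ?_
  simp only at h5 h6
  linarith

theorem tiltedInf_eq {z : E} {s : ℝ} (hs : z + w + s • v ∈ W)
    (h : ∀ t : ℝ, z + w + s • v + t • v ∈ W →
      F (z + w + s • v) + γ * t ≤ F (z + w + s • v + t • v)) :
    tiltedInf F W v w γ z = F (z + w + s • v) - γ * s := by
  refine IsLeast.csInf_eq ⟨⟨s, hs, rfl⟩, ?_⟩
  rintro _ ⟨t, ht, rfl⟩
  have e : z + w + s • v + (t - s) • v = z + w + t • v := by module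
  have := h (t - s) (by rw [e]; exact ht)
  rw [e] at this
  linarith

end TiltedInf

theorem isDCSurface_submodule {k : ℕ} (Q : Submodule ℝ E) (hQ : Module.finrank ℝ Q = k) :
    IsDCSurface k (Q : Set E) := by
  refine ⟨⟨0, Q.zero_mem⟩, fun x hx => ⟨Q, hQ, univ, isOpen_univ, mem_univ _, univ, isOpen_univ,
    fun _ => 0, fun x _ => ⟨univ, isOpen_univ, convex_univ, mem_univ _, subset_univ _, fun ℓ => ?_⟩,
    ?_⟩⟩
  · simpa using isDCOn_const convex_univ (0 : ℝ)
  · ext y; simp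

theorem finrank_orthogonal_pair [FiniteDimensional ℝ E] {k : ℕ} (hk : Module.finrank ℝ E = k + 2)
    {e v : E} (he : ‖e‖ = 1) (hv : ‖v‖ = 1) (hev : ⟪e, v⟫ = 0) :
    Module.finrank ℝ (Submodule.span ℝ {e, v})ᗮ = k := by
  have ho : Orthonormal ℝ ![e, v] := by
    constructor
    · intro i; fin_cases i <;> simp [he, hv]
    · intro i j hij; fin_cases i <;> fin_cases j <;> simp_all [real_inner_comm]
  have h1 := finrank_span_eq_card ho.linearIndependent
  rw [Matrix.range_cons, Matrix.range_cons, Matrix.range_empty, union_empty,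
    singleton_union] at h1
  have h2 := Submodule.finrank_add_finrank_orthogonal (Submodule.span ℝ {e, v})
  rw [h1, Fintype.card_fin] at h2
  lia

/-- The points of a graph chart at which a fixed convex function has two fixed supporting slopes
in a fixed direction lie on a DC surface of codimension two. -/
theorem IsChart.exists_isDCSurface [FiniteDimensional ℝ E] {C : Set E} {c e : E} {ρ R : ℝ}
    (hC : IsChart C c e ρ R) {k : ℕ} (hk : Module.finrank ℝ E = k + 2) {v : E} (hv : ‖v‖ = 1)
    (hev : ⟪e, v⟫ = 0) {W : Set E} (hW : Convex ℝ W) (hWo : IsOpen W)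
    (hWb : W ⊆ Metric.ball c ρ) {F : E → ℝ} (hF : ConvexOn ℝ W F) {B : ℝ}
    (hB : ∀ y ∈ W, B ≤ F y) {α β : ℝ} (hαβ : α < β) (κ : ℝ) :
    ∃ T : Set E, IsDCSurface k T ∧ ∀ u ∈ W, ⟪e, u⟫ = κ →
      (∀ t : ℝ, u + t • v ∈ W → F u + α * t ≤ F (u + t • v)) →
      (∀ t : ℝ, u + t • v ∈ W → F u + β * t ≤ F (u + t • v)) → lowerPoint C e u ∈ T := by
  set Q := (Submodule.span ℝ {e, v})ᗮ with hQ
  have hQk : Module.finrank ℝ Q = k := finrank_orthogonal_pair hk hC.unit hv hev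
  have eQ : e ∈ Qᗮ := Submodule.le_orthogonal_orthogonal _ (Submodule.subset_span (by simp))
  have vQ : v ∈ Qᗮ := Submodule.le_orthogonal_orthogonal _ (Submodule.subset_span (by simp))
  set w : E := κ • e with hw
  set P : Set Q := {z : Q | ∃ t : ℝ, (z : E) + w + t • v ∈ W} with hP
  have hPo : IsOpen P := by
    have : P = ⋃ t : ℝ, (fun z : Q => (z : E) + w + t • v) ⁻¹' W := by ext; simp [hP]
    rw [this]
    exact isOpen_iUnion fun t => hWo.preimage (by fun_prop)
  have hbdd : ∀ (γ : ℝ) (z : E), BddBelow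
      ((fun t : ℝ => F (z + w + t • v) - γ * t) '' {t : ℝ | z + w + t • v ∈ W}) := fun γ z => by
    refine ⟨B - |γ| * (ρ + ‖z + w - c‖), ?_⟩
    rintro _ ⟨t, ht, rfl⟩
    have h1 := hB _ ht
    have h2 : |t| ≤ ρ + ‖z + w - c‖ := by
      have h3 := mem_ball_iff_norm.1 (hWb ht)
      have h4 := _root_.norm_sub_le (z + w + t • v - c) (z + w - c)
      rw [show z + w + t • v - c - (z + w - c) = t • v by module, norm_smul, hv, mul_one,
        Real.norm_eq_abs] at h4
      linarith
    have h5 := mul_le_mul_of_nonneg_left h2 (abs_nonneg γ)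
    rw [← abs_mul] at h5
    have := le_abs_self (γ * t)
    linarith
  have hβα : 0 ≤ (β - α)⁻¹ := inv_nonneg.2 (by linarith)
  set g₁ : Q → ℝ := fun z => (β - α)⁻¹ * tiltedInf F W v w α (z : E) with hg₁
  set g₂ : Q → ℝ := fun z => (β - α)⁻¹ * tiltedInf F W v w β (z : E) with hg₂
  have c₁ : ConvexOn ℝ P g₁ := (convexOn_tiltedInf hF (hbdd α)).smul hβα
  have c₂ : ConvexOn ℝ P g₂ := (convexOn_tiltedInf hF (hbdd β)).smul hβα
  have k₁ := c₁.continuousOn hPo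
  have k₂ := c₂.continuousOn hPo
  set f : Q → E := fun z => (z : E) + w + (g₁ z - g₂ z) • v with hf
  have kf : ContinuousOn f P :=
    ((continuous_subtype_val.add continuous_const).continuousOn).add
      ((k₁.sub k₂).smul continuousOn_const)
  set G : Set Q := P ∩ f ⁻¹' W with hG
  have hGo : IsOpen G := kf.isOpen_inter_preimage hPo hWo
  set hh : Q → Qᗮ := fun z => (g₁ z - g₂ z) • (⟨v, vQ⟩ : Qᗮ) +
    (κ + lowerHeight C e (f z)) • (⟨e, eQ⟩ : Qᗮ) with hhh
  have hval : ∀ z : Q, (z : E) + ((hh z : Qᗮ) : E) = lowerPoint C e (f z) := fun z => by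
    simp only [hhh, lowerPoint, hf, hw, Submodule.coe_add, Submodule.coe_smul]
    module
  have hdc : LocallyDCMapOn G hh := fun z hz => by
    obtain ⟨ε, hε, hball⟩ := Metric.isOpen_iff.1 hGo z hz
    refine ⟨Metric.ball z ε, Metric.isOpen_ball, convex_ball _ _, Metric.mem_ball_self hε, hball,
      fun ℓ => ?_⟩
    have hcb := convex_ball z ε
    have d₁ := c₁.subset (fun y hy => (hball hy).1) hcb
    have d₂ := c₂.subset (fun y hy => (hball hy).1) hcb
    have hM0 : 0 ≤ 4 * R / ρ := by
      have := hC.radius_pos; have := hC.pos; positivity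
    have d₃ := convexOn_comp_sub (hC.convexOn.subset (hWb.trans hC.ball_subset_ball) hW)
      (fun x hx y hy => hC.abs_sub_le (hWb hx) (hWb hy)) hM0 hv d₁ d₂ fun y hy => (hball hy).2
    have i₁ : IsDCOn (Metric.ball z ε) fun y => g₁ y - g₂ y :=
      d₁.isDCOn_sub Metric.isOpen_ball d₂ fun _ _ => rfl
    have i₂ : IsDCOn (Metric.ball z ε) fun y => lowerHeight C e (f y) :=
      d₃.isDCOn_sub Metric.isOpen_ball ((d₁.add d₂).smul hM0) fun y _ => by
        simp only [hf, Pi.add_apply, smul_eq_mul]; ring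
    have i₃ := (i₁.const_mul (ℓ ⟨v, vQ⟩)).add
      (((isDCOn_const hcb κ).add i₂).const_mul (ℓ ⟨e, eQ⟩))
    have i₄ : (fun y => ℓ (hh y)) = fun y => ℓ ⟨v, vQ⟩ * (g₁ y - g₂ y) +
        ℓ ⟨e, eQ⟩ * (κ + lowerHeight C e (f y)) := funext fun y => by
      simp only [hhh, map_add, map_smul, smul_eq_mul]
      ring
    rw [i₄]
    exact i₃
  have hmem : ∀ u ∈ W, ⟪e, u⟫ = κ →
      (∀ t : ℝ, u + t • v ∈ W → F u + α * t ≤ F (u + t • v)) →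
      (∀ t : ℝ, u + t • v ∈ W → F u + β * t ≤ F (u + t • v)) → ∃ z ∈ G, f z = u := by
    intro u hu hκ h₁ h₂
    have hee : ⟪e, e⟫ = 1 := by rw [real_inner_self_eq_norm_sq, hC.unit]; norm_num
    have hvv : ⟪v, v⟫ = 1 := by rw [real_inner_self_eq_norm_sq, hv]; norm_num
    have hve : ⟪v, e⟫ = 0 := by rw [real_inner_comm, hev]
    have hz : u - w - ⟪v, u⟫ • v ∈ Q := by
      rw [hQ, Submodule.mem_orthogonal]
      intro y hy
      obtain ⟨a, b, rfl⟩ := Submodule.mem_span_pair.1 hy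
      simp only [hw, inner_add_left, inner_sub_right, real_inner_smul_left, real_inner_smul_right,
        hee, hvv, hve, hev, hκ]
      ring
    have hu' : u - w - ⟪v, u⟫ • v + w + ⟪v, u⟫ • v = u := by abel
    have hzP : (⟨_, hz⟩ : Q) ∈ P := ⟨⟪v, u⟫, by simpa only [hu'] using hu⟩
    have t₁ := tiltedInf_eq (F := F) (W := W) (v := v) (w := w) (γ := α)
      (z := u - w - ⟪v, u⟫ • v) (s := ⟪v, u⟫) (by rwa [hu']) (by rwa [hu'])
    have t₂ := tiltedInf_eq (F := F) (W := W) (v := v) (w := w) (γ := β)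
      (z := u - w - ⟪v, u⟫ • v) (s := ⟪v, u⟫) (by rwa [hu']) (by rwa [hu'])
    have hfu : f ⟨_, hz⟩ = u := by
      simp only [hf, hg₁, hg₂, t₁, t₂, ← mul_sub]
      rw [show F (u - w - ⟪v, u⟫ • v + w + ⟪v, u⟫ • v) - α * ⟪v, u⟫ -
        (F (u - w - ⟪v, u⟫ • v + w + ⟪v, u⟫ • v) - β * ⟪v, u⟫) = (β - α) * ⟪v, u⟫ by ring,
        inv_mul_cancel_left₀ (by linarith), hu']
    exact ⟨_, ⟨hzP, by rw [mem_preimage, hfu]; exact hu⟩, hfu⟩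
  rcases G.eq_empty_or_nonempty with hGe | hGn
  · refine ⟨Q, isDCSurface_submodule Q hQk, fun u hu hκ h₁ h₂ => ?_⟩
    obtain ⟨z, hz, -⟩ := hmem u hu hκ h₁ h₂
    simp [hGe] at hz
  · refine ⟨(fun z : Q => (z : E) + ((hh z : Qᗮ) : E)) '' G, ⟨hGn.image _, fun x _ =>
      ⟨Q, hQk, univ, isOpen_univ, mem_univ _, G, hGo, hh, hdc, inter_univ _⟩⟩,
      fun u hu hκ h₁ h₂ => ?_⟩
    obtain ⟨z, hz, rfl⟩ := hmem u hu hκ h₁ h₂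
    exact ⟨z, hz, hval z⟩

end DCSurfaces

section Kinks

variable {E : Type*} [NormedAddCommGroup E] [InnerProductSpace ℝ E]

/-- A convex function of one variable has two rational supporting slopes at an interior point, or
is differentiable there. -/
theorem ConvexOn.exists_supporting_slopes_or {I : Set ℝ} (hI : IsOpen I) (h0 : (0 : ℝ) ∈ I)
    {g : ℝ → ℝ} (hg : ConvexOn ℝ I g) (g0 : g 0 = 0) :
    (∃ α β : ℚ, α < β ∧ ∀ t ∈ I, (α : ℝ) * t ≤ g t ∧ (β : ℝ) * t ≤ g t) ∨
      ∃ p : ℝ, ∀ ε > 0, ∃ d > 0, ∀ t : ℝ, |t| ≤ d → t ∈ I ∧ g t ≤ p * t + ε * |t| := by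
  obtain ⟨d₀, hd₀, hball⟩ := Metric.isOpen_iff.1 hI 0 h0
  set L : Set ℝ := {q | ∃ t ∈ I, t < 0 ∧ q = g t / t} with hL
  set U : Set ℝ := {q | ∃ t ∈ I, 0 < t ∧ q = g t / t} with hU
  have hLn : L.Nonempty := ⟨_, -(d₀ / 2), hball (by
    rw [mem_ball_zero_iff, Real.norm_eq_abs, abs_neg, abs_of_pos] <;> linarith), by linarith, rfl⟩
  have hUn : U.Nonempty := ⟨_, d₀ / 2, hball (by
    rw [mem_ball_zero_iff, Real.norm_eq_abs, abs_of_pos] <;> linarith), by linarith, rfl⟩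
  have hle : ∀ a ∈ L, ∀ b ∈ U, a ≤ b := by
    rintro _ ⟨t, ht, ht0, rfl⟩ _ ⟨s, hs, hs0, rfl⟩
    have hts : 0 < s - t := by linarith
    have := hg.2 ht hs (show 0 ≤ s / (s - t) by positivity) (show 0 ≤ -t / (s - t) from
      div_nonneg (by linarith) hts.le) (by field_simp; ring)
    simp only [smul_eq_mul] at this
    rw [show s / (s - t) * t + -t / (s - t) * s = 0 by field_simp; ring, g0,
      show s / (s - t) * g t + -t / (s - t) * g s = (s * g t - t * g s) / (s - t) by ring] at this
    have h1 : 0 ≤ s * g t - t * g s := by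
      by_contra h
      exact absurd this (not_le.2 (div_neg_of_neg_of_pos (not_le.1 h) hts))
    rw [div_le_iff_of_neg ht0, div_mul_eq_mul_div, div_le_iff₀ hs0]
    linarith
  have hLb : BddAbove L := hUn.imp fun b hb a ha => hle a ha b hb
  have hUb : BddBelow U := hLn.imp fun a ha b hb => hle a ha b hb
  have hab : sSup L ≤ sInf U := csSup_le hLn fun a ha => le_csInf hUn fun b hb => hle a ha b hb
  rcases hab.lt_or_eq with h | h
  · left
    obtain ⟨α, h1, h2⟩ := exists_rat_btwn h
    obtain ⟨β, h3, h4⟩ := exists_rat_btwn h2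
    refine ⟨α, β, by exact_mod_cast h3, fun t ht => ?_⟩
    rcases lt_trichotomy t 0 with h5 | h5 | h5
    · have h6 : g t / t ≤ sSup L := le_csSup hLb ⟨t, ht, h5, rfl⟩
      constructor <;> rw [← div_le_iff_of_neg h5] <;> linarith
    · simp [h5, g0]
    · have h6 : sInf U ≤ g t / t := csInf_le hUb ⟨t, ht, h5, rfl⟩
      constructor <;> rw [← le_div_iff₀ h5] <;> linarith
  · right
    refine ⟨sInf U, fun ε hε => ?_⟩
    obtain ⟨_, ⟨s, hs, hs0, rfl⟩, h1⟩ := exists_lt_of_csInf_lt hUn (lt_add_of_pos_right (sInf U) hε)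
    obtain ⟨_, ⟨t, ht, ht0, rfl⟩, h2⟩ := exists_lt_of_lt_csSup hLn (sub_lt_self (sSup L) hε)
    rw [h] at h2
    have hpt : ∀ x ∈ I, ∀ r ∈ Icc (0 : ℝ) 1, r * x ∈ I ∧ g (r * x) ≤ r * g x := fun x hx r hr => by
      have e : r • x + (1 - r) • (0 : ℝ) = r * x := by simp
      have m := hg.1 hx h0 hr.1 (sub_nonneg.2 hr.2) (by ring)
      have k := hg.2 hx h0 hr.1 (sub_nonneg.2 hr.2) (by ring)
      rw [e] at m k
      simp only [smul_eq_mul, g0, mul_zero, add_zero] at k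
      exact ⟨m, k⟩
    refine ⟨min s (-t), lt_min hs0 (by linarith), fun x hx => ?_⟩
    have hxs := hx.trans (min_le_left _ _)
    have hxt := hx.trans (min_le_right _ _)
    rcases le_total 0 x with hx0 | hx0
    · rw [abs_of_nonneg hx0] at *
      obtain ⟨m, k⟩ := hpt s hs (x / s) ⟨by positivity, (div_le_one hs0).2 hxs⟩
      rw [div_mul_cancel₀ _ hs0.ne'] at m k
      refine ⟨m, k.trans ?_⟩
      rw [div_mul_eq_mul_div, mul_div_assoc]
      nlinarith [mul_le_mul_of_nonneg_left h1.le hx0]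
    · rw [abs_of_nonpos hx0] at *
      obtain ⟨m, k⟩ := hpt t ht (x / t) ⟨div_nonneg_of_nonpos hx0 ht0.le,
        (div_le_one_of_neg ht0).2 (by linarith)⟩
      rw [div_mul_cancel₀ _ ht0.ne] at m k
      refine ⟨m, k.trans ?_⟩
      rw [div_mul_eq_mul_div, mul_div_assoc]
      nlinarith [mul_le_mul_of_nonpos_left h2.le hx0]

theorem ConvexOn.le_of_forall_direction {ι : Type*} [Fintype ι] [Nonempty ι] {W : Set E}
    {F : E → ℝ} (hF : ConvexOn ℝ W F) {u : E} {b : ι → E} {p : ι → ℝ}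
    (h : ∀ i, ∀ ε > 0, ∃ d > 0, ∀ t : ℝ, |t| ≤ d →
      u + t • b i ∈ W ∧ F (u + t • b i) ≤ F u + p i * t + ε * |t|) {ε : ℝ} (hε : 0 < ε) :
    ∃ d > 0, ∀ a : ι → ℝ, (∀ i, |a i| ≤ d) → u + ∑ i, a i • b i ∈ W ∧
      F (u + ∑ i, a i • b i) ≤ F u + ∑ i, p i * a i + ε * ∑ i, |a i| := by
  choose d hd hW using fun i => h i ε hε
  set N : ℝ := (Fintype.card ι : ℝ) with hN
  have hN0 : 0 < N := Nat.cast_pos.2 Fintype.card_pos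
  refine ⟨(Finset.univ.inf' Finset.univ_nonempty d) / N, div_pos
    ((Finset.lt_inf'_iff _).2 fun i _ => hd i) hN0, fun a ha => ?_⟩
  have ha' : ∀ i, |N * a i| ≤ d i := fun i => by
    rw [abs_mul, abs_of_pos hN0, mul_comm]
    exact ((le_div_iff₀ hN0).1 (ha i)).trans (Finset.inf'_le _ (Finset.mem_univ i))
  have hsum : ∑ _i : ι, N⁻¹ = 1 := by
    rw [Finset.sum_const, Finset.card_univ, nsmul_eq_mul, ← hN, mul_inv_cancel₀ hN0.ne']
  have e : ∑ i, N⁻¹ • (u + (N * a i) • b i) = u + ∑ i, a i • b i := by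
    simp only [smul_add, Finset.sum_add_distrib, smul_smul, inv_mul_cancel_left₀ hN0.ne']
    rw [← Finset.sum_smul, hsum, one_smul]
  have hN1 : ∀ i ∈ Finset.univ (α := ι), 0 ≤ N⁻¹ := fun _ _ => (inv_pos.2 hN0).le
  refine ⟨e ▸ hF.1.sum_mem hN1 hsum fun i _ => (hW i _ (ha' i)).1, ?_⟩
  rw [← e]
  refine (hF.map_sum_le hN1 hsum fun i _ => (hW i _ (ha' i)).1).trans ?_
  refine (Finset.sum_le_sum fun i _ => smul_le_smul_of_nonneg_left (hW i _ (ha' i)).2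
    (inv_pos.2 hN0).le).trans (le_of_eq ?_)
  rw [Finset.mul_sum]
  have e2 : F u = ∑ _i : ι, N⁻¹ * F u := by rw [← Finset.sum_mul, hsum, one_mul]
  nth_rewrite 2 [e2]
  rw [← Finset.sum_add_distrib, ← Finset.sum_add_distrib]
  refine Finset.sum_congr rfl fun i _ => ?_
  rw [abs_mul, abs_of_pos hN0, smul_eq_mul]
  field_simp

/-- A convex function either has two rational supporting slopes in one of the directions of an
orthonormal basis of a hyperplane, or is touched to first order along the hyperplane by every convex
function which supports it. -/
theorem ConvexOn.exists_kink_or {ι : Type*} [Fintype ι] [Nonempty ι] {W : Set E} (hWo : IsOpen W)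
    {F : E → ℝ} (hF : ConvexOn ℝ W F) {u : E} (hu : u ∈ W) {H : Submodule ℝ E}
    (b : OrthonormalBasis ι ℝ H) :
    (∃ (i : ι) (α β : ℚ), α < β ∧ ∀ t : ℝ, u + t • (b i : E) ∈ W →
      F u + α * t ≤ F (u + t • (b i : E)) ∧ F u + β * t ≤ F (u + t • (b i : E))) ∨
    ∀ F₁ : E → ℝ, ConvexOn ℝ W F₁ → (∀ y ∈ W, F₁ y ≤ F y) → F₁ u = F u → ∀ ε > 0, ∃ d > 0,
      ∀ h ∈ H, ‖h‖ ≤ d → u + h ∈ W ∧ F (u + h) - F₁ (u + h) ≤ ε * ‖h‖ := by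
  by_cases hk : ∃ (i : ι) (α β : ℚ), α < β ∧ ∀ t : ℝ, u + t • (b i : E) ∈ W →
      F u + α * t ≤ F (u + t • (b i : E)) ∧ F u + β * t ≤ F (u + t • (b i : E))
  · exact Or.inl hk
  right
  have hdir : ∀ i, ∃ p : ℝ, ∀ ε > 0, ∃ d > 0, ∀ t : ℝ, |t| ≤ d → u + t • (b i : E) ∈ W ∧
      F (u + t • (b i : E)) ≤ F u + p * t + ε * |t| := fun i => by
    set I : Set ℝ := (fun t : ℝ => u + t • (b i : E)) ⁻¹' W with hI
    have hIo : IsOpen I := hWo.preimage (by fun_prop)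
    have comb : ∀ x y r q : ℝ, r + q = 1 → u + (r • x + q • y) • (b i : E) =
        r • (u + x • (b i : E)) + q • (u + y • (b i : E)) := fun x y r q h => by
      have : u = r • u + q • u := by rw [← add_smul, h, one_smul]
      nth_rewrite 1 [this]
      simp only [smul_eq_mul]
      module
    have hg : ConvexOn ℝ I fun t => F (u + t • (b i : E)) - F u := by
      refine ⟨fun x hx y hy r q hr hq h => ?_, fun x hx y hy r q hr hq h => ?_⟩
      · rw [hI, mem_preimage, comb _ _ _ _ h]; exact hF.1 hx hy hr hq h
      · have := hF.2 hx hy hr hq h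
        beta_reduce
        rw [comb _ _ _ _ h]
        have e : F u = r * F u + q * F u := by rw [← add_mul, h, one_mul]
        simp only [smul_eq_mul] at this ⊢
        linarith
    rcases hg.exists_supporting_slopes_or hIo (by simpa [hI] using hu) (by simp) with
      ⟨α, β, hαβ, h⟩ | ⟨p, h⟩
    · refine (hk ⟨i, α, β, hαβ, fun t ht => ?_⟩).elim
      have := h t ht
      constructor <;> linarith [this.1, this.2]
    · refine ⟨p, fun ε hε => ?_⟩
      obtain ⟨d, hd, h⟩ := h ε hε
      exact ⟨d, hd, fun t ht => ⟨(h t ht).1, by linarith [(h t ht).2]⟩⟩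
  choose p hp using hdir
  intro F₁ hF₁ hle heq ε hε
  set N : ℝ := (Fintype.card ι : ℝ) with hN
  have hN0 : 0 < N := Nat.cast_pos.2 Fintype.card_pos
  obtain ⟨d, hd, key⟩ := hF.le_of_forall_direction hp (ε := ε / (2 * N)) (by positivity)
  refine ⟨d, hd, fun h hh hhd => ?_⟩
  set a : ι → ℝ := fun i => ⟪(b i : E), h⟫ with ha
  have ha1 : ∀ i, |a i| ≤ ‖h‖ := fun i => by
    refine (abs_real_inner_le_norm _ _).trans ?_
    have : ‖(b i : E)‖ = 1 := b.orthonormal.1 i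
    rw [this, one_mul]
  have hs : ∑ i, a i • (b i : E) = h := by
    have := congrArg (Subtype.val) (b.sum_repr' ⟨h, hh⟩)
    simpa using this
  have hsum : ∑ i, |a i| ≤ N * ‖h‖ := by
    refine (Finset.sum_le_sum fun i _ => ha1 i).trans (le_of_eq ?_)
    rw [Finset.sum_const, Finset.card_univ, nsmul_eq_mul]
  obtain ⟨m₁, k₁⟩ := key a fun i => (ha1 i).trans hhd
  obtain ⟨m₂, k₂⟩ := key (fun i => -a i) fun i => by rw [abs_neg]; exact (ha1 i).trans hhd
  simp only [neg_smul, Finset.sum_neg_distrib, abs_neg, mul_neg, hs] at m₁ k₁ m₂ k₂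
  refine ⟨m₁, ?_⟩
  have k₃ := hF₁.2 m₁ m₂ (show (0 : ℝ) ≤ 1 / 2 by norm_num) (show (0 : ℝ) ≤ 1 / 2 by norm_num)
    (by norm_num)
  rw [show (1 / 2 : ℝ) • (u + h) + (1 / 2 : ℝ) • (u + -h) = u by module, heq] at k₃
  simp only [smul_eq_mul] at k₃
  have k₄ := hle _ m₂
  have k₅ := mul_le_mul_of_nonneg_left hsum (by positivity : 0 ≤ ε / (2 * N))
  have k₆ : ε / (2 * N) * (N * ‖h‖) = ε * ‖h‖ / 2 := by field_simp
  linarith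

end Kinks

section DistTo

variable {E : Type*} [NormedAddCommGroup E] [InnerProductSpace ℝ E]

/-- The distance to `K` in the exterior of `C`. -/
noncomputable def distTo (C K : Set E) (x : E) : ℝ := ⨅ p : K, pathDist (interior C)ᶜ x p

variable {C K : Set E} {x y p : E}

theorem distTo_le (hp : p ∈ K) : distTo C K x ≤ pathDist (interior C)ᶜ x p :=
  ciInf_le ⟨0, by rintro _ ⟨q, rfl⟩; exact pathDist_nonneg _ _ _⟩ (⟨p, hp⟩ : K)

theorem le_distTo (hK : K.Nonempty) {a : ℝ} (h : ∀ p ∈ K, a ≤ pathDist (interior C)ᶜ x p) :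
    a ≤ distTo C K x :=
  have := hK.to_subtype
  le_ciInf fun p => h p p.2

theorem exists_pathDist_lt (hK : K.Nonempty) {a : ℝ} (h : distTo C K x < a) :
    ∃ p ∈ K, pathDist (interior C)ᶜ x p < a :=
  have := hK.to_subtype
  let ⟨p, hp⟩ := exists_lt_of_ciInf_lt h
  ⟨p, p.2, hp⟩

theorem distTo_le_add (hl : LengthConnected (interior C)ᶜ) (hK : K.Nonempty)
    (hKC : K ⊆ frontier C) (hx : x ∈ frontier C) (hy : y ∈ frontier C) :
    distTo C K x ≤ pathDist (interior C)ᶜ x y + distTo C K y := by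
  rw [← sub_le_iff_le_add']
  refine le_distTo hK fun p hp => ?_
  have := hl.triangle (frontier_subset_compl_interior C hx) (frontier_subset_compl_interior C hy)
    (frontier_subset_compl_interior C (hKC hp))
  have := distTo_le (C := C) (x := x) hp
  linarith

variable [FiniteDimensional ℝ E] {c e : E} {ρ R : ℝ}

theorem IsChart.convexOn_distTo (h2 : 2 ≤ Module.finrank ℝ E) (hC : IsChart C c e (2 * ρ) R)
    (hρ : 0 < ρ) (hK : K.Nonempty) (hKC : K ⊆ frontier C) {W : Set E} (hW : Convex ℝ W)
    (hWo : IsOpen W) (hWb : W ⊆ Metric.ball c ρ) {r₀ : ℝ} (hr₀ : 0 < r₀)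
    (hr : ∀ y ∈ W, r₀ ≤ distTo C K (lowerPoint C e y)) :
    ConvexOn ℝ W fun y => (1 + 4 * R / ρ) ^ 2 / r₀ * ‖y‖ ^ 2 +
      lowerHeight C e y - distTo C K (lowerPoint C e y) := by
  refine ⟨hW, fun y hy z hz a b ha hb hab => ?_⟩
  refine le_of_forall_pos_le_add fun ε hε => ?_
  obtain ⟨p, hp, hlt⟩ := exists_pathDist_lt hK
    (lt_add_of_pos_right (distTo C K (lowerPoint C e (a • y + b • z))) hε)
  have key := (hC.convexOn_chart h2 hρ (hKC hp) hW hWo hWb hr₀ fun w hw =>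
    (hr w hw).trans (distTo_le hp)).2 hy hz ha hb hab
  have k₁ := distTo_le (C := C) (x := lowerPoint C e y) hp
  have k₂ := distTo_le (C := C) (x := lowerPoint C e z) hp
  simp only [smul_eq_mul] at key ⊢
  nlinarith [mul_le_mul_of_nonneg_left k₁ ha, mul_le_mul_of_nonneg_left k₂ hb]

theorem IsChart.lowerPoint_proj (hC : IsChart C c e ρ R) (hx : x ∈ frontier C)
    (hxb : x + (⟪e, c⟫ - ⟪e, x⟫) • e ∈ Metric.ball c (2 * ρ)) (hxc : ⟪e, x⟫ ≤ ⟪e, c⟫) :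
    lowerPoint C e (x + (⟪e, c⟫ - ⟪e, x⟫) • e) = x := by
  have e1 : x + (⟪e, c⟫ - ⟪e, x⟫) • e + (⟪e, x⟫ - ⟪e, c⟫) • e = x := by module
  rw [lowerPoint, hC.lowerHeight_eq hxb (t := ⟪e, x⟫ - ⟪e, c⟫) (by linarith) (by rwa [e1]), e1]

/-- At a point with two distinct nearest points in `K`, the convex function associated with the
distance to `K` in a chart has two supporting slopes in a direction of an orthonormal basis. -/
theorem IsChart.exists_kink (h2 : 2 ≤ Module.finrank ℝ E) (hC : IsChart C c e (2 * ρ) R)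
    (hρ : 0 < ρ) (hKC : K ⊆ frontier C) {W : Set E} (hW : Convex ℝ W)
    (hWo : IsOpen W) (hWb : W ⊆ Metric.ball c ρ) {r₀ : ℝ} (hr₀ : 0 < r₀)
    (hr : ∀ y ∈ W, r₀ ≤ distTo C K (lowerPoint C e y)) {ι : Type*} [Fintype ι] [Nonempty ι]
    (b : OrthonormalBasis ι ℝ (Submodule.span ℝ {e})ᗮ) (hx : x ∈ frontier C)
    (hxW : x + (⟪e, c⟫ - ⟪e, x⟫) • e ∈ W) (hxc : ⟪e, x⟫ < ⟪e, c⟫) {y₁ y₂ : E} (hy₁ : y₁ ∈ K)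
    (hy₂ : y₂ ∈ K) (hne : y₁ ≠ y₂) (hd₁ : pathDist (interior C)ᶜ x y₁ = distTo C K x)
    (hd₂ : pathDist (interior C)ᶜ x y₂ = distTo C K x) {F : E → ℝ}
    (hF : F = fun y => (1 + 4 * R / ρ) ^ 2 / r₀ * ‖y‖ ^ 2 +
      lowerHeight C e y - distTo C K (lowerPoint C e y)) {u : E}
    (hu : u = x + (⟪e, c⟫ - ⟪e, x⟫) • e) :
    ∃ (i : ι) (α β : ℚ), α < β ∧ ∀ t : ℝ, u + t • (b i : E) ∈ W →
      F u + α * t ≤ F (u + t • (b i : E)) ∧ F u + β * t ≤ F (u + t • (b i : E)) := by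
  have hC' := hC.mono_pos hρ
  have hl := hC'.lengthConnected h2
  have hFc : ConvexOn ℝ W F := by
    rw [hF]; exact hC.convexOn_distTo h2 hρ ⟨_, hy₁⟩ hKC hW hWo hWb hr₀ hr
  rw [← hu] at hxW
  rcases hFc.exists_kink_or hWo hxW b with h | h
  · exact h
  exfalso
  have hWb' := hWb.trans hC'.ball_subset_ball
  have hux : lowerPoint C e u = x := by
    rw [hu]; exact hC'.lowerPoint_proj hx (hu ▸ hWb' hxW) hxc.le
  have hs0 : 0 < distTo C K x := by
    have := hr u hxW
    rw [hux] at this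
    linarith
  set s := distTo C K x with hs
  have hd0 : 0 < pathDist (interior C)ᶜ y₂ y₁ :=
    (norm_pos_iff.2 (sub_ne_zero.2 hne.symm)).trans_le
      (hl.norm_sub_le (frontier_subset_compl_interior C (hKC hy₂))
        (frontier_subset_compl_interior C (hKC hy₁)))
  set d := pathDist (interior C)ᶜ y₂ y₁ with hd
  set ε := min (1 / 2) (d ^ 2 / (2 * (6 * s ^ 2 + 1))) with hε
  have hε0 : 0 < ε := by positivity
  have hε1 : ε ≤ 1 / 2 := min_le_left _ _
  have hε2 : ε * (2 * (6 * s ^ 2 + 1)) ≤ d ^ 2 := (le_div_iff₀ (by positivity)).1 (min_le_right _ _)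
  obtain ⟨δ, hδ, key⟩ := h _ (hC.convexOn_chart h2 hρ (hKC hy₁) hW hWo hWb hr₀ fun w hw =>
    (hr w hw).trans (distTo_le hy₁)) (fun y _ => by
      rw [hF]
      have := distTo_le (C := C) (x := lowerPoint C e y) hy₁
      beta_reduce
      linarith) (by rw [hF]; beta_reduce; rw [hux, hd₁]) ε hε0
  set g := ⟪e, c⟫ - ⟪e, x⟫ with hg
  have hg0 : 0 < g := by linarith
  set t := min s (min (δ / 2) (g / 4)) with ht
  have ht0 : 0 < t := by positivity
  have hts : t ≤ s := min_le_left _ _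
  have htδ : t ≤ δ / 2 := (min_le_right _ _).trans (min_le_left _ _)
  have htg : t ≤ g / 4 := (min_le_right _ _).trans (min_le_right _ _)
  obtain ⟨m, hm, m₁, m₂, m₃⟩ := hC.exists_approx_comparison h2 hρ hx (hKC hy₂) (hKC hy₁)
    (t := t) ⟨ht0.le, by rw [hd₂]; exact hts⟩ (η := ε * t) (by positivity)
  rw [hd₂] at m₂ m₃
  rw [hd₁, ← hd] at m₃
  have hεt : ε * t ≤ t := by nlinarith
  have hmx : ‖m - x‖ ≤ t + ε * t :=
    (norm_sub_rev m x).le.trans ((hl.norm_sub_le (frontier_subset_compl_interior C hx)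
      (frontier_subset_compl_interior C hm)).trans m₁)
  have hin : |⟪e, m - x⟫| ≤ ‖m - x‖ := by
    have := abs_real_inner_le_norm e (m - x)
    rwa [hC.unit, one_mul] at this
  have hmc : ⟪e, m⟫ ≤ ⟪e, c⟫ := by
    have h3 := (abs_le.1 hin).2
    rw [inner_sub_right] at h3
    linarith
  have hee : ⟪e, e⟫ = 1 := by rw [real_inner_self_eq_norm_sq, hC.unit]; norm_num
  set h' := (m - x) - ⟪e, m - x⟫ • e with hh'
  have hH : h' ∈ (Submodule.span ℝ {e})ᗮ := by
    rw [Submodule.mem_orthogonal_singleton_iff_inner_right, hh', inner_sub_right,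
      real_inner_smul_right, hee]
    ring
  have hn : ‖h'‖ ≤ ‖m - x‖ := by
    refine le_of_sq_le_sq ?_ (norm_nonneg _)
    rw [hh', norm_sub_sq_real, norm_smul, hC.unit, real_inner_smul_right, real_inner_comm,
      Real.norm_eq_abs, mul_one, sq_abs]
    nlinarith [sq_nonneg ⟪e, m - x⟫]
  obtain ⟨k₁, k₂⟩ := key h' hH (by linarith)
  have hum : u + h' = m + (⟪e, c⟫ - ⟪e, m⟫) • e := by
    rw [hu, hh', inner_sub_right, hg]; module
  have hlm : lowerPoint C e (u + h') = m := by
    have := hWb' k₁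
    rw [hum] at this ⊢
    exact hC'.lowerPoint_proj hm this hmc
  rw [hF] at k₂
  beta_reduce at k₂
  rw [hlm] at k₂
  have k₃ := distTo_le (C := C) (x := m) hy₂
  have k₄ : ε * ‖h'‖ ≤ ε * (2 * t) := mul_le_mul_of_nonneg_left (by linarith) hε0.le
  have k₅ : pathDist (interior C)ᶜ m y₁ ≤ s - t + 3 * ε * t := by linarith
  have k₆ := pow_le_pow_left₀ (pathDist_nonneg (interior C)ᶜ m y₁) k₅ 2
  have k₇ : (s - t + 3 * ε * t) ^ 2 ≤ (s - t) ^ 2 + 6 * s * ε * t := by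
    have : 0 ≤ ε * t ^ 2 * (2 - 3 * ε) := by
      have : 0 ≤ 2 - 3 * ε := by linarith
      positivity
    linarith
  have k₈ := mul_le_mul_of_nonneg_left (k₆.trans k₇) hs0.le
  have k₉ : t * d ^ 2 ≤ t * ((6 * s ^ 2 + 1) * ε) := by linarith
  have := le_of_mul_le_mul_left k₉ ht0
  linarith [sq_pos_of_pos hd0]

end DistTo

section Covering

open Topology

variable {E : Type*} [NormedAddCommGroup E] [InnerProductSpace ℝ E]

/-- `S` is covered by countably many `k`-dimensional DC surfaces. -/
def IsCoverable (k : ℕ) (S : Set E) : Prop :=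
  ∃ 𝒯 : Set (Set E), 𝒯.Countable ∧ (∀ T ∈ 𝒯, IsDCSurface k T) ∧ S ⊆ ⋃₀ 𝒯

theorem IsCoverable.mono {k : ℕ} {S S' : Set E} (h : IsCoverable k S) (hS : S' ⊆ S) :
    IsCoverable k S' :=
  let ⟨𝒯, h₁, h₂, h₃⟩ := h
  ⟨𝒯, h₁, h₂, hS.trans h₃⟩

theorem IsCoverable.iUnion {k : ℕ} {ι : Type*} [Countable ι] {S : ι → Set E}
    (h : ∀ i, IsCoverable k (S i)) : IsCoverable k (⋃ i, S i) := by
  choose 𝒯 h₁ h₂ h₃ using h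
  refine ⟨⋃ i, 𝒯 i, countable_iUnion h₁, fun T hT => ?_, iUnion_subset fun i => (h₃ i).trans
    (sUnion_mono (subset_iUnion _ i))⟩
  obtain ⟨i, hi⟩ := mem_iUnion.1 hT
  exact h₂ i T hi

theorem IsCoverable.exists_seq {k : ℕ} {S : Set E} (h : IsCoverable k S) {T₀ : Set E}
    (hT₀ : IsDCSurface k T₀) : ∃ T : ℕ → Set E, (∀ i, IsDCSurface k (T i)) ∧ S ⊆ ⋃ i, T i := by
  obtain ⟨𝒯, h₁, h₂, h₃⟩ := h
  obtain ⟨T, hT⟩ := (h₁.insert T₀).exists_eq_range (insert_nonempty _ _)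
  refine ⟨T, fun i => ?_, h₃.trans ?_⟩
  · have : T i ∈ insert T₀ 𝒯 := hT ▸ mem_range_self i
    rcases this with h | h
    · rwa [h]
    · exact h₂ _ h
  · rw [← sUnion_range, ← hT]
    exact sUnion_mono (subset_insert _ _)

theorem isCoverable_of_locally [SecondCountableTopology E] {k : ℕ} {S : Set E}
    (h : ∀ x ∈ S, ∃ N ∈ 𝓝 x, IsCoverable k (S ∩ N)) : IsCoverable k S := by
  choose! N hN hS using h
  obtain ⟨t, ht, htc, hcov⟩ := TopologicalSpace.countable_cover_nhdsWithin (s := S) (f := N)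
    fun x hx => mem_nhdsWithin_of_mem_nhds (hN x hx)
  have := htc.to_subtype
  refine (IsCoverable.iUnion (ι := t) (S := fun x => S ∩ N x) fun x => hS x (ht x.2)).mono
    fun x hx => ?_
  obtain ⟨y, hy, hxy⟩ := mem_iUnion₂.1 (hcov hx)
  exact mem_iUnion.2 ⟨⟨y, hy⟩, hx, hxy⟩

/-- The points of the boundary of `C` at positive distance from `K` which have at least two nearest
points in `K`. -/
def multiNearest (C K : Set E) : Set E :=
  {x | x ∈ frontier C ∧ 0 < distTo C K x ∧ ∃ y₁ ∈ K, ∃ y₂ ∈ K, y₁ ≠ y₂ ∧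
    pathDist (interior C)ᶜ x y₁ = distTo C K x ∧ pathDist (interior C)ᶜ x y₂ = distTo C K x}

variable [FiniteDimensional ℝ E] {C K : Set E}

theorem IsConvexBody.exists_isChart (hC : IsConvexBody C) {x : E} (hx : x ∈ frontier C) :
    ∃ (c e : E) (ρ R : ℝ), 0 < ρ ∧ IsChart C c e (2 * ρ) R ∧ c - x = ‖c - x‖ • e ∧
      0 < ‖c - x‖ := by
  obtain ⟨hcomp, hconv, c, hc⟩ := hC
  obtain ⟨ρ, hρ, hball⟩ := Metric.isOpen_iff.1 isOpen_interior c hc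
  obtain ⟨R, hR⟩ := hcomp.isBounded.subset_closedBall c
  have hne : 0 < ‖c - x‖ := norm_pos_iff.2 (sub_ne_zero.2 fun h => hx.2 (h ▸ hc))
  refine ⟨c, ‖c - x‖⁻¹ • (c - x), ρ / 4, R, by positivity, ⟨hconv, hcomp, ?_, by positivity, ?_, hR⟩,
    ?_, hne⟩
  · rw [norm_smul, norm_inv, norm_norm, inv_mul_cancel₀ hne.ne']
  · rw [show 2 * (2 * (ρ / 4)) = ρ by ring]
    exact hball.trans interior_subset
  · rw [smul_smul, mul_inv_cancel₀ hne.ne', one_smul]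

theorem isCoverable_multiNearest_nhds {k : ℕ} (hk : Module.finrank ℝ E = k + 2)
    (hC : IsConvexBody C) (hKC : K ⊆ frontier C) {x : E} (hx : x ∈ multiNearest C K) :
    ∃ N ∈ 𝓝 x, IsCoverable k (multiNearest C K ∩ N) := by
  obtain ⟨hxC, hpos, y, hy, -⟩ := hx
  have h2 : 2 ≤ Module.finrank ℝ E := by lia
  have hK : K.Nonempty := ⟨y, hy⟩
  obtain ⟨c, e, ρ, R, hρ, hch, hcx, hne⟩ := hC.exists_isChart hxC
  have hch' := hch.mono_pos hρ
  have hl := hch'.lengthConnected h2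
  have hR := hch'.radius_pos
  have hee : ⟪e, e⟫ = 1 := by rw [real_inner_self_eq_norm_sq, hch.unit]; norm_num
  set M := 1 + 4 * R / ρ with hM
  have hM0 : 0 < M := by positivity
  set s := distTo C K x with hs
  set δ := min ρ (s / (2 * M)) with hδ
  have hδ0 : 0 < δ := by positivity
  have hδs : δ * (2 * M) ≤ s := (le_div_iff₀ (by positivity)).1 (min_le_right _ _)
  set W := Metric.ball c δ with hW
  have hWb : W ⊆ Metric.ball c ρ := Metric.ball_subset_ball (min_le_left _ _)
  have hin : ⟪e, c⟫ - ⟪e, x⟫ = ‖c - x‖ := by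
    rw [← inner_sub_right, hcx, real_inner_smul_right, hee, mul_one, ← hcx]
  have hxc : x + (⟪e, c⟫ - ⟪e, x⟫) • e = c := by rw [hin, ← hcx]; abel
  have hcρ : c ∈ Metric.ball c ρ := Metric.mem_ball_self hρ
  have hlx : lowerPoint C e c = x := by
    have := hch'.lowerPoint_proj hxC (by rw [hxc]; exact hch'.ball_subset_ball hcρ) (by linarith)
    rwa [hxc] at this
  have hr : ∀ z ∈ W, s / 2 ≤ distTo C K (lowerPoint C e z) := fun z hz => by
    have h1 := hch'.pathDist_lowerPoint_le hcρ (hWb hz)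
    rw [hlx] at h1
    have h3 := distTo_le_add hl hK hKC hxC
      (hch'.lowerPoint_mem_frontier (hch'.ball_subset_ball (hWb hz)))
    have h4 : ‖c - z‖ < δ := by rw [norm_sub_rev]; exact mem_ball_iff_norm.1 hz
    have h5 := mul_le_mul_of_nonneg_left h4.le hM0.le
    linarith
  set F : E → ℝ := fun y => (1 + 4 * R / ρ) ^ 2 / (s / 2) * ‖y‖ ^ 2 +
      lowerHeight C e y - distTo C K (lowerPoint C e y) with hF
  have hWc : Convex ℝ W := convex_ball _ _
  have hWo : IsOpen W := Metric.isOpen_ball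
  have hFc : ConvexOn ℝ W F := hch.convexOn_distTo h2 hρ hK hKC hWc hWo hWb (by positivity) hr
  have hFb : ∀ z ∈ W, -(2 * R) - 12 * R ≤ F z := fun z hz => by
    have hz' := hch'.ball_subset_ball (hWb hz)
    have h1 := (abs_le.1 (hch'.abs_lowerHeight_le hz')).1
    have h3 := (distTo_le hy).trans (hch'.pathDist_le h2 (hch'.lowerPoint_mem_frontier hz') (hKC hy))
    have h4 : 0 ≤ (1 + 4 * R / ρ) ^ 2 / (s / 2) * ‖z‖ ^ 2 := by positivity
    simp only [hF]
    linarith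
  set H := (Submodule.span ℝ {e})ᗮ with hH
  have hHk : Module.finrank ℝ H = k + 1 := by
    have h1 : Module.finrank ℝ (Submodule.span ℝ {e}) + Module.finrank ℝ H = Module.finrank ℝ E :=
      Submodule.finrank_add_finrank_orthogonal _
    have h3 : Module.finrank ℝ (Submodule.span ℝ {e}) = 1 :=
      finrank_span_singleton (by rintro rfl; simp at hee)
    omega
  have : Nonempty (Fin (Module.finrank ℝ H)) := ⟨⟨0, by omega⟩⟩
  set b := stdOrthonormalBasis ℝ H
  have hb : ∀ i, ∀ q : {q : ℚ × ℚ // q.1 < q.2}, ∃ T : Set E, IsDCSurface k T ∧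
      ∀ u ∈ W, ⟪e, u⟫ = ⟪e, c⟫ →
      (∀ t : ℝ, u + t • (b i : E) ∈ W → F u + (q.1.1 : ℝ) * t ≤ F (u + t • (b i : E))) →
      (∀ t : ℝ, u + t • (b i : E) ∈ W → F u + (q.1.2 : ℝ) * t ≤ F (u + t • (b i : E))) →
      lowerPoint C e u ∈ T := fun i q =>
    hch'.exists_isDCSurface hk (b.orthonormal.1 i)
      (Submodule.mem_orthogonal_singleton_iff_inner_right.1 (b i).2) hWc hWo hWb hFc hFb
      (by exact_mod_cast q.2) _
  choose T hT hTm using hb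
  set pr : E → E := fun z => z + (⟪e, c⟫ - ⟪e, z⟫) • e with hpr
  have hprc : Continuous pr := by fun_prop
  refine ⟨pr ⁻¹' W ∩ {z | ⟪e, z⟫ < ⟪e, c⟫}, IsOpen.mem_nhds ((hWo.preimage hprc).inter
    (isOpen_lt (by fun_prop) continuous_const)) ⟨?_, ?_⟩,
    range fun q : Fin _ × {q : ℚ × ℚ // q.1 < q.2} => T q.1 q.2, countable_range _, ?_, ?_⟩
  · rw [mem_preimage, hpr]; beta_reduce; rw [hxc]; exact Metric.mem_ball_self hδ0
  · rw [mem_ofPred_eq]; linarith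
  · rintro _ ⟨q, rfl⟩; exact hT _ _
  · rintro z ⟨⟨hz, -, y₁, hy₁, y₂, hy₂, hy, d₁, d₂⟩, hzW, hzc⟩
    obtain ⟨i, α, β, hαβ, h⟩ := hch.exists_kink h2 hρ hKC hWc hWo hWb (by positivity) hr b hz hzW hzc
      hy₁ hy₂ hy d₁ d₂ hF rfl
    refine ⟨_, ⟨(i, ⟨(α, β), hαβ⟩), rfl⟩, ?_⟩
    have := hTm i ⟨(α, β), hαβ⟩ (pr z) hzW (by
      simp only [hpr, inner_add_right, real_inner_smul_right, hee]; ring)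
      (fun t ht => (h t ht).1) fun t ht => (h t ht).2
    rwa [hpr, hch'.lowerPoint_proj hz (hch'.ball_subset_ball (hWb hzW)) hzc.le] at this

theorem isCoverable_multiNearest {k : ℕ} (hk : Module.finrank ℝ E = k + 2)
    (hC : IsConvexBody C) (hKC : K ⊆ frontier C) : IsCoverable k (multiNearest C K) :=
  isCoverable_of_locally fun _ hx => isCoverable_multiNearest_nhds hk hC hKC hx

theorem mem_multiNearest_sublevel (h2 : 2 ≤ Module.finrank ℝ E) (hC : IsConvexBody C)
    (hK : K.Nonempty) (hKC : K ⊆ frontier C) {x : E} (hx : x ∈ frontier C) {r : ℝ}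
    (hr : r = distTo C K x) {γ₁ γ₂ : ℝ → E}
    (h₁ : IsMinimizingCurveToSet (frontier C) K x r γ₁)
    (h₂ : IsMinimizingCurveToSet (frontier C) K x r γ₂) (hne : ¬ EqOn γ₁ γ₂ (Icc 0 r)) :
    ∃ q : ℚ, x ∈ multiNearest C {p | p ∈ frontier C ∧ distTo C K p ≤ q} := by
  obtain ⟨c, e, ρ, R, hρ, hch, -⟩ := hC.exists_isChart hx
  have hl := (hch.mono_pos hρ).lengthConnected h2
  have sub := frontier_subset_compl_interior C
  have iso : ∀ {γ : ℝ → E}, IsMinimizingCurveToSet (frontier C) K x r γ →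
      ∀ s ∈ Icc 0 r, ∀ t ∈ Icc 0 r, pathDist (interior C)ᶜ (γ s) (γ t) = |s - t| :=
    fun h s hs t ht => by
      rw [← intrinsicDist_frontier_eq h2 hC (h.1 hs) (h.1 ht)]; exact h.2.2.2 s hs t ht
  have lip : ∀ {γ : ℝ → E}, IsMinimizingCurveToSet (frontier C) K x r γ →
      ∀ s ∈ Icc 0 r, ∀ t ∈ Icc 0 r, ‖γ s - γ t‖ ≤ |s - t| := fun h s hs t ht =>
    (hl.norm_sub_le (sub (h.1 hs)) (sub (h.1 ht))).trans_eq (iso h s hs t ht)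
  simp only [EqOn, not_forall] at hne
  obtain ⟨a, ha, hab⟩ := hne
  have ha0 : 0 < a := ha.1.lt_of_ne fun h => hab (by rw [← h, h₁.2.1, h₂.2.1])
  have hd : 0 < ‖γ₁ a - γ₂ a‖ := norm_pos_iff.2 (sub_ne_zero.2 hab)
  obtain ⟨q, hq₁, hq₂⟩ := exists_rat_btwn (show r - a < r - a + min a (‖γ₁ a - γ₂ a‖ / 2) by
    have : 0 < min a (‖γ₁ a - γ₂ a‖ / 2) := by positivity
    linarith)
  have hm₁ := min_le_left a (‖γ₁ a - γ₂ a‖ / 2)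
  have hm₂ := min_le_right a (‖γ₁ a - γ₂ a‖ / 2)
  have hs0 : 0 < r - q := by linarith
  have hs : r - q ∈ Icc 0 r := ⟨hs0.le, by linarith [ha.2]⟩
  have h0 : (0 : ℝ) ∈ Icc 0 r := ⟨le_rfl, ha.1.trans ha.2⟩
  have hr' : r ∈ Icc 0 r := ⟨h0.2, le_rfl⟩
  have mem : ∀ {γ : ℝ → E}, IsMinimizingCurveToSet (frontier C) K x r γ →
      γ (r - q) ∈ {p | p ∈ frontier C ∧ distTo C K p ≤ q} := fun h => by
    refine ⟨h.1 hs, (distTo_le h.2.2.1).trans_eq ?_⟩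
    rw [iso h _ hs _ hr', sub_sub_cancel_left, abs_neg, abs_of_nonneg (by linarith [ha.2])]
  have dist : ∀ {γ : ℝ → E}, IsMinimizingCurveToSet (frontier C) K x r γ →
      pathDist (interior C)ᶜ x (γ (r - q)) = r - q := fun h => by
    have := iso h _ h0 _ hs
    rw [h.2.1] at this
    rw [this, zero_sub, abs_neg, abs_of_pos hs0]
  have heq : distTo C {p | p ∈ frontier C ∧ distTo C K p ≤ q} x = r - q := by
    refine le_antisymm ((distTo_le (mem h₁)).trans_eq (dist h₁)) (le_distTo ⟨_, mem h₁⟩ fun p hp => ?_)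
    have := distTo_le_add hl hK hKC hx hp.1
    linarith [hp.2]
  refine ⟨q, hx, by rw [heq]; exact hs0, _, mem h₁, _, mem h₂, fun h => ?_, by rw [heq, dist h₁],
    by rw [heq, dist h₂]⟩
  have l₁ := lip h₁ _ ha _ hs
  have l₂ := lip h₂ _ hs _ ha
  have l₃ := norm_sub_le_norm_sub_add_norm_sub (γ₁ a) (γ₁ (r - q)) (γ₂ a)
  rw [h] at l₁ l₃
  rw [abs_of_pos (by linarith)] at l₁
  rw [abs_of_neg (by linarith)] at l₂
  linarith

end Covering

/-- Let `n ≥ 2`, `X ⊂ ℝ^{n+1}` a convex surface, `∅ ≠ K ⊆ X` closed.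
The multijoined locus `M(K)`, consisting of the points `x ∈ X` joined to `K` by at least
two different minimal curves realizing `r = d_K(x) = inf_{y ∈ K} dist_X(x,y)`, can be
covered by countably many `(n−1)`-dimensional DC surfaces in `ℝ^{n+1}`. -/
theorem multijoined_locus_covered_by_DC_surfaces (n : ℕ) (hn : 2 ≤ n)
    (X : Set (EuclideanSpace ℝ (Fin (n + 1)))) (hX : IsConvexSurface X)
    (K : Set (EuclideanSpace ℝ (Fin (n + 1)))) (hKne : K.Nonempty) (hKcl : IsClosed K)
    (hKX : K ⊆ X) :
    ∃ T : ℕ → Set (EuclideanSpace ℝ (Fin (n + 1))),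
      (∀ i, IsDCSurface (n - 1) (T i)) ∧
      {x ∈ X | ∃ γ₁ γ₂ : ℝ → EuclideanSpace ℝ (Fin (n + 1)),
          IsMinimizingCurveToSet X K x
            (⨅ y : K, intrinsicDist X x (y : EuclideanSpace ℝ (Fin (n + 1)))) γ₁ ∧
          IsMinimizingCurveToSet X K x
            (⨅ y : K, intrinsicDist X x (y : EuclideanSpace ℝ (Fin (n + 1)))) γ₂ ∧
          ¬ EqOn γ₁ γ₂
            (Icc 0 (⨅ y : K, intrinsicDist X x (y : EuclideanSpace ℝ (Fin (n + 1)))))}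
        ⊆ ⋃ i, T i := by
  obtain ⟨C, hC, rfl⟩ := hX
  have hdim : Module.finrank ℝ (EuclideanSpace ℝ (Fin (n + 1))) = n + 1 :=
    finrank_euclideanSpace_fin
  have h2 : 2 ≤ Module.finrank ℝ (EuclideanSpace ℝ (Fin (n + 1))) := by omega
  obtain ⟨Q, hQ⟩ : ∃ Q : Submodule ℝ (EuclideanSpace ℝ (Fin (n + 1))),
      Module.finrank ℝ Q = n - 1 := by
    have h01 : (0 : Fin (n + 1)) ≠ 1 := by
      rw [Ne, Fin.ext_iff, Fin.val_zero, Fin.val_one', Nat.mod_eq_of_lt (by omega)]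
      omega
    exact ⟨_, finrank_orthogonal_pair (e := EuclideanSpace.single 0 1)
      (v := EuclideanSpace.single 1 1) (by omega) (by simp) (by simp)
      (by rw [EuclideanSpace.inner_single_left]; simp [h01])⟩
  refine IsCoverable.exists_seq (IsCoverable.mono (IsCoverable.iUnion fun q : ℚ =>
    isCoverable_multiNearest (k := n - 1) (by omega) hC
      (K := {p | p ∈ frontier C ∧ distTo C K p ≤ q}) fun p hp => hp.1) ?_)
    (isDCSurface_submodule Q hQ)
  rintro x ⟨hx, γ₁, γ₂, h₁, h₂, hne⟩
  have hr : (⨅ y : K, intrinsicDist (frontier C) x (y : EuclideanSpace ℝ (Fin (n + 1)))) =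
      distTo C K x :=
    iInf_congr fun y => intrinsicDist_frontier_eq h2 hC hx (hKX y.2)
  exact mem_iUnion.2 (mem_multiNearest_sublevel h2 hC hKne hKX hx hr h₁ h₂ hne)
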